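/- Let M ∈ ℕ and let θ_1, θ_2 ∈ Q_M be distinct and nonzero. There exist an absolute constant c ∈ (0,1) and a constant C_M > 0 (depending only on M) such that for every δ ∈ (0,1) and every measurable function f : ℝ → [0,1] supported in [0,1] with ∫_0^1 f ≥ δ, one has ∫_0^1 ∫_0^1 f(x) f(x − θ_1 t) f(x − θ_2 t) dx dt ≥ C_M^{−1} exp(−δ^{−(1−c)}). -/

import Mathlib

open MeasureTheory

/-- `Q_M`: rationals in `[−M, M]` with denominator at most `M`. -/
def QM (M : ℕ) : Set ℝ :=
  {θ : ℝ | |θ| ≤ M ∧ ∃ (N : ℕ) (z : ℤ), 1 ≤ N ∧ N ≤ M ∧ θ = (z : ℝ) / N}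

namespace RothCount

open Finset

section Bohr

variable {G : Type*} [AddCommGroup G] [Fintype G]

open Classical in
/-- The Bohr set of width `r` with frequency set `Γ`. -/
noncomputable def bohr (Γ : Finset (AddChar G ℂ)) (r : ℝ) : Finset G :=
  univ.filter fun x => ∀ γ ∈ Γ, ‖1 - γ x‖ ≤ r

lemma mem_bohr {Γ : Finset (AddChar G ℂ)} {r : ℝ} {x : G} :
    x ∈ bohr Γ r ↔ ∀ γ ∈ Γ, ‖1 - γ x‖ ≤ r := by
  simp [bohr]

lemma bohr_mono (Γ : Finset (AddChar G ℂ)) {r s : ℝ} (h : r ≤ s) : bohr Γ r ⊆ bohr Γ s :=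
  fun _ hx => mem_bohr.2 fun γ hγ => (mem_bohr.1 hx γ hγ).trans h

lemma zero_mem_bohr (Γ : Finset (AddChar G ℂ)) {r : ℝ} (h : 0 ≤ r) : (0 : G) ∈ bohr Γ r :=
  mem_bohr.2 fun γ _ => by simpa using h

lemma bohr_nonempty (Γ : Finset (AddChar G ℂ)) {r : ℝ} (h : 0 ≤ r) : (bohr Γ r).Nonempty :=
  ⟨0, zero_mem_bohr Γ h⟩

lemma norm_one_sub_char_sub (γ : AddChar G ℂ) (x y : G) : ‖1 - γ (x - y)‖ = ‖γ y - γ x‖ := by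
  have h : γ x = γ (x - y) * γ y := by rw [← AddChar.map_add_eq_mul, sub_add_cancel]
  rw [h, show γ y - γ (x - y) * γ y = (1 - γ (x - y)) * γ y by ring, norm_mul,
    AddChar.norm_apply, mul_one]

lemma neg_mem_bohr {Γ : Finset (AddChar G ℂ)} {r : ℝ} {x : G} (hx : x ∈ bohr Γ r) :
    -x ∈ bohr Γ r := mem_bohr.2 fun γ hγ => by
  have := norm_one_sub_char_sub γ 0 x
  rw [zero_sub] at this
  rw [this, AddChar.map_zero_eq_one, norm_sub_rev]
  exact mem_bohr.1 hx γ hγ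

lemma add_mem_bohr {Γ : Finset (AddChar G ℂ)} {r s : ℝ} {x y : G} (hx : x ∈ bohr Γ r)
    (hy : y ∈ bohr Γ s) : x + y ∈ bohr Γ (r + s) := mem_bohr.2 fun γ hγ => by
  have h : 1 - γ (x + y) = (1 - γ x) + γ x * (1 - γ y) := by
    rw [AddChar.map_add_eq_mul]; ring
  rw [h]
  refine (norm_add_le _ _).trans (add_le_add (mem_bohr.1 hx γ hγ) ?_)
  rw [norm_mul, AddChar.norm_apply, one_mul]
  exact mem_bohr.1 hy γ hγ

lemma sub_mem_bohr {Γ : Finset (AddChar G ℂ)} {r s : ℝ} {x y : G} (hx : x ∈ bohr Γ r)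
    (hy : y ∈ bohr Γ s) : x - y ∈ bohr Γ (r + s) :=
  sub_eq_add_neg x y ▸ add_mem_bohr hx (neg_mem_bohr hy)

lemma nsmul_mem_bohr {Γ : Finset (AddChar G ℂ)} {r : ℝ} {x : G} (hx : x ∈ bohr Γ r) (m : ℕ) :
    m • x ∈ bohr Γ (m * r) := by
  induction m with
  | zero => simpa using zero_mem_bohr Γ le_rfl
  | succ m ih =>
    rw [succ_nsmul]
    push_cast
    rw [add_mul, one_mul]
    exact add_mem_bohr ih hx

lemma zsmul_mem_bohr {Γ : Finset (AddChar G ℂ)} {r : ℝ} {x : G} (hx : x ∈ bohr Γ r) (m : ℤ) :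
    m • x ∈ bohr Γ (|(m : ℝ)| * r) := by
  obtain ⟨k, rfl | rfl⟩ := m.eq_nat_or_neg
  · simpa using nsmul_mem_bohr hx k
  · simpa using neg_mem_bohr (nsmul_mem_bohr hx k)

lemma norm_sub_le_of_floor_eq {r : ℝ} (hr : 0 < r) {z w : ℂ}
    (h1 : ⌊2 * z.re / r⌋ = ⌊2 * w.re / r⌋) (h2 : ⌊2 * z.im / r⌋ = ⌊2 * w.im / r⌋) :
    ‖z - w‖ ≤ r := by
  have key : ∀ a b : ℝ, ⌊2 * a / r⌋ = ⌊2 * b / r⌋ → |a - b| ≤ r / 2 := fun a b hab => by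
    have := (Int.abs_sub_lt_one_of_floor_eq_floor hab).le
    rw [← sub_div, ← mul_sub, abs_div, abs_of_pos hr, div_le_one hr, abs_mul, abs_two] at this
    linarith
  calc ‖z - w‖ ≤ |(z - w).re| + |(z - w).im| := Complex.norm_le_abs_re_add_abs_im _
    _ ≤ r / 2 + r / 2 := add_le_add (key _ _ h1) (key _ _ h2)
    _ = r := by ring

lemma card_bohr_ge (Γ : Finset (AddChar G ℂ)) {r : ℝ} (hr : 0 < r) (hr1 : r ≤ 1) :
    (r / 8) ^ (2 * #Γ) * Fintype.card G ≤ #(bohr Γ r) := by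
  classical
  set m : ℤ := ⌈2 / r⌉ with hm
  have hm1 : 2 / r ≤ m := Int.le_ceil _
  have hm2 : (m : ℝ) < 2 / r + 1 := Int.ceil_lt_add_one _
  have hm0 : 0 ≤ m := by
    have : (0 : ℝ) ≤ m := le_trans (by positivity) hm1
    exact_mod_cast this
  let t : Finset (Γ → ℤ × ℤ) := Fintype.piFinset fun _ => Icc (-m) m ×ˢ Icc (-m) m
  let f : G → Γ → ℤ × ℤ := fun x γ => (⌊2 * (γ.1 x).re / r⌋, ⌊2 * (γ.1 x).im / r⌋)
  have hfl : ∀ a : ℝ, |a| ≤ 1 → ⌊2 * a / r⌋ ∈ Icc (-m) m := fun a ha => by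
    have ha' := abs_le.1 ha
    rw [Finset.mem_Icc]
    constructor
    · rw [Int.le_floor]
      push_cast
      have : -(2 / r) ≤ 2 * a / r := by
        rw [← neg_div]
        gcongr
        linarith
      linarith
    · have : 2 * a / r ≤ m := by
        refine le_trans ?_ hm1
        gcongr
        linarith
      have := (Int.floor_le (2 * a / r)).trans this
      exact_mod_cast this
  have hmaps : ∀ x ∈ (univ : Finset G), f x ∈ t := fun x _ => by
    rw [Fintype.mem_piFinset]
    intro γ
    rw [Finset.mem_product]
    have h1 : ‖γ.1 x‖ = 1 := AddChar.norm_apply _ _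
    exact ⟨hfl _ ((Complex.abs_re_le_norm _).trans h1.le),
      hfl _ ((Complex.abs_im_le_norm _).trans h1.le)⟩
  have htn : t.Nonempty := ⟨f 0, hmaps 0 (mem_univ _)⟩
  have htc : (#t : ℝ) ≤ (8 / r) ^ (2 * #Γ) := by
    have : #t = ((2 * m + 1).toNat ^ 2) ^ #Γ := by
      simp only [t, Fintype.card_piFinset, Finset.card_product, Int.card_Icc, prod_const,
        card_univ, Fintype.card_coe]
      rw [show m + 1 - -m = 2 * m + 1 by ring, pow_two]
    rw [this]
    push_cast
    rw [← pow_mul]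
    gcongr
    have : (((2 * m + 1).toNat : ℤ) : ℝ) = 2 * m + 1 := by
      rw [Int.toNat_of_nonneg (by omega)]; push_cast; ring
    have h2 : (((2 * m + 1).toNat : ℕ) : ℝ) = 2 * m + 1 := by exact_mod_cast this
    rw [h2]
    have : (1 : ℝ) ≤ 1 / r := by rw [le_div_iff₀ hr]; linarith
    have h8 : 8 / r = 8 * (1 / r) := by ring
    have h2' : 2 / r = 2 * (1 / r) := by ring
    rw [h8]
    rw [h2'] at hm2
    linarith
  obtain ⟨y, _, hy⟩ := Finset.exists_le_card_fiber_of_nsmul_le_card_of_maps_to (M := ℝ)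
    (b := (r / 8) ^ (2 * #Γ) * Fintype.card G) hmaps htn (by
      rw [nsmul_eq_mul, card_univ, ← mul_assoc]
      have : (#t : ℝ) * (r / 8) ^ (2 * #Γ) ≤ 1 := by
        calc (#t : ℝ) * (r / 8) ^ (2 * #Γ) ≤ (8 / r) ^ (2 * #Γ) * (r / 8) ^ (2 * #Γ) := by gcongr
          _ = 1 := by rw [← mul_pow]; field_simp; simp
      nlinarith [(Nat.cast_nonneg (Fintype.card G) : (0 : ℝ) ≤ _)])
  refine hy.trans ?_
  norm_cast
  have hne : (0 : ℝ) < #{x ∈ (univ : Finset G) | f x = y} := by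
    refine lt_of_lt_of_le ?_ hy
    have : (0 : ℝ) < Fintype.card G := by exact_mod_cast Fintype.card_pos
    positivity
  obtain ⟨x0, hx0⟩ := Finset.card_pos.1 (by exact_mod_cast hne)
  refine Finset.card_le_card_of_injOn (fun x => x - x0) ?_ fun a _ b _ h => by simpa using h
  intro x hx
  simp only [coe_filter, mem_univ, true_and, Set.mem_ofPred_eq, mem_filter] at hx hx0
  rw [Finset.mem_coe, mem_bohr]
  intro γ hγ
  rw [norm_one_sub_char_sub]
  have := congr_fun (hx0.trans hx.symm) ⟨γ, hγ⟩
  simp only [f, Prod.mk.injEq] at this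
  exact norm_sub_le_of_floor_eq hr this.1 this.2

/-- A width at which the Bohr set barely changes in size. -/
def Reg (η Q : ℝ) (Γ : Finset (AddChar G ℂ)) (r : ℝ) : Prop :=
  (1 - η) * #(bohr Γ (r + r / Q)) ≤ #(bohr Γ (r - r / Q))

lemma exists_reg (Γ : Finset (AddChar G ℂ)) {η ρ : ℝ} {K : ℕ} (hK : 2 ≤ K)
    (hη1 : η ≤ 1) (hρ : 0 < ρ) (hρ1 : ρ ≤ 1) (h : (1 - η) ^ K ≤ (ρ / 16) ^ (2 * #Γ)) :
    ∃ r, ρ / 2 ≤ r ∧ r ≤ ρ ∧ Reg η (4 * K) Γ r := by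
  by_contra! hcon
  have hK0 : (0 : ℝ) < K := by positivity
  have hK2 : (2 : ℝ) ≤ K := by exact_mod_cast hK
  set a : ℕ → ℝ := fun j => #(bohr Γ (ρ - 2 * j * (ρ / (4 * K)))) with ha
  have hstep : ∀ j < K, a (j + 1) < (1 - η) * a j := by
    intro j hj
    have hj' : (j : ℝ) + 1 ≤ K := by exact_mod_cast hj
    set r := ρ - (2 * j + 1) * (ρ / (4 * K)) with hr
    have hq : ρ / (4 * K) * (2 * K) = ρ / 2 := by field_simp; norm_num
    have hq0 : 0 < ρ / (4 * K) := by positivity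
    have h1 : ρ / 2 ≤ r := by nlinarith
    have h2 : r ≤ ρ := by nlinarith [(Nat.cast_nonneg j : (0 : ℝ) ≤ j)]
    have h3 : r / (4 * K) ≤ ρ / (4 * K) := by gcongr
    have h4 := hcon r h1 h2
    rw [Reg, not_le] at h4
    refine lt_of_le_of_lt ?_ (lt_of_lt_of_le h4 ?_)
    · simp only [ha]
      norm_cast
      refine card_le_card (bohr_mono _ ?_)
      push_cast
      nlinarith
    · simp only [ha]
      refine mul_le_mul_of_nonneg_left ?_ (by linarith)
      norm_cast
      refine card_le_card (bohr_mono _ ?_)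
      push_cast
      nlinarith
  have hind : ∀ j ≤ K, a j ≤ (1 - η) ^ j * a 0 := by
    intro j hj
    induction j with
    | zero => simp
    | succ j ih =>
      rw [pow_succ]
      nlinarith [hstep j hj, ih (by omega), mul_le_mul_of_nonneg_left (ih (by omega))
        (by linarith : (0 : ℝ) ≤ 1 - η)]
  obtain ⟨k, rfl⟩ : ∃ k, K = k + 1 := ⟨K - 1, by omega⟩
  have hlast := hstep k (by omega)
  have hk := hind k (by omega)
  have hG : a 0 ≤ Fintype.card G := by
    simp only [ha]; exact_mod_cast card_le_univ _
  have hlow : (ρ / 16) ^ (2 * #Γ) * Fintype.card G ≤ a (k + 1) := by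
    have := card_bohr_ge Γ (r := ρ / 2) (by positivity) (by linarith)
    rw [show ρ / 2 / 8 = ρ / 16 by ring] at this
    refine this.trans ?_
    simp only [ha]
    refine Nat.cast_le.2 (card_le_card (bohr_mono _ ?_))
    have : 2 * ((k + 1 : ℕ) : ℝ) * (ρ / (4 * ((k + 1 : ℕ) : ℝ))) = ρ / 2 := by
      field_simp; norm_num
    rw [this]; linarith
  have hfin : (1 - η) ^ (k + 1) * Fintype.card G ≤ a (k + 1) :=
    (mul_le_mul_of_nonneg_right h (Nat.cast_nonneg _)).trans hlow
  have : (1 - η) * a k ≤ (1 - η) ^ (k + 1) * Fintype.card G := by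
    calc (1 - η) * a k ≤ (1 - η) * ((1 - η) ^ k * a 0) :=
          mul_le_mul_of_nonneg_left hk (by linarith)
      _ = (1 - η) ^ (k + 1) * a 0 := by ring
      _ ≤ _ := mul_le_mul_of_nonneg_left hG (pow_nonneg (by linarith) _)
  linarith

end Bohr

section Indicator

variable {G : Type*}

open Classical in
/-- The indicator function of a finite set. -/
noncomputable def ind (A : Finset G) (x : G) : ℝ := if x ∈ A then 1 else 0

lemma ind_nonneg (A : Finset G) (x : G) : 0 ≤ ind A x := by unfold ind; split_ifs <;> norm_num

lemma ind_le_one (A : Finset G) (x : G) : ind A x ≤ 1 := by unfold ind; split_ifs <;> norm_num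

lemma ind_of_mem {A : Finset G} {x : G} (h : x ∈ A) : ind A x = 1 := if_pos h

lemma ind_of_notMem {A : Finset G} {x : G} (h : x ∉ A) : ind A x = 0 := if_neg h

lemma sum_ind_mul [Fintype G] (A : Finset G) (f : G → ℝ) :
    ∑ x, ind A x * f x = ∑ x ∈ A, f x := by
  classical
  simp [ind]

lemma sum_ind [Fintype G] (A : Finset G) : ∑ x, ind A x = #A := by
  have := sum_ind_mul A fun _ => 1
  simpa using this

end Indicator

section Sums

variable {G : Type*} [AddCommGroup G] [Fintype G]

/-- The additive convolution, as an unnormalised sum. -/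
def conv (f g : G → ℝ) (x : G) : ℝ := ∑ y, f y * g (x - y)

/-- The additive correlation, as an unnormalised sum. -/
def corr (f g : G → ℝ) (x : G) : ℝ := ∑ y, f y * g (y + x)

lemma sum_sum_pow_eq {ι β : Type*} [Fintype β] (E : Finset ι) (K L : ι → β → ℝ) (p : ℕ) :
    ∑ z ∈ E, ∑ u ∈ E, (∑ y, K z y * L u y) ^ p =
      ∑ Y : Fin p → β, (∑ z ∈ E, ∏ i, K z (Y i)) * ∑ u ∈ E, ∏ i, L u (Y i) := by
  simp only [Fintype.sum_pow, prod_mul_distrib, sum_mul_sum]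
  rw [sum_congr rfl fun z _ => sum_comm, sum_comm]

lemma conv_sub (F₁ F₂ : G → ℝ) (z u : G) :
    conv F₁ F₂ (u - z) = ∑ y, F₁ (y - z) * F₂ (u - y) := by
  rw [conv, ← Equiv.sum_comp (Equiv.subRight z)]
  refine sum_congr rfl fun y _ => ?_
  simp only [Equiv.subRight_apply]
  congr 2; abel

lemma corr_sub (F : G → ℝ) (z u : G) : corr F F (u - z) = ∑ y, F (y - z) * F (y - u) := by
  rw [corr, ← Equiv.sum_comp (Equiv.subRight u)]
  refine sum_congr rfl fun y _ => ?_
  simp only [Equiv.subRight_apply]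
  rw [mul_comm]; congr 2; abel

lemma corr_sub' (F : G → ℝ) (z u : G) : corr F F (u - z) = ∑ y, F (z - y) * F (u - y) := by
  rw [corr, ← Equiv.sum_comp (Equiv.subLeft z)]
  refine sum_congr rfl fun y _ => ?_
  simp only [Equiv.subLeft_apply]
  congr 2; abel

lemma bil_corr_nonneg (E : Finset G) (F : G → ℝ) (p : ℕ) :
    0 ≤ ∑ z ∈ E, ∑ u ∈ E, corr F F (u - z) ^ p := by
  simp only [corr_sub, sum_sum_pow_eq]
  exact sum_nonneg fun Y _ => mul_self_nonneg _

lemma bil_conv_sq_le (E : Finset G) (F₁ F₂ : G → ℝ) (p : ℕ) :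
    (∑ z ∈ E, ∑ u ∈ E, conv F₁ F₂ (u - z) ^ p) ^ 2 ≤
      (∑ z ∈ E, ∑ u ∈ E, corr F₁ F₁ (u - z) ^ p) *
        ∑ z ∈ E, ∑ u ∈ E, corr F₂ F₂ (u - z) ^ p := by
  simp only [conv_sub, corr_sub F₁, corr_sub' F₂]
  rw [sum_sum_pow_eq, sum_sum_pow_eq, sum_sum_pow_eq]
  refine (sum_mul_sq_le_sq_mul_sq _ _ _).trans (le_of_eq ?_)
  simp only [sq]

end Sums

lemma unbalance_pointwise (x : ℝ) {p : ℕ} (hp : Even p) :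
    0.3 * x ^ p + x ^ (p + 1) - 3 * 0.3 ^ (p + 1) ≤ 2 * (if 0.3 ≤ x then x ^ (p + 1) else 0) := by
  have hodd : Odd (p + 1) := hp.add_one
  have hp3 : (0 : ℝ) ≤ 0.3 ^ p := by positivity
  split_ifs with h
  · have h0 : 0 ≤ x := by linarith
    have : 0 ≤ x ^ p := by positivity
    rw [pow_succ, pow_succ]
    nlinarith
  · push Not at h
    rcases le_or_gt 0 x with h0 | h0
    · have h1 : x ^ p ≤ 0.3 ^ p := pow_le_pow_left₀ h0 h.le p
      have h2 : x ^ (p + 1) ≤ 0.3 ^ (p + 1) := pow_le_pow_left₀ h0 h.le _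
      rw [pow_succ 0.3] at *
      linarith
    · rcases le_or_gt (-0.3) x with h1 | h1
      · have h2 : x ^ p ≤ 0.3 ^ p := by
          rw [← hp.neg_pow x]
          exact pow_le_pow_left₀ (by linarith) (by linarith) p
        have h3 : x ^ (p + 1) ≤ 0 := (hodd.pow_neg h0).le
        rw [pow_succ 0.3] at *
        linarith
      · have h2 : 0 ≤ x ^ p := hp.pow_nonneg x
        rw [pow_succ, pow_succ]
        nlinarith

lemma unbalance {ι : Type*} (s : Finset ι) (g G₀ : ι → ℝ) {p : ℕ} (hp : Even p) (hp12 : 12 ≤ p)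
    (h1 : 0.4 ^ p * #s ≤ ∑ i ∈ s, g i ^ p) (h2 : 0 ≤ ∑ i ∈ s, g i ^ (p + 1))
    (h3 : ∀ i ∈ s, 0 ≤ G₀ i) (h4 : ∀ i ∈ s, g i + 0.98 ≤ G₀ i) :
    1.25 ^ (200 * (p + 1)) * #s ≤ ∑ i ∈ s, G₀ i ^ (200 * (p + 1)) := by
  classical
  rcases s.eq_empty_or_nonempty with rfl | hs
  · simp
  have hn : (0 : ℝ) < #s := by exact_mod_cast hs.card_pos
  set P := s.filter fun i => 0.3 ≤ g i with hP
  have hsum : 2 * 0.2 ^ (p + 1) * #s ≤ 2 * ∑ i ∈ P, g i ^ (p + 1) := by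
    have h := sum_le_sum fun i (_ : i ∈ s) => unbalance_pointwise (g i) hp
    rw [← mul_sum, ← sum_filter, sum_sub_distrib, sum_add_distrib, ← mul_sum, sum_const,
      nsmul_eq_mul] at h
    obtain ⟨m, rfl⟩ := Nat.exists_eq_add_of_le hp12
    have e1 : (31 : ℝ) * 0.3 ^ (12 + m) ≤ 0.4 ^ (12 + m) := by
      have : (0.3 : ℝ) ^ m ≤ 0.4 ^ m := by gcongr; norm_num
      have h0 : (0 : ℝ) ≤ 0.3 ^ m := by positivity
      have h1' : (31 : ℝ) * 0.3 ^ 12 ≤ 0.4 ^ 12 := by norm_num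
      rw [pow_add, pow_add, ← mul_assoc]
      exact mul_le_mul h1' this h0 (by positivity)
    have e2 : (0.2 : ℝ) ^ (12 + m) ≤ 0.3 ^ (12 + m) := by gcongr; norm_num
    have e3 : (0 : ℝ) ≤ 0.2 ^ (12 + m) := by positivity
    have key : (2 * 0.2 ^ (12 + m + 1) : ℝ) ≤ 0.3 * 0.4 ^ (12 + m) - 3 * 0.3 ^ (12 + m + 1) := by
      rw [pow_succ, pow_succ]; linarith
    have := mul_le_mul_of_nonneg_right key hn.le
    rw [← hP] at h
    linarith
  have hcs : (0.04 ^ (p + 1) : ℝ) * #s ^ 2 ≤ #P * ∑ i ∈ s, G₀ i ^ (2 * (p + 1)) := by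
    have hle : (0.2 : ℝ) ^ (p + 1) * #s ≤ ∑ i ∈ P, G₀ i ^ (p + 1) := by
      have hsum' : (0.2 : ℝ) ^ (p + 1) * #s ≤ ∑ i ∈ P, g i ^ (p + 1) := by linarith
      refine hsum'.trans (sum_le_sum fun i hi => ?_)
      have := h4 i (mem_filter.1 hi).1
      exact pow_le_pow_left₀ (by linarith [(mem_filter.1 hi).2]) (by linarith) _
    have h := sum_mul_sq_le_sq_mul_sq P (fun _ => (1 : ℝ)) fun i => G₀ i ^ (p + 1)
    simp only [one_mul, one_pow, sum_const, nsmul_eq_mul, mul_one] at h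
    calc (0.04 ^ (p + 1) : ℝ) * #s ^ 2 = (0.2 ^ (p + 1) * #s) ^ 2 := by
          rw [mul_pow, ← pow_mul, mul_comm (p + 1) 2, pow_mul]; norm_num
      _ ≤ (∑ i ∈ P, G₀ i ^ (p + 1)) ^ 2 := pow_le_pow_left₀ (by positivity) hle 2
      _ ≤ #P * ∑ i ∈ P, (G₀ i ^ (p + 1)) ^ 2 := h
      _ ≤ #P * ∑ i ∈ s, G₀ i ^ (2 * (p + 1)) := by
          refine mul_le_mul_of_nonneg_left ?_ (Nat.cast_nonneg _)
          simp only [← pow_mul, mul_comm (p + 1) 2]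
          exact sum_le_sum_of_subset_of_nonneg (filter_subset _ _) fun i hi _ =>
            pow_nonneg (h3 i hi) _
  rcases le_or_gt ((4 : ℝ) ^ (p + 1) * #s) (∑ i ∈ s, G₀ i ^ (2 * (p + 1))) with hc | hc
  · have hj := pow_sum_div_card_le_sum_pow (s := s) (f := fun i => G₀ i ^ (2 * (p + 1))) (n := 99)
      fun i hi => pow_nonneg (h3 i hi) _
    simp only [← pow_mul] at hj
    rw [show 2 * (p + 1) * (99 + 1) = 200 * (p + 1) by ring] at hj
    refine le_trans ?_ hj
    rw [le_div_iff₀ (by positivity)]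
    calc 1.25 ^ (200 * (p + 1)) * (#s : ℝ) * #s ^ 99
        ≤ 2 ^ (200 * (p + 1)) * (#s : ℝ) * #s ^ 99 := by gcongr; norm_num
      _ = ((4 : ℝ) ^ (p + 1) * #s) ^ (99 + 1) := by
          rw [mul_pow, ← pow_mul, show (4 : ℝ) = 2 ^ 2 by norm_num, ← pow_mul]; ring_nf
      _ ≤ _ := pow_le_pow_left₀ (by positivity) hc _
  · have hPc : (0.01 : ℝ) ^ (p + 1) * #s ≤ #P := by
      have h5 : (0.04 ^ (p + 1) : ℝ) * #s ^ 2 ≤ #P * (4 ^ (p + 1) * #s) :=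
        hcs.trans (mul_le_mul_of_nonneg_left hc.le (Nat.cast_nonneg _))
      have h6 : (0.04 : ℝ) ^ (p + 1) = 0.01 ^ (p + 1) * 4 ^ (p + 1) := by
        rw [← mul_pow]; norm_num
      rw [h6] at h5
      have h7 : (0 : ℝ) < 4 ^ (p + 1) * #s := by positivity
      nlinarith
    calc 1.25 ^ (200 * (p + 1)) * (#s : ℝ) = (1.25 ^ 200) ^ (p + 1) * #s := by rw [pow_mul]
      _ ≤ (0.01 * 1.28 ^ 200) ^ (p + 1) * #s := by gcongr; norm_num
      _ = (0.01 ^ (p + 1) * #s) * 1.28 ^ (200 * (p + 1)) := by rw [mul_pow, pow_mul]; ring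
      _ ≤ #P * 1.28 ^ (200 * (p + 1)) := by gcongr
      _ = ∑ i ∈ P, (1.28 : ℝ) ^ (200 * (p + 1)) := by rw [sum_const, nsmul_eq_mul]
      _ ≤ ∑ i ∈ P, G₀ i ^ (200 * (p + 1)) := sum_le_sum fun i hi =>
          pow_le_pow_left₀ (by norm_num)
            (by linarith [h4 i (mem_filter.1 hi).1, (mem_filter.1 hi).2]) _
      _ ≤ _ := sum_le_sum_of_subset_of_nonneg (filter_subset _ _) fun i hi _ =>
            pow_nonneg (h3 i hi) _

lemma prod_ind {ι G : Type*} [Fintype ι] (X : Finset G) (f : ι → G) (Y : Finset G) (z : G)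
    (h : z ∈ Y ↔ ∀ i, f i ∈ X) : ∏ i, ind X (f i) = ind Y z := by
  by_cases hz : z ∈ Y
  · rw [ind_of_mem hz]
    exact prod_eq_one fun i _ => ind_of_mem (h.1 hz i)
  · rw [ind_of_notMem hz]
    obtain ⟨i, hi⟩ := not_forall.1 fun h' => hz (h.2 h')
    exact prod_eq_zero (mem_univ i) (ind_of_notMem hi)

section Sift

variable {G : Type*} [AddCommGroup G] [Fintype G]

lemma corr_sub_add (F : G → ℝ) (z u : G) :
    corr F F (u - z) = ∑ y, F (y + z) * F (y + u) := by
  rw [corr, ← Equiv.sum_comp (Equiv.addRight z)]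
  refine sum_congr rfl fun y _ => ?_
  simp only [Equiv.coe_addRight]
  congr 2; abel

lemma corr_ind_nonneg (X Y : Finset G) (v : G) : 0 ≤ corr (ind X) (ind Y) v :=
  sum_nonneg fun _ _ => mul_nonneg (ind_nonneg _ _) (ind_nonneg _ _)

lemma sift (X E : Finset G) (hE : E.Nonempty) (hX : X.Nonempty) {α : ℝ} (hα : 0 < α) {q : ℕ}
    (hq : 120 ≤ q)
    (h : (1.25 * (α * #X)) ^ q * #E ^ 2 ≤
      ∑ z ∈ E, ∑ u ∈ E, corr (ind X) (ind X) (u - z) ^ q) :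
    ∃ Y ⊆ E, α ^ q / 2 * #E ≤ #Y ∧
      0.99 * (#Y : ℝ) ^ 2 ≤ ∑ z ∈ Y, ∑ u ∈ Y,
        ind (univ.filter fun v => 1.2 * (α * #X) ≤ corr (ind X) (ind X) v) (z - u) := by
  classical
  set r := corr (ind X) (ind X) with hr
  set S := univ.filter fun v => 1.2 * (α * #X) ≤ r v with hS
  set a := α * (#X : ℝ) with ha
  have ha0 : 0 < a := mul_pos hα (by exact_mod_cast hX.card_pos)
  have hE0 : (0 : ℝ) < #E := by exact_mod_cast hE.card_pos
  let Y : (Fin q → G) → Finset G := fun s => E.filter fun z => ∀ i, s i + z ∈ X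
  have hY : ∀ s, Y s ⊆ E := fun s => filter_subset _ _
  have hprod : ∀ s : Fin q → G, ∀ z ∈ E, ∏ i, ind X (s i + z) = ind (Y s) z := fun s z hz =>
    prod_ind X _ _ z (by simp [Y, hz])
  have hsumY : ∀ s (f : G → ℝ), ∑ z ∈ E, ind (Y s) z * f z = ∑ z ∈ Y s, f z := by
    intro s f
    rw [← sum_subset (hY s) fun z _ hz => by rw [ind_of_notMem hz, zero_mul]]
    exact sum_congr rfl fun z hz => by rw [ind_of_mem hz, one_mul]
  have hfirst : ∑ s, (#(Y s) : ℝ) = #E * (#X : ℝ) ^ q := by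
    have h1 : ∀ s, (#(Y s) : ℝ) = ∑ z ∈ E, ∏ i, ind X (s i + z) := fun s => by
      rw [sum_congr rfl (hprod s)]
      have := hsumY s fun _ => 1
      simpa using this.symm
    simp only [h1]
    rw [sum_comm]
    have h2 : ∀ z ∈ E, ∑ s : Fin q → G, ∏ i, ind X (s i + z) = (#X : ℝ) ^ q := fun z _ => by
      rw [← Fintype.sum_pow (fun y => ind X (y + z)), ← sum_ind X]
      congr 1
      exact Equiv.sum_comp (Equiv.addRight z) (ind X)
    rw [sum_congr rfl h2, sum_const, nsmul_eq_mul]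
  have hpow : ∀ φ : G → ℝ, ∑ s, ∑ z ∈ Y s, ∑ u ∈ Y s, φ (u - z) =
      ∑ z ∈ E, ∑ u ∈ E, r (u - z) ^ q * φ (u - z) := by
    intro φ
    have h1 : ∀ z u : G, r (u - z) ^ q =
        ∑ s : Fin q → G, (∏ i, ind X (s i + z)) * ∏ i, ind X (s i + u) := fun z u => by
      rw [hr, corr_sub_add, Fintype.sum_pow]
      simp only [prod_mul_distrib]
    simp only [h1, sum_mul]
    rw [sum_congr rfl fun z (_ : z ∈ E) => sum_comm (s := E) (t := univ), sum_comm]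
    refine sum_congr rfl fun s _ => ?_
    rw [← hsumY]
    refine sum_congr rfl fun z hz => ?_
    rw [← hsumY, mul_sum]
    exact sum_congr rfl fun u hu => by rw [hprod s z hz, hprod s u hu]; ring
  have hsq : ∑ s, (#(Y s) : ℝ) ^ 2 = ∑ z ∈ E, ∑ u ∈ E, r (u - z) ^ q := by
    have := hpow fun _ => 1
    simpa [sq] using this
  have hbad : ∑ s, ∑ z ∈ Y s, ∑ u ∈ Y s, (1 - ind S (u - z)) ≤ (1.2 * a) ^ q * #E ^ 2 := by
    rw [hpow fun v => 1 - ind S v]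
    calc _ ≤ ∑ z ∈ E, ∑ u ∈ E, (1.2 * a) ^ q := by
          refine sum_le_sum fun z _ => sum_le_sum fun u _ => ?_
          by_cases hv : u - z ∈ S
          · rw [ind_of_mem hv, sub_self, mul_zero]; positivity
          · rw [ind_of_notMem hv, sub_zero, mul_one]
            have : r (u - z) < 1.2 * a := by simpa [hS] using hv
            exact pow_le_pow_left₀ (corr_ind_nonneg X X _) this.le q
      _ = _ := by simp only [sum_const, nsmul_eq_mul]; ring
  by_contra! hcon
  have hpt : ∀ s, (#(Y s) : ℝ) ^ 2 ≤ α ^ q / 2 * #E * #(Y s) +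
      100 * ∑ z ∈ Y s, ∑ u ∈ Y s, (1 - ind S (u - z)) := by
    intro s
    have hD : 0 ≤ ∑ z ∈ Y s, ∑ u ∈ Y s, (1 - ind S (u - z)) :=
      sum_nonneg fun z _ => sum_nonneg fun u _ => by linarith [ind_le_one S (u - z)]
    rcases lt_or_ge (#(Y s) : ℝ) (α ^ q / 2 * #E) with h1 | h1
    · have : (0 : ℝ) ≤ #(Y s) := Nat.cast_nonneg _
      nlinarith
    · have h2 := hcon (Y s) (hY s) h1
      have h3 : ∑ z ∈ Y s, ∑ u ∈ Y s, (1 - ind S (u - z)) =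
          (#(Y s) : ℝ) ^ 2 - ∑ z ∈ Y s, ∑ u ∈ Y s, ind S (z - u) := by
        rw [sum_comm]
        simp only [sum_sub_distrib, sum_const, nsmul_eq_mul, mul_one, sq]
      have : 0 ≤ α ^ q / 2 * #E * (#(Y s) : ℝ) := by positivity
      rw [h3]
      linarith
  have hs := sum_le_sum fun s (_ : s ∈ univ) => hpt s
  rw [hsq, sum_add_distrib, ← mul_sum, ← mul_sum, hfirst] at hs
  have h5 : α ^ q / 2 * #E * (#E * (#X : ℝ) ^ q) = a ^ q / 2 * #E ^ 2 := by
    rw [ha, mul_pow]; ring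
  have h6 : (101 : ℝ) * 1.2 ^ q ≤ 1.25 ^ q := by
    obtain ⟨m, rfl⟩ := Nat.exists_eq_add_of_le hq
    rw [pow_add, pow_add, ← mul_assoc]
    exact mul_le_mul (by norm_num) (by gcongr; norm_num) (by positivity) (by positivity)
  have h7 : (1 : ℝ) ≤ 1.2 ^ q := one_le_pow₀ (by norm_num)
  have h8 : (0 : ℝ) < a ^ q * #E ^ 2 := by positivity
  rw [h5] at hs
  have h9 := h.trans hs
  rw [mul_pow] at h9 hbad
  have h10 : (1.25 ^ q : ℝ) * (a ^ q * #E ^ 2) ≤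
      (1 / 2 + 100 * 1.2 ^ q) * (a ^ q * #E ^ 2) := by linarith
  have := le_of_mul_le_mul_right h10 h8
  linarith

end Sift

open Classical in
lemma card_tail_le {ι : Type*} (U : Finset ι) (X : ι → ℝ) (hX : ∀ u ∈ U, |X u| ≤ 1)
    (h0 : ∑ u ∈ U, X u = 0) {ε : ℝ} (hε : 0 < ε) (hε1 : ε ≤ 1) (ℓ : ℕ) :
    (#((Fintype.piFinset fun _ : Fin ℓ => U).filter fun s => ε * ℓ < ∑ i, X (s i)) : ℝ) ≤
      Real.exp (-(ε ^ 2 * ℓ / 4)) * (#U : ℝ) ^ ℓ := by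
  have hmgf : ∑ u ∈ U, Real.exp (ε / 2 * X u) ≤ Real.exp (ε ^ 2 / 4) * #U := by
    calc ∑ u ∈ U, Real.exp (ε / 2 * X u) ≤ ∑ u ∈ U, (1 + ε / 2 * X u + ε ^ 2 / 4) := by
          refine sum_le_sum fun u hu => ?_
          have hx := hX u hu
          have h1 : |ε / 2 * X u| ≤ 1 := by
            rw [abs_mul, abs_of_pos (by positivity)]
            nlinarith [abs_nonneg (X u)]
          have h2 := (abs_le.1 (Real.abs_exp_sub_one_sub_id_le h1)).2
          have h3 : X u ^ 2 ≤ 1 := by rw [← sq_abs]; nlinarith [abs_nonneg (X u)]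
          nlinarith [sq_nonneg ε, mul_le_mul_of_nonneg_left h3 (sq_nonneg ε)]
      _ = (1 + ε ^ 2 / 4) * #U := by
          rw [sum_add_distrib, sum_add_distrib, ← mul_sum, h0]
          simp only [sum_const, nsmul_eq_mul]; ring
      _ ≤ _ := by
          gcongr
          rw [add_comm]; exact Real.add_one_le_exp _
  calc (#((Fintype.piFinset fun _ : Fin ℓ => U).filter fun s => ε * ℓ < ∑ i, X (s i)) : ℝ)
      = ∑ s ∈ (Fintype.piFinset fun _ : Fin ℓ => U).filter fun s => ε * ℓ < ∑ i, X (s i), 1 := by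
        simp
    _ ≤ ∑ s ∈ (Fintype.piFinset fun _ : Fin ℓ => U).filter fun s => ε * ℓ < ∑ i, X (s i),
          Real.exp (-(ε ^ 2 * ℓ / 2)) * ∏ i, Real.exp (ε / 2 * X (s i)) := by
        refine sum_le_sum fun s hs => ?_
        rw [← Real.exp_sum, ← mul_sum, ← Real.exp_add]
        refine Real.one_le_exp ?_
        have := (mem_filter.1 hs).2
        nlinarith
    _ ≤ ∑ s ∈ Fintype.piFinset fun _ : Fin ℓ => U,
          Real.exp (-(ε ^ 2 * ℓ / 2)) * ∏ i, Real.exp (ε / 2 * X (s i)) :=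
        sum_le_sum_of_subset_of_nonneg (filter_subset _ _) fun s _ _ => by positivity
    _ = Real.exp (-(ε ^ 2 * ℓ / 2)) * (∑ u ∈ U, Real.exp (ε / 2 * X u)) ^ ℓ := by
        rw [← mul_sum, sum_pow']
    _ ≤ Real.exp (-(ε ^ 2 * ℓ / 2)) * (Real.exp (ε ^ 2 / 4) * #U) ^ ℓ := by
        gcongr
    _ = _ := by
        rw [mul_pow, ← mul_assoc, ← Real.exp_nat_mul, ← Real.exp_add]
        congr 2; ring

section CrootSisask

variable {G : Type*} [AddCommGroup G] [Fintype G]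

open Classical in
lemma croot_sisask (S₀ : G → ℝ) (hS0 : ∀ x, 0 ≤ S₀ x) (hS1 : ∀ x, S₀ x ≤ 1)
    {U UB E V : Finset G} (hU : U.Nonempty) (hUB : ∀ u ∈ U, ∀ t ∈ E, u + t ∈ UB)
    {ε : ℝ} (hε : 0 < ε) (hε1 : ε ≤ 1) {ℓ : ℕ} (hℓ : 0 < ℓ) :
    ∃ T ⊆ E, #E * (#U : ℝ) ^ ℓ ≤ 2 * #T * (#UB : ℝ) ^ ℓ ∧ ∃ a : G → ℝ, ∀ t ∈ T,
      ∃ D : Finset G, #D ≤ 4 * Real.exp (-(ε ^ 2 * ℓ / 4)) * #V ∧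
        ∀ v ∈ V, v ∉ D → |a (v + t) - (∑ u ∈ U, S₀ (v - u)) / #U| ≤ ε := by
  have hU0 : (0 : ℝ) < #U := by exact_mod_cast hU.card_pos
  have hℓ0 : (0 : ℝ) < ℓ := by exact_mod_cast hℓ
  set h : G → ℝ := fun v => (∑ u ∈ U, S₀ (v - u)) / #U with hh
  set P := Fintype.piFinset fun _ : Fin ℓ => U with hP
  have hPc : (#P : ℝ) = (#U : ℝ) ^ ℓ := by simp [hP]
  let a : (Fin ℓ → G) → G → ℝ := fun s v => (∑ i, S₀ (v - s i)) / ℓ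
  set β := Real.exp (-(ε ^ 2 * ℓ / 4)) with hβ
  have hβ0 : 0 < β := Real.exp_pos _
  let D : (Fin ℓ → G) → Finset G := fun s => V.filter fun v => ε < |a s v - h v|
  have htail : ∀ v, (#(P.filter fun s => ε < |a s v - h v|) : ℝ) ≤ 2 * β * (#U : ℝ) ^ ℓ := by
    intro v
    have hh0 : 0 ≤ h v := div_nonneg (sum_nonneg fun _ _ => hS0 _) hU0.le
    have hh1 : h v ≤ 1 := by
      rw [hh, div_le_one hU0]
      have := sum_le_card_nsmul U (fun u => S₀ (v - u)) 1 fun u _ => hS1 _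
      simpa using this
    have hX : ∀ u ∈ U, |S₀ (v - u) - h v| ≤ 1 := fun u _ =>
      abs_le.2 ⟨by linarith [hS0 (v - u)], by linarith [hS1 (v - u)]⟩
    have hX0 : ∑ u ∈ U, (S₀ (v - u) - h v) = 0 := by
      rw [sum_sub_distrib, sum_const, nsmul_eq_mul, hh]
      field_simp; ring
    have h1 := card_tail_le U _ hX hX0 hε hε1 ℓ
    have h2 := card_tail_le U (fun u => -(S₀ (v - u) - h v)) (fun u hu => by
      rw [abs_neg]; exact hX u hu) (by rw [sum_neg_distrib, hX0, neg_zero]) hε hε1 ℓ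
    have hsub : P.filter (fun s => ε < |a s v - h v|) ⊆
        P.filter (fun s => ε * ℓ < ∑ i, (S₀ (v - s i) - h v)) ∪
        P.filter (fun s => ε * ℓ < ∑ i, -(S₀ (v - s i) - h v)) := by
      intro s hs
      obtain ⟨hsP, hs⟩ := mem_filter.1 hs
      have e : a s v - h v = (∑ i, (S₀ (v - s i) - h v)) / ℓ := by
        simp only [a, sum_sub_distrib, sum_const, card_univ, Fintype.card_fin, nsmul_eq_mul]
        field_simp
      rw [e, lt_abs, lt_div_iff₀ hℓ0, ← neg_div, lt_div_iff₀ hℓ0] at hs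
      rw [mem_union, mem_filter, mem_filter, sum_neg_distrib]
      exact hs.imp (fun h => ⟨hsP, h⟩) fun h => ⟨hsP, h⟩
    have h3 := (card_le_card hsub).trans (card_union_le _ _)
    have h4 : (#(P.filter fun s => ε < |a s v - h v|) : ℝ) ≤
        (#(P.filter fun s => ε * ℓ < ∑ i, (S₀ (v - s i) - h v)) : ℝ) +
        #(P.filter fun s => ε * ℓ < ∑ i, -(S₀ (v - s i) - h v)) := by exact_mod_cast h3
    linarith
  set Good := P.filter fun s => (#(D s) : ℝ) ≤ 4 * β * #V with hGood
  have hGoodc : (#U : ℝ) ^ ℓ ≤ 2 * #Good := by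
    rcases V.eq_empty_or_nonempty with hV | hV
    · have : Good = P := filter_true_of_mem fun s _ => by simp [D, hV]
      rw [this, hPc]
      have : (0 : ℝ) < (#U : ℝ) ^ ℓ := by positivity
      linarith
    have hV0 : (0 : ℝ) < #V := by exact_mod_cast hV.card_pos
    have h1 : ∑ s ∈ P, (#(D s) : ℝ) ≤ 2 * β * (#U : ℝ) ^ ℓ * #V := by
      calc ∑ s ∈ P, (#(D s) : ℝ)
          = ∑ s ∈ P, ∑ v ∈ V, if ε < |a s v - h v| then (1 : ℝ) else 0 := by simp [D]
        _ = ∑ v ∈ V, (#(P.filter fun s => ε < |a s v - h v|) : ℝ) := by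
            rw [sum_comm]; simp
        _ ≤ ∑ v ∈ V, 2 * β * (#U : ℝ) ^ ℓ := sum_le_sum fun v _ => htail v
        _ = _ := by rw [sum_const, nsmul_eq_mul]; ring
    have h2 : 4 * β * #V * (#P - #Good : ℝ) ≤ ∑ s ∈ P, (#(D s) : ℝ) := by
      calc 4 * β * #V * (#P - #Good : ℝ)
          = ∑ s ∈ P, if (#(D s) : ℝ) ≤ 4 * β * #V then 0 else 4 * β * #V := by
            have := card_filter_add_card_filter_not (s := P) fun s => (#(D s) : ℝ) ≤ 4 * β * #V
            rw [sum_ite, sum_const_zero, zero_add, sum_const, nsmul_eq_mul, ← this, ← hGood]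
            push_cast; ring
        _ ≤ _ := sum_le_sum fun s _ => by
            split_ifs with hc
            · exact Nat.cast_nonneg _
            · exact (not_le.1 hc).le
    rw [hPc] at h2
    have h3 : (4 * β * #V) * ((#U : ℝ) ^ ℓ - #Good) ≤ (4 * β * #V) * ((#U : ℝ) ^ ℓ / 2) := by
      refine (h2.trans h1).trans (le_of_eq ?_)
      ring
    have := le_of_mul_le_mul_left h3 (by positivity)
    linarith
  set W := Fintype.piFinset fun _ : Fin ℓ => UB with hW
  have hWc : (#W : ℝ) = (#UB : ℝ) ^ ℓ := by simp [hW]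
  have hmaps : ∀ x ∈ Good ×ˢ E, (fun i => x.1 i + x.2) ∈ W := by
    rintro ⟨s, t⟩ hx
    obtain ⟨hs, ht⟩ := mem_product.1 hx
    rw [hW, Fintype.mem_piFinset]
    exact fun i => hUB _ (Fintype.mem_piFinset.1 (mem_filter.1 hs).1 i) _ ht
  have hsum := card_eq_sum_card_fiberwise (f := fun x : (Fin ℓ → G) × G => fun i => x.1 i + x.2)
    hmaps
  have hfib : ∀ w, #((Good ×ˢ E).filter fun x => (fun i => x.1 i + x.2) = w) ≤
      #(E.filter fun t => (fun i => w i - t) ∈ Good) := by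
    intro w
    refine card_le_card_of_injOn Prod.snd ?_ ?_
    · rintro ⟨s, t⟩ hx
      obtain ⟨hx', rfl⟩ := mem_filter.1 (mem_coe.1 hx)
      obtain ⟨hs, ht⟩ := mem_product.1 hx'
      rw [mem_coe, mem_filter]
      refine ⟨ht, ?_⟩
      simpa using hs
    · rintro ⟨s, t⟩ hx ⟨s', t'⟩ hx' heq
      obtain ⟨-, hx⟩ := mem_filter.1 (mem_coe.1 hx)
      obtain ⟨-, hx'⟩ := mem_filter.1 (mem_coe.1 hx')
      simp only at heq
      subst heq
      refine Prod.ext (funext fun i => ?_) rfl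
      have := congr_fun (hx.trans hx'.symm) i
      simpa using this
  have hW0 : W.Nonempty ∨ E = ∅ := by
    rcases E.eq_empty_or_nonempty with h | ⟨t, ht⟩
    · exact Or.inr h
    · obtain ⟨u, hu⟩ := hU
      exact Or.inl ⟨fun _ => u + t, Fintype.mem_piFinset.2 fun _ => hUB u hu t ht⟩
  rcases hW0 with hW0 | rfl
  swap
  · exact ⟨∅, Subset.rfl, by simp, fun _ => 0, fun t ht => absurd ht (notMem_empty t)⟩
  obtain ⟨w, -, hw⟩ : ∃ w ∈ W, (#Good * #E : ℝ) / #W ≤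
      #(E.filter fun t => (fun i => w i - t) ∈ Good) := by
    by_contra! hcon
    have h1 := sum_lt_sum_of_nonempty hW0 hcon
    have hWpos : (0 : ℝ) < #W := by exact_mod_cast hW0.card_pos
    rw [sum_const, nsmul_eq_mul, mul_div_cancel₀ _ hWpos.ne'] at h1
    have h2 : (#Good * #E : ℝ) ≤ ∑ w ∈ W, (#(E.filter fun t => (fun i => w i - t) ∈ Good) : ℝ) := by
      rw [card_product] at hsum
      have := hsum.le.trans (sum_le_sum fun w _ => hfib w)
      exact_mod_cast this
    linarith
  refine ⟨E.filter fun t => (fun i => w i - t) ∈ Good, filter_subset _ _, ?_, a w,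
    fun t ht => ?_⟩
  · have hWpos : (0 : ℝ) < #W := by exact_mod_cast hW0.card_pos
    rw [div_le_iff₀ hWpos, hWc] at hw
    have : (0 : ℝ) ≤ #E := Nat.cast_nonneg _
    nlinarith
  · obtain ⟨-, ht⟩ := mem_filter.1 ht
    refine ⟨D fun i => w i - t, (mem_filter.1 ht).2, fun v hv hvD => ?_⟩
    have := not_lt.1 fun hlt => hvD (mem_filter.2 ⟨hv, hlt⟩)
    have e : a w (v + t) = a (fun i => w i - t) v := by
      simp only [a]
      congr 1
      refine sum_congr rfl fun i _ => ?_
      congr 1; abel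
    rw [e]; exact this

end CrootSisask

section Fourier

variable {G : Type*} [AddCommGroup G] [Fintype G]

/-- The Fourier transform, as an unnormalised sum. -/
noncomputable def ft (f : G → ℝ) (γ : AddChar G ℂ) : ℂ := ∑ x, (f x : ℂ) * γ x

lemma sum_norm_ft_sq (f : G → ℝ) :
    ∑ γ, ‖ft f γ‖ ^ 2 = Fintype.card G * ∑ x, f x ^ 2 := by
  classical
  have h : ∀ γ : AddChar G ℂ, ((‖ft f γ‖ ^ 2 : ℝ) : ℂ) =
      ∑ x, ∑ y, (f x * f y : ℂ) * γ (x - y) := fun γ => by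
    push_cast
    rw [← Complex.mul_conj', ft, map_sum, sum_mul_sum]
    refine sum_congr rfl fun x _ => sum_congr rfl fun y _ => ?_
    rw [map_mul, Complex.conj_ofReal, ← AddChar.map_neg_eq_conj, sub_eq_add_neg,
      AddChar.map_add_eq_mul]
    ring
  have : ((∑ γ, ‖ft f γ‖ ^ 2 : ℝ) : ℂ) = ((Fintype.card G * ∑ x, f x ^ 2 : ℝ) : ℂ) := by
    rw [Complex.ofReal_sum, sum_congr rfl fun γ _ => h γ, sum_comm]
    push_cast
    rw [mul_sum]
    refine sum_congr rfl fun x _ => ?_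
    rw [sum_comm]
    simp only [← mul_sum, AddChar.sum_apply_eq_ite, sub_eq_zero]
    simp only [mul_ite, mul_zero, sum_ite_eq, mem_univ, if_true]
    ring
  exact_mod_cast this

lemma ft_corr (σ h : G → ℝ) (γ : AddChar G ℂ) :
    ft (corr σ h) γ = (starRingEnd ℂ) (ft σ γ) * ft h γ := by
  rw [ft, ft, ft, map_sum, sum_mul_sum]
  simp only [corr, Complex.ofReal_sum, sum_mul, Complex.ofReal_mul, map_mul, Complex.conj_ofReal]
  rw [sum_comm]
  refine sum_congr rfl fun x _ => ?_
  rw [← Equiv.sum_comp (Equiv.subRight x)]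
  refine sum_congr rfl fun y _ => ?_
  simp only [Equiv.subRight_apply, add_sub_cancel]
  rw [← AddChar.map_neg_eq_conj, sub_eq_add_neg, AddChar.map_add_eq_mul]
  ring

lemma ft_conv (f h : G → ℝ) (γ : AddChar G ℂ) : ft (conv f h) γ = ft f γ * ft h γ := by
  rw [ft, ft, ft, sum_mul_sum]
  simp only [conv, Complex.ofReal_sum, sum_mul, Complex.ofReal_mul]
  rw [sum_comm]
  refine sum_congr rfl fun x _ => ?_
  rw [← Equiv.sum_comp (Equiv.addRight x)]
  refine sum_congr rfl fun y _ => ?_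
  simp only [Equiv.coe_addRight, add_sub_cancel_right]
  rw [AddChar.map_add_eq_mul]
  ring

lemma norm_ft_le (f : G → ℝ) (γ : AddChar G ℂ) : ‖ft f γ‖ ≤ ∑ x, |f x| :=
  (norm_sum_le _ _).trans <| sum_le_sum fun x _ => by
    rw [norm_mul, AddChar.norm_apply, mul_one, Complex.norm_real, Real.norm_eq_abs]

lemma sum_corr_sq_le (σ h : G → ℝ) {M : ℝ} (hσ : ∀ γ, ‖ft σ γ‖ ≤ M) :
    ∑ x, corr σ h x ^ 2 ≤ M ^ 2 * ∑ x, h x ^ 2 := by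
  have hG : (0 : ℝ) < Fintype.card G := by exact_mod_cast Fintype.card_pos
  refine le_of_mul_le_mul_left ?_ hG
  rw [← sum_norm_ft_sq, mul_left_comm, ← sum_norm_ft_sq, mul_sum]
  refine sum_le_sum fun γ _ => ?_
  rw [ft_corr, norm_mul, mul_pow, RCLike.norm_conj]
  gcongr
  exact hσ γ

end Fourier

lemma sum_one_sub_ind {G : Type*} [Fintype G] (A : Finset G) (f : G → ℝ) :
    ∑ x, ind A x * (1 - f x) = ∑ x ∈ A, (1 - f x) := sum_ind_mul A fun x => 1 - f x

section Regular

variable {G : Type*} [AddCommGroup G] [Fintype G]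

lemma Reg.card_sub_le {η Q r : ℝ} {Γ : Finset (AddChar G ℂ)} (h : Reg η Q Γ r) (hη1 : η ≤ 1)
    (hQ : 0 ≤ r / Q) : (1 - η) * #(bohr Γ r) ≤ #(bohr Γ (r - r / Q)) :=
  le_trans (mul_le_mul_of_nonneg_left
    (Nat.cast_le.2 (card_le_card (bohr_mono Γ (by linarith)))) (by linarith)) h

lemma Reg.sum_shift_le {η Q r : ℝ} {Γ : Finset (AddChar G ℂ)} (h : Reg η Q Γ r) (hη1 : η ≤ 1)
    (hQ : 0 ≤ r / Q) {b : G} (hb : b ∈ bohr Γ (r / Q)) :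
    ∑ x ∈ bohr Γ r, (1 - ind (bohr Γ r) (x + b)) ≤ η * #(bohr Γ r) := by
  have hsub : bohr Γ (r - r / Q) ⊆ bohr Γ r := bohr_mono Γ (by linarith)
  have h1 : (#(bohr Γ (r - r / Q)) : ℝ) ≤ ∑ x ∈ bohr Γ r, ind (bohr Γ r) (x + b) := by
    calc (#(bohr Γ (r - r / Q)) : ℝ) = ∑ x ∈ bohr Γ (r - r / Q), ind (bohr Γ r) (x + b) := by
          rw [sum_congr rfl fun x hx => ind_of_mem (by
            have := add_mem_bohr hx hb; rwa [sub_add_cancel] at this)]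
          simp
      _ ≤ _ := sum_le_sum_of_subset_of_nonneg hsub fun _ _ _ => ind_nonneg _ _
  have h2 := h.card_sub_le hη1 hQ
  rw [sum_sub_distrib, sum_const, nsmul_eq_mul, mul_one]
  linarith

lemma Reg.norm_ft_mul_le {η Q r : ℝ} {Γ : Finset (AddChar G ℂ)} (h : Reg η Q Γ r) (hη1 : η ≤ 1)
    (hQ : 0 ≤ r / Q) {b : G} (hb : b ∈ bohr Γ (r / Q)) (γ : AddChar G ℂ) :
    ‖1 - γ b‖ * ‖ft (ind (bohr Γ r)) γ‖ ≤ 2 * η * #(bohr Γ r) := by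
  set B := bohr Γ r with hB
  have h1 : (1 - γ b) * ft (ind B) γ = ft (fun x => ind B x - ind B (x - b)) γ := by
    have e : γ b * ft (ind B) γ = ∑ x, (ind B (x - b) : ℂ) * γ x := by
      rw [ft, mul_sum, ← Equiv.sum_comp (Equiv.subRight b)]
      refine sum_congr rfl fun x _ => ?_
      simp only [Equiv.subRight_apply]
      rw [mul_left_comm, ← AddChar.map_add_eq_mul, add_sub_cancel]
    rw [sub_mul, one_mul, e, ft, ft, ← sum_sub_distrib]
    refine sum_congr rfl fun x _ => ?_
    push_cast; ring
  rw [← norm_mul, h1]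
  refine (norm_ft_le _ _).trans ?_
  calc ∑ x, |ind B x - ind B (x - b)|
      ≤ ∑ x, (ind B x * (1 - ind B (x + -b)) + ind B (x - b) * (1 - ind B x)) := by
        refine sum_le_sum fun x _ => ?_
        rw [← sub_eq_add_neg]
        have a1 := ind_nonneg B x
        have a2 := ind_nonneg B (x - b)
        have a3 := ind_le_one B x
        have a4 := ind_le_one B (x - b)
        refine abs_le.2 ⟨?_, ?_⟩ <;> nlinarith
    _ = ∑ x ∈ B, (1 - ind B (x + -b)) + ∑ x ∈ B, (1 - ind B (x + b)) := by
        rw [sum_add_distrib, sum_one_sub_ind, ← sum_one_sub_ind B fun x => ind B (x + b)]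
        congr 1
        rw [← Equiv.sum_comp (Equiv.addRight b)]
        simp
    _ ≤ _ := by
        have := h.sum_shift_le hη1 hQ hb
        have := h.sum_shift_le hη1 hQ (neg_mem_bohr hb)
        linarith

end Regular

section Spectral

variable {G : Type*} [AddCommGroup G] [Fintype G]

open Classical in
lemma spectral {η Q r c τ r' : ℝ} {Γ : Finset (AddChar G ℂ)} (hreg : Reg η Q Γ r) (hc : 0 < c)
    (hη : η ≤ 0.005 * c) (hc1 : c ≤ 1) (hQ : 0 ≤ r / Q) {T : Finset G} (hτ : 0 < τ)
    (hr : 0 ≤ r)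
    (hT : T ⊆ bohr Γ r) (hTc : #T = τ * #(bohr Γ r)) {γ : AddChar G ℂ} (hr0 : 0 ≤ r')
    (hr1 : r' ≤ 0.01) (hrQ : r' ≤ r / Q)
    (hdens : ∀ w, ∑ b ∈ bohr (insert γ Γ) r', ind T (w + b) ≤
      1.1 * τ * #(bohr (insert γ Γ) r'))
    (hγ : 0.5 * #T ≤ ‖ft (ind T) γ‖) {b : G} (hb : b ∈ bohr Γ (r / Q)) : ‖1 - γ b‖ ≤ c := by
  by_contra! hcon
  set B := bohr Γ r with hB
  set N := bohr (insert γ Γ) r' with hN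
  have hB0 : (0 : ℝ) < #B := by exact_mod_cast (bohr_nonempty Γ hr).card_pos
  have hN0 : (0 : ℝ) < #N := by exact_mod_cast (bohr_nonempty (insert γ Γ) hr0).card_pos
  have hNsub : N ⊆ bohr Γ (r / Q) := fun x hx => mem_bohr.2 fun χ hχ =>
    (mem_bohr.1 hx χ (mem_insert_of_mem hχ)).trans hrQ
  have hη1 : η ≤ 1 := by linarith
  have hBγ : ‖ft (ind B) γ‖ ≤ 0.01 * #B := by
    have h1 := hreg.norm_ft_mul_le hη1 hQ hb γ
    have h2 : c * ‖ft (ind B) γ‖ ≤ ‖1 - γ b‖ * ‖ft (ind B) γ‖ :=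
      mul_le_mul_of_nonneg_right hcon.le (norm_nonneg _)
    have h3 : c * ‖ft (ind B) γ‖ ≤ c * (0.01 * #B) := by
      refine (h2.trans h1).trans ?_
      nlinarith
    exact le_of_mul_le_mul_left h3 hc
  set F : G → ℝ := fun x => ind T x - τ * ind B x with hF
  have hFγ : 0.49 * (τ * #B) ≤ ‖ft F γ‖ := by
    have e : ft F γ = ft (ind T) γ - τ * ft (ind B) γ := by
      simp only [ft, hF, mul_sum, ← sum_sub_distrib]
      refine sum_congr rfl fun x _ => ?_
      push_cast; ring
    rw [e]
    refine le_trans ?_ (norm_sub_norm_le _ _)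
    rw [norm_mul, Complex.norm_real, Real.norm_of_nonneg hτ.le]
    rw [hTc] at hγ
    nlinarith
  set A : G → ℝ := fun w => ∑ y ∈ N, F (w + y) with hA
  have hAγ : ft A γ = (∑ y ∈ N, γ (-y)) * ft F γ := by
    rw [ft, ft, sum_mul_sum]
    simp only [hA, Complex.ofReal_sum, sum_mul]
    rw [sum_comm]
    refine sum_congr rfl fun y _ => ?_
    rw [← Equiv.sum_comp (Equiv.subRight y)]
    refine sum_congr rfl fun x _ => ?_
    simp only [Equiv.subRight_apply, sub_add_cancel]
    rw [sub_eq_add_neg, AddChar.map_add_eq_mul]; ring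
  have hNγ : 0.99 * #N ≤ ‖∑ y ∈ N, γ (-y)‖ := by
    have h1 : ‖∑ y ∈ N, (1 - γ (-y))‖ ≤ 0.01 * #N := by
      refine (norm_sum_le _ _).trans ?_
      refine (sum_le_card_nsmul N _ 0.01 fun y hy => ?_).trans (by rw [nsmul_eq_mul, mul_comm])
      exact (mem_bohr.1 (neg_mem_bohr hy) γ (mem_insert_self _ _)).trans hr1
    have h2 : (∑ y ∈ N, γ (-y)) = (#N : ℂ) - ∑ y ∈ N, (1 - γ (-y)) := by
      rw [sum_sub_distrib]; simp
    rw [h2]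
    refine le_trans ?_ (norm_sub_norm_le _ _)
    rw [Complex.norm_natCast]
    linarith
  have hlow : 0.48 * (τ * #B * #N) ≤ ∑ w, |A w| := by
    refine le_trans ?_ (norm_ft_le A γ)
    rw [hAγ, norm_mul]
    calc 0.48 * (τ * #B * #N) ≤ (0.99 * #N) * (0.49 * (τ * #B)) := by
          have : 0 < τ * #B * #N := by positivity
          nlinarith
      _ ≤ _ := mul_le_mul hNγ hFγ (by positivity) (norm_nonneg _)
  have hA0 : ∑ w, A w = 0 := by
    simp only [hA]
    rw [sum_comm]
    refine sum_eq_zero fun y _ => ?_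
    have e : ∑ x, F (x + y) = ∑ x, F x := Equiv.sum_comp (Equiv.addRight y) F
    rw [e]
    simp only [hF, sum_sub_distrib, ← mul_sum, sum_ind]
    rw [hTc, sub_self]
  have habs : ∑ w, |A w| = 2 * ∑ w, max (A w) 0 := by
    have : ∀ w, |A w| = 2 * max (A w) 0 - A w := fun w => by
      rcases le_total 0 (A w) with h | h
      · rw [abs_of_nonneg h, max_eq_left h]; ring
      · rw [abs_of_nonpos h, max_eq_right h]; ring
    simp only [this, sum_sub_distrib, ← mul_sum, hA0, sub_zero]
  have hpos : ∀ w, max (A w) 0 ≤ τ * #N * (0.1 * ind B w +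
      1.1 * (ind (bohr Γ (r + r / Q)) w - ind (bohr Γ (r - r / Q)) w)) := by
    intro w
    have hBp : bohr Γ (r - r / Q) ⊆ bohr Γ (r + r / Q) := bohr_mono _ (by linarith)
    have hτN : 0 < τ * #N := by positivity
    have hAw : A w ≤ 1.1 * τ * #N - τ * ∑ y ∈ N, ind B (w + y) := by
      simp only [hA, hF, sum_sub_distrib, ← mul_sum]
      linarith [hdens w]
    by_cases h1 : w ∈ bohr Γ (r - r / Q)
    · have h2 : ∑ y ∈ N, ind B (w + y) = #N := by
        rw [sum_congr rfl fun y hy => ind_of_mem (by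
          have := add_mem_bohr h1 (hNsub hy); rwa [sub_add_cancel] at this)]
        simp
      rw [ind_of_mem h1, ind_of_mem (hBp h1), ind_of_mem (bohr_mono _ (by linarith) h1)]
      rw [h2] at hAw
      refine max_le ?_ ?_ <;> linarith
    · have h3 : 0 ≤ ind B w := ind_nonneg B w
      by_cases h2 : w ∈ bohr Γ (r + r / Q)
      · rw [ind_of_notMem h1, ind_of_mem h2]
        have h4 : 0 ≤ ∑ y ∈ N, ind B (w + y) := sum_nonneg fun _ _ => ind_nonneg _ _
        refine max_le ?_ ?_ <;> nlinarith
      · have hz : ∀ y ∈ N, w + y ∉ B := fun y hy hwy => h2 (by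
          have := sub_mem_bohr hwy (hNsub hy); rwa [add_sub_cancel_right] at this)
        have h4 : A w = 0 := by
          refine sum_eq_zero fun y hy => ?_
          simp only [hF]
          rw [ind_of_notMem (hz y hy), ind_of_notMem fun h => hz y hy (hT h)]; ring
        rw [ind_of_notMem h1, ind_of_notMem h2, h4, max_self]
        nlinarith
  have hsum := sum_le_sum fun w (_ : w ∈ univ) => hpos w
  rw [← mul_sum, sum_add_distrib, ← mul_sum, ← mul_sum, sum_sub_distrib, sum_ind, sum_ind,
    sum_ind] at hsum
  have hm : (#(bohr Γ (r - r / Q)) : ℝ) ≤ #B :=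
    Nat.cast_le.2 (card_le_card (bohr_mono _ (by linarith)))
  rw [Reg] at hreg
  have hp : (#(bohr Γ (r + r / Q)) : ℝ) ≤ 1.01 * #B := by
    have : (0 : ℝ) ≤ #(bohr Γ (r + r / Q)) := Nat.cast_nonneg _
    nlinarith
  have hdiff : (#(bohr Γ (r + r / Q)) : ℝ) - #(bohr Γ (r - r / Q)) ≤ 0.01 * #B := by
    have : η * #(bohr Γ (r + r / Q)) ≤ 0.005 * (1.01 * #B) :=
      mul_le_mul (by linarith) hp (Nat.cast_nonneg _) (by norm_num)
    linarith
  have hτN : 0 < τ * #N := by positivity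
  have h9 : τ * #N * (0.1 * #B + 1.1 * (#(bohr Γ (r + r / Q)) - #(bohr Γ (r - r / Q)))) ≤
      τ * #N * (0.12 * #B) := mul_le_mul_of_nonneg_left (by linarith) hτN.le
  have : 0 < τ * #B * #N := by positivity
  linarith

end Spectral

section Level

variable {G : Type*} [AddCommGroup G] [Fintype G]

/-- A regular Bohr set whose rank and inverse width are controlled by `h`. -/
structure IsLevel (Q η : ℝ) (h : ℕ) (Γ : Finset (AddChar G ℂ)) (r : ℝ) : Prop where
  card_le : #Γ ≤ h
  width : 1 ≤ Q ^ h * r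
  le_one : r ≤ 1
  reg : Reg η Q Γ r

variable (G) in
/-- Every Bohr set of bounded rank and width has a regular width nearby. -/
def HasReg (Q η : ℝ) (H : ℕ) : Prop :=
  ∀ (Γ : Finset (AddChar G ℂ)) (ρ : ℝ), #Γ ≤ H → 1 ≤ Q ^ H * ρ → ρ ≤ 1 →
    ∃ r, ρ / 2 ≤ r ∧ r ≤ ρ ∧ Reg η Q Γ r

variable {Q η : ℝ} {h H : ℕ} {Γ : Finset (AddChar G ℂ)} {r : ℝ}

lemma pow_width_mono (hQ : 1 ≤ Q) {h H : ℕ} (hH : h ≤ H) {r : ℝ} (hr : 1 ≤ Q ^ h * r) :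
    1 ≤ Q ^ H * r := by
  have hr0 : 0 < r := pos_of_mul_pos_right (by linarith) (by positivity : 0 ≤ Q ^ h)
  exact hr.trans (mul_le_mul_of_nonneg_right (pow_le_pow_right₀ hQ hH) hr0.le)

lemma IsLevel.mono (hQ : 1 ≤ Q) (hl : IsLevel Q η h Γ r) (hH : h ≤ H) : IsLevel Q η H Γ r :=
  ⟨hl.card_le.trans hH, pow_width_mono hQ hH hl.width, hl.le_one, hl.reg⟩

lemma IsLevel.pos (hQ : 1 ≤ Q) (hl : IsLevel Q η h Γ r) : 0 < r :=
  pos_of_mul_pos_right (by linarith [hl.width]) (by positivity : 0 ≤ Q ^ h)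

lemma HasReg.exists_level (hH : HasReg G Q η H) (hQ : 2 ≤ Q) (hh : h ≤ H) (hΓ : #Γ ≤ h) {ρ : ℝ}
    (hρ : 1 ≤ Q ^ h * ρ) (hρ1 : ρ ≤ 1) :
    ∃ r, ρ / 2 ≤ r ∧ r ≤ ρ ∧ IsLevel Q η (h + 1) Γ r := by
  obtain ⟨r, h1, h2, h3⟩ := hH Γ ρ (hΓ.trans hh) (pow_width_mono (by linarith) hh hρ) hρ1
  refine ⟨r, h1, h2, hΓ.trans (Nat.le_succ h), ?_, h2.trans hρ1, h3⟩
  have : 0 ≤ Q ^ h := by positivity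
  have hρ0 : 0 < ρ := pos_of_mul_pos_right (by linarith) this
  rw [pow_succ]
  calc (1 : ℝ) ≤ Q ^ h * ρ := hρ
    _ = Q ^ h * 2 * (ρ / 2) := by ring
    _ ≤ Q ^ h * Q * r := by gcongr

end Level

lemma exists_no_increment {R : ℕ → ℝ → Prop} {δ₀ c : ℝ} {J : ℕ} (h0 : R 0 δ₀)
    (hle : ∀ δ, R J δ → δ ≤ 1) (hc : 1 ≤ c) (hδ : 0 ≤ δ₀) (hJ : 1 < c ^ J * δ₀) :
    ∃ j < J, ∃ δ, δ₀ ≤ δ ∧ R j δ ∧ ∀ δ', R (j + 1) δ' → δ' ≤ c * δ := by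
  by_contra! hcon
  have h : ∀ j ≤ J, ∃ δ, c ^ j * δ₀ ≤ δ ∧ R j δ := by
    intro j hj
    induction j with
    | zero => exact ⟨δ₀, by simp, h0⟩
    | succ j ih =>
      obtain ⟨δ, h1, h2⟩ := ih (by omega)
      have h3 : δ₀ ≤ δ := le_trans (le_mul_of_one_le_left hδ (one_le_pow₀ hc)) h1
      obtain ⟨δ', h4, h5⟩ := hcon j (by omega) δ h3 h2
      refine ⟨δ', le_trans ?_ h5.le, h4⟩
      rw [pow_succ, mul_comm _ c, mul_assoc]
      exact mul_le_mul_of_nonneg_left h1 (by linarith)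
  obtain ⟨δ, h1, h2⟩ := h J le_rfl
  linarith [hle δ h2]

section AlmostPeriodic

variable {G : Type*} [AddCommGroup G] [Fintype G]

open Classical in
lemma spectral_level {Q η c τ₀ ρ : ℝ} {H h I : ℕ} (hQ : 100 ≤ Q) (hreg : HasReg G Q η H)
    (hc : 0 < c) (hc1 : c ≤ 1) (hη : η ≤ 0.005 * c) (hH : h + 3 * I ≤ H) (hτ₀ : 0 < τ₀)
    (hI : 1 < 1.1 ^ I * τ₀) {Γ : Finset (AddChar G ℂ)} (hl : IsLevel Q η h Γ ρ) {T : Finset G}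
    (hTs : T ⊆ bohr Γ ρ) (hT : τ₀ * #(bohr Γ ρ) ≤ #T) :
    ∃ Γ' r, Γ ⊆ Γ' ∧ r ≤ ρ ∧ IsLevel Q η (h + 3 * I) Γ' r ∧ ∃ T' : Finset G, T'.Nonempty ∧
      T' ⊆ bohr Γ' r ∧ (∃ y, ∀ t ∈ T', y + t ∈ T) ∧
      ∀ γ, 0.5 * #T' ≤ ‖ft (ind T') γ‖ → ∀ b ∈ bohr Γ' (r / Q), ‖1 - γ b‖ ≤ c := by
  have hQ1 : 1 ≤ Q := by linarith
  have hρ0 := hl.pos hQ1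
  set R : ℕ → ℝ → Prop := fun j δ => ∃ Γ' r, Γ ⊆ Γ' ∧ r ≤ ρ ∧ IsLevel Q η (h + 3 * j) Γ' r ∧
    ∃ y, ∑ b ∈ bohr Γ' r, ind T (y + b) = δ * #(bohr Γ' r) with hR
  have hB0 : (0 : ℝ) < #(bohr Γ ρ) := by exact_mod_cast (bohr_nonempty Γ hρ0.le).card_pos
  have hδ : τ₀ ≤ #T / #(bohr Γ ρ) := (le_div_iff₀ hB0).2 hT
  have h0 : R 0 (#T / #(bohr Γ ρ)) := by
    refine ⟨Γ, ρ, Subset.rfl, le_rfl, hl, 0, ?_⟩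
    rw [div_mul_cancel₀ _ hB0.ne']
    simp only [zero_add]
    rw [← sum_subset hTs fun x _ hx => ind_of_notMem hx, sum_congr rfl fun x hx => ind_of_mem hx]
    simp
  have hle : ∀ δ, R I δ → δ ≤ 1 := by
    rintro δ ⟨Γ', r, -, -, hl', y, hy⟩
    have hB : (0 : ℝ) < #(bohr Γ' r) := by
      exact_mod_cast (bohr_nonempty Γ' (hl'.pos hQ1).le).card_pos
    have h1 : ∑ b ∈ bohr Γ' r, ind T (y + b) ≤ #(bohr Γ' r) := by
      have := sum_le_card_nsmul (bohr Γ' r) (fun b => ind T (y + b)) 1 fun b _ => ind_le_one T _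
      simpa using this
    rw [hy] at h1
    exact le_of_mul_le_mul_right (by linarith) hB
  obtain ⟨j, hj, δ, hδδ, ⟨Γ', r, hΓ, hr, hl', y, hy⟩, hinc⟩ := exists_no_increment h0 hle
    (c := 1.1) (by norm_num) (by positivity)
    (hI.trans_le (mul_le_mul_of_nonneg_left hδ (by positivity)))
  have hδ0 : 0 < δ := by linarith
  have hr0 := hl'.pos hQ1
  have hB : (0 : ℝ) < #(bohr Γ' r) := by exact_mod_cast (bohr_nonempty Γ' hr0.le).card_pos
  set T' := (bohr Γ' r).filter fun b => y + b ∈ T with hT'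
  have hT'c : (#T' : ℝ) = δ * #(bohr Γ' r) := by
    rw [← hy]; simp [hT', ind]
  refine ⟨Γ', r, hΓ, hr, hl'.mono hQ1 (by omega), T', ?_, filter_subset _ _,
    ⟨y, fun t ht => (mem_filter.1 ht).2⟩, fun γ hγ b hb => ?_⟩
  · rw [← card_pos]
    have : (0 : ℝ) < #T' := by rw [hT'c]; positivity
    exact_mod_cast this
  · have hQ0 : 0 < Q := by linarith
    have hw : 1 ≤ Q ^ (h + 3 * j + 1) * min 0.01 (r / Q) := by
      rcases min_choice 0.01 (r / Q) with hm | hm <;> rw [hm]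
      · have : 1 ≤ Q ^ (h + 3 * j) := one_le_pow₀ hQ1
        rw [pow_succ]; nlinarith
      · have := hl'.width
        rw [pow_succ, mul_assoc, mul_div_cancel₀ _ hQ0.ne']; exact this
    obtain ⟨r', hr1, hr2, hl2⟩ := hreg.exists_level (Γ := insert γ Γ') (by linarith)
      (by omega : h + 3 * j + 1 ≤ H) ((card_insert_le _ _).trans (by have := hl'.card_le; omega))
      hw ((min_le_left _ _).trans (by norm_num))
    have hr'0 := hl2.pos hQ1
    refine spectral hl'.reg hc hη hc1 (by positivity) hδ0 hr0.le (filter_subset _ _) hT'c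
      hr'0.le (hr2.trans (min_le_left _ _)) (hr2.trans (min_le_right _ _)) (fun w => ?_) hγ hb
    have hN : (0 : ℝ) < #(bohr (insert γ Γ') r') := by
      exact_mod_cast (bohr_nonempty _ hr'0.le).card_pos
    have h1 := hinc ((∑ b ∈ bohr (insert γ Γ') r', ind T (y + w + b)) / #(bohr (insert γ Γ') r'))
      ⟨insert γ Γ', r', hΓ.trans (subset_insert _ _), ?_, hl2.mono hQ1 (by omega), y + w, by
        rw [div_mul_cancel₀ _ hN.ne']⟩
    · rw [div_le_iff₀ hN] at h1
      refine le_trans (sum_le_sum fun b _ => ?_) h1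
      by_cases hb' : w + b ∈ T'
      · rw [ind_of_mem hb', ind_of_mem (by rw [add_assoc]; exact (mem_filter.1 hb').2)]
      · rw [ind_of_notMem hb']; exact ind_nonneg _ _
    · refine (hr2.trans (min_le_right _ _)).trans (le_trans ?_ hr)
      exact div_le_self hr0.le hQ1

/-- Iterated convolution of a function with itself. -/
noncomputable def iterConv (ψ : G → ℝ) : ℕ → G → ℝ
  | 0 => ind {0}
  | k + 1 => conv ψ (iterConv ψ k)

lemma sum_conv_mul (f g Φ : G → ℝ) :
    ∑ x, conv f g x * Φ x = ∑ x, g x * ∑ v, f v * Φ (v + x) := by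
  simp only [conv, sum_mul, mul_sum]
  rw [sum_comm]
  symm
  rw [sum_comm]
  refine sum_congr rfl fun v _ => ?_
  symm
  rw [← Equiv.sum_comp (Equiv.addLeft v)]
  refine sum_congr rfl fun x _ => ?_
  simp only [Equiv.coe_addLeft, add_sub_cancel_left]
  ring

lemma conv_nonneg {f g : G → ℝ} (hf : ∀ x, 0 ≤ f x) (hg : ∀ x, 0 ≤ g x) (x : G) :
    0 ≤ conv f g x := sum_nonneg fun _ _ => mul_nonneg (hf _) (hg _)

lemma sum_conv (f g : G → ℝ) : ∑ x, conv f g x = (∑ x, f x) * ∑ x, g x := by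
  have := sum_conv_mul f g fun _ => 1
  simp only [mul_one] at this
  rw [this, ← sum_mul, mul_comm]

lemma iterConv_nonneg {ψ : G → ℝ} (hψ : ∀ x, 0 ≤ ψ x) (k : ℕ) (x : G) : 0 ≤ iterConv ψ k x := by
  induction k generalizing x with
  | zero => exact ind_nonneg _ _
  | succ k ih => exact conv_nonneg hψ ih x

lemma sum_iterConv {ψ : G → ℝ} (h1 : ∑ x, ψ x = 1) (k : ℕ) : ∑ x, iterConv ψ k x = 1 := by
  induction k with
  | zero => simp [iterConv, sum_ind]
  | succ k ih => rw [iterConv, sum_conv, h1, ih, one_mul]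

lemma ft_iterConv (ψ : G → ℝ) (k : ℕ) (γ : AddChar G ℂ) : ft (iterConv ψ k) γ = ft ψ γ ^ k := by
  induction k with
  | zero => simp [iterConv, ft, ind, apply_ite Complex.ofReal]
  | succ k ih => rw [iterConv, ft_conv, ih, pow_succ']

lemma iterConv_mem {ψ : G → ℝ} {Γ : Finset (AddChar G ℂ)} {s : ℝ}
    (hs : ∀ v, ψ v ≠ 0 → v ∈ bohr Γ s) (k : ℕ) {x : G} (hx : iterConv ψ k x ≠ 0) :
    x ∈ bohr Γ (k * s) := by
  induction k generalizing x with
  | zero =>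
    have : x = 0 := by
      by_contra hne
      exact hx (ind_of_notMem (by simpa using hne))
    rw [this]
    exact zero_mem_bohr _ (by simp)
  | succ k ih =>
    obtain ⟨y, -, hy⟩ := exists_ne_zero_of_sum_ne_zero hx
    have h1 := hs y (left_ne_zero_of_mul hy)
    have h2 := ih (right_ne_zero_of_mul hy)
    have := add_mem_bohr h1 h2
    rw [add_sub_cancel] at this
    refine bohr_mono _ (le_of_eq ?_) this
    push_cast; ring

lemma iterConv_approx {ψ Φ : G → ℝ} (hψ : ∀ x, 0 ≤ ψ x) (h1 : ∑ x, ψ x = 1)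
    {Γ : Finset (AddChar G ℂ)} {s ε : ℝ} (hs : ∀ v, ψ v ≠ 0 → v ∈ bohr Γ s) (k : ℕ)
    (hΦ : ∀ j < k, ∀ x ∈ bohr Γ (j * s), ∀ v, ψ v ≠ 0 → |Φ (v + x) - Φ x| ≤ ε) :
    |∑ x, iterConv ψ k x * Φ x - Φ 0| ≤ k * ε := by
  induction k with
  | zero => simp [iterConv, sum_ind_mul]
  | succ k ih =>
    have ih := ih fun j hj => hΦ j (by omega)
    have h2 : |∑ x, iterConv ψ (k + 1) x * Φ x - ∑ x, iterConv ψ k x * Φ x| ≤ ε := by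
      rw [iterConv, sum_conv_mul, ← sum_sub_distrib]
      calc |∑ x, (iterConv ψ k x * ∑ v, ψ v * Φ (v + x) - iterConv ψ k x * Φ x)|
          = |∑ x, iterConv ψ k x * ∑ v, ψ v * (Φ (v + x) - Φ x)| := by
            congr 1
            refine sum_congr rfl fun x _ => ?_
            simp only [mul_sub, sum_sub_distrib, ← sum_mul, h1, one_mul]
        _ ≤ ∑ x, |iterConv ψ k x * ∑ v, ψ v * (Φ (v + x) - Φ x)| := abs_sum_le_sum_abs _ _
        _ ≤ ∑ x, iterConv ψ k x * ε := by
            refine sum_le_sum fun x _ => ?_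
            rw [abs_mul, abs_of_nonneg (iterConv_nonneg hψ k x)]
            by_cases hx : iterConv ψ k x = 0
            · rw [hx, zero_mul, zero_mul]
            refine mul_le_mul_of_nonneg_left ?_ (iterConv_nonneg hψ k x)
            refine (abs_sum_le_sum_abs _ _).trans ?_
            calc ∑ v, |ψ v * (Φ (v + x) - Φ x)| ≤ ∑ v, ψ v * ε := by
                  refine sum_le_sum fun v _ => ?_
                  rw [abs_mul, abs_of_nonneg (hψ v)]
                  by_cases hv : ψ v = 0
                  · rw [hv, zero_mul, zero_mul]
                  exact mul_le_mul_of_nonneg_left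
                    (hΦ k (by omega) x (iterConv_mem hs k hx) v hv) (hψ v)
              _ = ε := by rw [← sum_mul, h1, one_mul]
        _ = ε := by rw [← sum_mul, sum_iterConv h1, one_mul]
    have := abs_sub_le (∑ x, iterConv ψ (k + 1) x * Φ x) (∑ x, iterConv ψ k x * Φ x) (Φ 0)
    push_cast
    linarith

open Classical in
lemma norm_ft_smooth_sub_le {T B : Finset G} (hT : T.Nonempty) (hB : B.Nonempty) {c : ℝ} {k : ℕ}
    (hk : 2 * (1 / 4 : ℝ) ^ k ≤ c)
    (hTB : ∀ γ, 0.5 * #T ≤ ‖ft (ind T) γ‖ → ∀ b ∈ B, ‖1 - γ b‖ ≤ c) (γ : AddChar G ℂ) :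
    ‖ft (fun x => iterConv (corr (fun y => ind T y / #T) (fun y => ind T y / #T)) k x -
      conv (iterConv (corr (fun y => ind T y / #T) (fun y => ind T y / #T)) k)
        (fun y => ind B y / #B) x) γ‖ ≤ c := by
  have hT0 : (0 : ℝ) < #T := by exact_mod_cast hT.card_pos
  have hB0 : (0 : ℝ) < #B := by exact_mod_cast hB.card_pos
  set μ : G → ℝ := fun y => ind T y / #T with hμ
  set ν : G → ℝ := fun y => ind B y / #B with hν
  have hfd : ∀ (U : Finset G) (c' : ℝ), ft (fun y => ind U y / c') γ = ft (ind U) γ / c' := by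
    intro U c'
    simp only [ft, sum_div]
    refine sum_congr rfl fun x _ => ?_
    push_cast; ring
  have e : ft (fun x => iterConv (corr μ μ) k x - conv (iterConv (corr μ μ) k) ν x) γ =
      ft (corr μ μ) γ ^ k * (1 - ft ν γ) := by
    have : ft (fun x => iterConv (corr μ μ) k x - conv (iterConv (corr μ μ) k) ν x) γ =
        ft (iterConv (corr μ μ) k) γ - ft (conv (iterConv (corr μ μ) k) ν) γ := by
      simp only [ft, ← sum_sub_distrib]
      refine sum_congr rfl fun x _ => ?_
      push_cast; ring
    rw [this, ft_conv, ft_iterConv]; ring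
  have hμ1 : ‖ft μ γ‖ ≤ 1 := by
    refine (norm_ft_le _ _).trans ?_
    simp only [hμ, abs_div, abs_of_nonneg (ind_nonneg _ _), Nat.abs_cast, ← sum_div, sum_ind]
    exact (div_self hT0.ne').le
  have hν1 : ‖ft ν γ‖ ≤ 1 := by
    refine (norm_ft_le _ _).trans ?_
    simp only [hν, abs_div, abs_of_nonneg (ind_nonneg _ _), Nat.abs_cast, ← sum_div, sum_ind]
    exact (div_self hB0.ne').le
  have hψ : ‖ft (corr μ μ) γ‖ = ‖ft μ γ‖ ^ 2 := by
    rw [ft_corr, norm_mul, RCLike.norm_conj, sq]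
  rw [e, norm_mul, norm_pow, hψ]
  by_cases hc : 0.5 * #T ≤ ‖ft (ind T) γ‖
  · have h1 : ‖1 - ft ν γ‖ ≤ c := by
      have e2 : 1 - ft ν γ = (∑ b ∈ B, (1 - γ b)) / #B := by
        have : ft (ind B) γ = ∑ b ∈ B, γ b := by
          simp [ft, ind, apply_ite Complex.ofReal]
        rw [hν, hfd, this, sum_sub_distrib]
        have hB1 : (#B : ℂ) ≠ 0 := by exact_mod_cast hB0.ne'
        simp
        field_simp
      rw [e2, norm_div, Complex.norm_natCast, div_le_iff₀ hB0]
      refine (norm_sum_le _ _).trans ((sum_le_sum (hTB γ hc)).trans ?_)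
      simp [mul_comm]
    calc _ ≤ 1 * ‖1 - ft ν γ‖ := by
          refine mul_le_mul_of_nonneg_right (pow_le_one₀ (by positivity) ?_) (norm_nonneg _)
          exact pow_le_one₀ (norm_nonneg _) hμ1
      _ ≤ c := by rw [one_mul]; exact h1
  · have h2 : ‖ft μ γ‖ ^ 2 ≤ 1 / 4 := by
      have : ‖ft μ γ‖ ≤ 1 / 2 := by
        rw [hμ, hfd, norm_div, Complex.norm_real, Real.norm_of_nonneg hT0.le, div_le_iff₀ hT0]
        push Not at hc
        linarith
      nlinarith [norm_nonneg (ft μ γ)]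
    have h3 : ‖1 - ft ν γ‖ ≤ 2 := by
      refine (norm_sub_le _ _).trans ?_
      rw [norm_one]; linarith
    calc _ ≤ (1 / 4 : ℝ) ^ k * 2 :=
          mul_le_mul (pow_le_pow_left₀ (by positivity) h2 _) h3 (norm_nonneg _) (by positivity)
      _ ≤ c := by linarith

lemma sq_sum_corr_le {σ h : G → ℝ} {M : ℝ} (hσ : ∀ γ, ‖ft σ γ‖ ≤ M) {Y V : Finset G}
    (h0 : ∀ x, 0 ≤ h x) (h1 : ∀ x, h x ≤ 1) (hV : ∀ x, σ x ≠ 0 → ∀ z ∈ Y, z + x ∈ V) :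
    (∑ x, σ x * ∑ z ∈ Y, h (z + x)) ^ 2 ≤ #Y * (M ^ 2 * #V) := by
  classical
  have e : ∑ x, σ x * ∑ z ∈ Y, h (z + x) =
      ∑ z ∈ Y, corr σ (fun v => ind V v * h v) z := by
    simp only [corr, mul_sum]
    rw [sum_comm]
    refine sum_congr rfl fun z hz => sum_congr rfl fun x _ => ?_
    by_cases hx : σ x = 0
    · simp [hx]
    · rw [add_comm x z, ind_of_mem (hV x hx z hz), one_mul]
  rw [e]
  calc _ ≤ #Y * ∑ z ∈ Y, corr σ (fun v => ind V v * h v) z ^ 2 := sq_sum_le_card_mul_sum_sq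
    _ ≤ #Y * ∑ z, corr σ (fun v => ind V v * h v) z ^ 2 := by
        refine mul_le_mul_of_nonneg_left ?_ (Nat.cast_nonneg _)
        exact sum_le_sum_of_subset_of_nonneg (subset_univ _) fun _ _ _ => sq_nonneg _
    _ ≤ #Y * (M ^ 2 * ∑ z, (ind V z * h z) ^ 2) := by
        gcongr
        exact sum_corr_sq_le _ _ hσ
    _ ≤ #Y * (M ^ 2 * #V) := by
        gcongr
        rw [← sum_ind V]
        refine sum_le_sum fun z _ => ?_
        have a1 := ind_nonneg V z
        have a2 := ind_le_one V z
        rw [sq]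
        have : ind V z * h z ≤ ind V z := mul_le_of_le_one_right a1 (h1 z)
        have b0 : 0 ≤ ind V z * h z := mul_nonneg a1 (h0 z)
        nlinarith

lemma abs_avg_shift_le {T Y V : Finset G} {h a : G → ℝ} (h0 : ∀ x, 0 ≤ h x) (h1 : ∀ x, h x ≤ 1)
    {ε d : ℝ} (hε : 0 ≤ ε) (hY : Y.Nonempty)
    (hT : ∀ t ∈ T, ∃ D : Finset G, #D ≤ d ∧ ∀ v ∈ V, v ∉ D → |a (v + t) - h v| ≤ ε)
    {t₁ t₂ x : G} (ht₁ : t₁ ∈ T) (ht₂ : t₂ ∈ T) (hx : ∀ z ∈ Y, z + x ∈ V)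
    (hx' : ∀ z ∈ Y, z + (t₁ - t₂ + x) ∈ V) :
    |(∑ z ∈ Y, h (z + (t₁ - t₂ + x))) / #Y - (∑ z ∈ Y, h (z + x)) / #Y| ≤ 2 * ε + 2 * d / #Y := by
  classical
  have hY0 : (0 : ℝ) < #Y := by exact_mod_cast hY.card_pos
  obtain ⟨D₁, hD₁, hh₁⟩ := hT t₁ ht₁
  obtain ⟨D₂, hD₂, hh₂⟩ := hT t₂ ht₂
  have key : ∀ z ∈ Y, |h (z + (t₁ - t₂ + x)) - h (z + x)| ≤
      2 * ε + (ind D₂ (z + (t₁ - t₂ + x)) + ind D₁ (z + x)) := by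
    intro z hz
    by_cases m : z + (t₁ - t₂ + x) ∈ D₂ ∨ z + x ∈ D₁
    · have : 1 ≤ ind D₂ (z + (t₁ - t₂ + x)) + ind D₁ (z + x) := by
        rcases m with m | m
        · rw [ind_of_mem m]; linarith [ind_nonneg D₁ (z + x)]
        · rw [ind_of_mem m]; linarith [ind_nonneg D₂ (z + (t₁ - t₂ + x))]
      rw [abs_le]
      constructor <;> linarith [h0 (z + x), h1 (z + x), h0 (z + (t₁ - t₂ + x)),
        h1 (z + (t₁ - t₂ + x))]
    · push Not at m
      have e1 := abs_le.1 (hh₂ _ (hx' z hz) m.1)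
      have e2 := abs_le.1 (hh₁ _ (hx z hz) m.2)
      rw [show z + (t₁ - t₂ + x) + t₂ = z + x + t₁ by abel] at e1
      have := ind_nonneg D₁ (z + x)
      have := ind_nonneg D₂ (z + (t₁ - t₂ + x))
      rw [abs_le]
      constructor <;> linarith
  have hs : ∀ (D : Finset G) (w : G), ∑ z ∈ Y, ind D (z + w) ≤ #D := by
    intro D w
    calc _ ≤ ∑ z, ind D (z + w) := sum_le_univ_sum_of_nonneg fun _ => ind_nonneg _ _
      _ = #D := by rw [← sum_ind D]; exact Equiv.sum_comp (Equiv.addRight w) (ind D)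
  rw [← sub_div, ← sum_sub_distrib, abs_div, Nat.abs_cast, div_le_iff₀ hY0]
  refine (abs_sum_le_sum_abs _ _).trans ((sum_le_sum key).trans ?_)
  rw [sum_add_distrib, sum_add_distrib, sum_const, nsmul_eq_mul, add_mul, div_mul_cancel₀ _ hY0.ne']
  linarith [hs D₂ (t₁ - t₂ + x), hs D₁ x]

lemma exists_sum_shift_ge {S Y B : Finset G} (hY : Y.Nonempty) (hB : B.Nonempty) {lam : G → ℝ}
    (h0 : ∀ x, 0 ≤ lam x) (h1 : ∑ x, lam x = 1) {c : ℝ}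
    (h : c < ∑ x, conv lam (fun y => ind B y / #B) x *
      ((∑ z ∈ Y, (∑ u ∈ Y, ind S (z + x - u)) / #Y) / #Y)) :
    ∃ w, c * #B ≤ ∑ b ∈ B, ind S (w + b) := by
  by_contra! hcon
  have hY0 : (0 : ℝ) < #Y := by exact_mod_cast hY.card_pos
  have hB0 : (0 : ℝ) < #B := by exact_mod_cast hB.card_pos
  refine absurd h (not_lt.2 ?_)
  have hb : ∀ v, ∑ b ∈ B, (∑ z ∈ Y, (∑ u ∈ Y, ind S (z + (v + b) - u)) / #Y) / #Y ≤ c * #B := by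
    intro v
    rw [← sum_div, sum_comm, div_le_iff₀ hY0]
    calc _ ≤ ∑ _z ∈ Y, c * #B := by
          refine sum_le_sum fun z _ => ?_
          rw [← sum_div, sum_comm, div_le_iff₀ hY0]
          calc _ ≤ ∑ _u ∈ Y, c * #B := by
                refine sum_le_sum fun u _ => ?_
                have := hcon (z + v - u)
                refine le_trans (le_of_eq ?_) this.le
                refine sum_congr rfl fun b _ => ?_
                congr 1; abel
            _ = c * #B * #Y := by rw [sum_const, nsmul_eq_mul, mul_comm]
      _ = c * #B * #Y := by rw [sum_const, nsmul_eq_mul, mul_comm]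
  rw [sum_conv_mul]
  have e : ∀ x, ind B x / #B * ∑ v, lam v *
      ((∑ z ∈ Y, (∑ u ∈ Y, ind S (z + (v + x) - u)) / #Y) / #Y) = ind B x * ((∑ v, lam v *
      ((∑ z ∈ Y, (∑ u ∈ Y, ind S (z + (v + x) - u)) / #Y) / #Y)) / #B) := fun x => by ring
  rw [sum_congr rfl fun x _ => e x, sum_ind_mul, ← sum_div, div_le_iff₀ hB0, sum_comm]
  calc _ ≤ ∑ v, lam v * (c * #B) := by
        refine sum_le_sum fun v _ => ?_
        rw [← mul_sum]
        exact mul_le_mul_of_nonneg_left (hb v) (h0 v)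
    _ = c * #B := by rw [← sum_mul, h1, one_mul]

lemma bohr_anti {Γ Γ' : Finset (AddChar G ℂ)} (h : Γ ⊆ Γ') (r : ℝ) : bohr Γ' r ⊆ bohr Γ r :=
  fun _ hx => mem_bohr.2 fun χ hχ => mem_bohr.1 hx χ (h hχ)

lemma exists_ne_of_corr_ne {T : Finset G} {c : ℝ} {v : G}
    (h : corr (fun y => ind T y / c) (fun y => ind T y / c) v ≠ 0) :
    ∃ t₁ ∈ T, ∃ t₂ ∈ T, v = t₁ - t₂ := by
  obtain ⟨y, -, hy⟩ := exists_ne_zero_of_sum_ne_zero h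
  have h1 : y ∈ T := by
    by_contra hn
    simp [ind_of_notMem hn] at hy
  have h2 : y + v ∈ T := by
    by_contra hn
    simp [ind_of_notMem hn] at hy
  exact ⟨y + v, h2, y, h1, by abel⟩

open Classical in
set_option maxHeartbeats 800000 in
theorem almost_periodic {Q η κ ε ρ : ℝ} {H h I k ℓ : ℕ} (hQ : 100 ≤ Q) (hreg : HasReg G Q η H)
    (hη : η ≤ κ / 40000) (hκ : 0 < κ) (hκ1 : κ ≤ 1) (hk : 2 * k + 1 ≤ Q)
    (hk4 : 2 * (1 / 4 : ℝ) ^ k ≤ κ / 200) (hε : 0 < ε) (hε1 : ε ≤ 1) (hℓ : 0 < ℓ)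
    (herr : k * (2 * ε + 16 * Real.exp (-(ε ^ 2 * ℓ / 4)) / κ) ≤ 0.01)
    (hI : 1 < 1.1 ^ I * ((κ / 2) ^ ℓ / 2)) (hH : h + 3 * I + 10 ≤ H)
    {Γ : Finset (AddChar G ℂ)} (hl : IsLevel Q η h Γ ρ) {Y S : Finset G} (hY : Y ⊆ bohr Γ ρ)
    (hYc : κ * #(bohr Γ ρ) ≤ #Y)
    (hS : 0.99 * (#Y : ℝ) ^ 2 ≤ ∑ z ∈ Y, ∑ u ∈ Y, ind S (z - u)) :
    ∃ Γ' r', IsLevel Q η (h + 3 * I + 10) Γ' r' ∧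
      ∃ w, 0.97 * #(bohr Γ' r') ≤ ∑ b ∈ bohr Γ' r', ind S (w + b) := by
  have hQ1 : 1 ≤ Q := by linarith
  have hQ0 : 0 < Q := by linarith
  have hρ := hl.pos hQ1
  have hE0 : (0 : ℝ) < #(bohr Γ ρ) := by exact_mod_cast (bohr_nonempty Γ hρ.le).card_pos
  have hY0 : (0 : ℝ) < #Y := lt_of_lt_of_le (by positivity) hYc
  have hYn : Y.Nonempty := card_pos.1 (by exact_mod_cast hY0)
  -- the inner Bohr set
  obtain ⟨ρ₄, -, hρ₄, hl₄⟩ := hreg.exists_level (by linarith) (h := h + 2) (by omega)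
    (hl.card_le.trans (by omega)) (ρ := ρ / Q ^ 2)
    (by rw [pow_add]; have := hl.width; field_simp; linarith)
    (by rw [div_le_one (by positivity)]; nlinarith [hl.le_one])
  have hρ₄0 := hl₄.pos hQ1
  have hρQ : (2 * k + 1) * ρ₄ ≤ ρ / Q := by
    calc _ ≤ Q * (ρ / Q ^ 2) := mul_le_mul hk hρ₄ hρ₄0.le hQ0.le
      _ = ρ / Q := by field_simp
  set V := bohr Γ (ρ + ρ / Q) with hV
  have hVE : (#V : ℝ) ≤ 2 * #(bohr Γ ρ) := by
    have h1 := hl.reg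
    unfold Reg at h1
    have h2 : (#(bohr Γ (ρ - ρ / Q)) : ℝ) ≤ #(bohr Γ ρ) := by
      exact_mod_cast card_le_card (bohr_mono Γ (by linarith [div_pos hρ hQ0]))
    have : (0 : ℝ) ≤ #V := Nat.cast_nonneg _
    nlinarith
  have hVY : κ / 2 * #V ≤ #Y := by nlinarith
  have hρ₄Q : ρ₄ ≤ ρ / Q := by
    have : 0 ≤ (k : ℝ) * ρ₄ := by positivity
    linarith
  have hV0 : (0 : ℝ) < #V := by
    exact_mod_cast (bohr_nonempty Γ (by positivity)).card_pos
  -- almost periods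
  obtain ⟨T, hTE, hTc, a, ha⟩ := croot_sisask (ind S) (ind_nonneg S) (ind_le_one S) (U := Y)
    (UB := V) (E := bohr Γ ρ₄) (V := V) hYn
    (fun u hu t ht => bohr_mono Γ (by linarith) (add_mem_bohr (hY hu) ht)) hε hε1 hℓ
  have hTc' : (κ / 2) ^ ℓ / 2 * #(bohr Γ ρ₄) ≤ #T := by
    have h1 : (κ / 2) ^ ℓ * (#V : ℝ) ^ ℓ ≤ (#Y : ℝ) ^ ℓ := by
      rw [← mul_pow]
      exact pow_le_pow_left₀ (by positivity) hVY _
    have h2 : 0 < (#V : ℝ) ^ ℓ := by positivity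
    have h3 : #(bohr Γ ρ₄) * ((κ / 2) ^ ℓ * (#V : ℝ) ^ ℓ) ≤ 2 * #T * (#V : ℝ) ^ ℓ :=
      le_trans (mul_le_mul_of_nonneg_left h1 (Nat.cast_nonneg _)) hTc
    have h4 : (κ / 2) ^ ℓ / 2 * #(bohr Γ ρ₄) * (#V : ℝ) ^ ℓ ≤ #T * (#V : ℝ) ^ ℓ := by linarith
    exact le_of_mul_le_mul_right h4 h2
  -- spectral localisation
  obtain ⟨Γ₁, r, hΓ₁, hr, hl₁, T', hT'n, hT'B, ⟨y, hy⟩, hspec⟩ := spectral_level hQ hreg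
    (c := κ / 200) (by positivity) (by linarith) (by linarith) (by omega)
    (by positivity) hI hl₄ hTE hTc'
  have hr0 := hl₁.pos hQ1
  obtain ⟨r₁, -, hr₁, hl₂⟩ := hreg.exists_level (by linarith) (h := h + 3 * I + 4) (by omega)
    (hl₁.card_le.trans (by omega)) (Γ := Γ₁) (ρ := r / Q)
    (by
      have h1 := hl₁.width
      rw [show h + 3 * I + 4 = (h + 2 + 1 + 3 * I) + 1 by ring, pow_succ]
      field_simp
      linarith)
    (by rw [div_le_one (by positivity)]; linarith [hl₁.le_one])
  refine ⟨Γ₁, r₁, hl₂.mono hQ1 (by omega), ?_⟩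
  have hr₁0 := hl₂.pos hQ1
  set B := bohr Γ₁ r₁ with hB
  have hBn : B.Nonempty := bohr_nonempty Γ₁ hr₁0.le
  set μ : G → ℝ := fun y => ind T' y / #T' with hμ
  have hT'0 : (0 : ℝ) < #T' := by exact_mod_cast hT'n.card_pos
  have hB0 : (0 : ℝ) < #B := by exact_mod_cast hBn.card_pos
  have hμ0 : ∀ x, 0 ≤ μ x := fun x => div_nonneg (ind_nonneg _ _) hT'0.le
  have hμ1 : ∑ x, μ x = 1 := by rw [hμ, ← sum_div, sum_ind, div_self hT'0.ne']
  have hψ0 : ∀ x, 0 ≤ corr μ μ x := fun x => sum_nonneg fun _ _ => mul_nonneg (hμ0 _) (hμ0 _)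
  have hψ1 : ∑ x, corr μ μ x = 1 := by
    simp only [corr]
    rw [sum_comm]
    simp only [← mul_sum]
    rw [← hμ1]
    refine sum_congr rfl fun y _ => ?_
    rw [show ∑ x, μ (y + x) = ∑ x, μ x from Equiv.sum_comp (Equiv.addLeft y) μ, hμ1, mul_one]
  have hψs : ∀ v, corr μ μ v ≠ 0 → v ∈ bohr Γ (2 * ρ₄) := by
    intro v hv
    obtain ⟨t₁, h1, t₂, h2, rfl⟩ := exists_ne_of_corr_ne hv
    have := sub_mem_bohr (hT'B h1) (hT'B h2)
    exact bohr_mono Γ (by linarith) (bohr_anti hΓ₁ _ this)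
  set hh : G → ℝ := fun v => (∑ u ∈ Y, ind S (v - u)) / #Y with hhh
  have hh0 : ∀ v, 0 ≤ hh v := fun v => div_nonneg (sum_nonneg fun _ _ => ind_nonneg _ _) hY0.le
  have hh1 : ∀ v, hh v ≤ 1 := fun v => by
    rw [hhh, div_le_one hY0]
    calc _ ≤ ∑ _u ∈ Y, (1 : ℝ) := sum_le_sum fun _ _ => ind_le_one _ _
      _ = #Y := by simp
  set Φ : G → ℝ := fun x => (∑ z ∈ Y, hh (z + x)) / #Y with hΦ
  have hΦ0 : 0.99 ≤ Φ 0 := by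
    simp only [hΦ, hhh, add_zero, ← sum_div]
    rw [div_div, le_div_iff₀ (by positivity), ← sq]
    exact hS
  have hmV : ∀ x ∈ bohr Γ (ρ / Q), ∀ z ∈ Y, z + x ∈ V := fun x hx z hz => add_mem_bohr (hY hz) hx
  have happ := iterConv_approx (Φ := Φ) hψ0 hψ1 hψs k
    (ε := 2 * ε + 16 * Real.exp (-(ε ^ 2 * ℓ / 4)) / κ) (by
    intro j hj x hx v hv
    obtain ⟨t₁, h1, t₂, h2, rfl⟩ := exists_ne_of_corr_ne hv
    have hjk : (j : ℝ) + 1 ≤ k := by exact_mod_cast hj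
    have hjs : (j + 1) * (2 * ρ₄) ≤ ρ / Q := by
      linarith [mul_le_mul_of_nonneg_right hjk hρ₄0.le]
    have m1 : x ∈ bohr Γ (ρ / Q) := bohr_mono Γ (by linarith) hx
    have m2 : y + t₁ - (y + t₂) + x ∈ bohr Γ (ρ / Q) := by
      rw [show y + t₁ - (y + t₂) + x = (t₁ - t₂) + x by abel]
      exact bohr_mono Γ (by linarith) (add_mem_bohr (hψs _ hv) hx)
    have := abs_avg_shift_le (h := hh) (a := a) hh0 hh1 hε.le hYn ha (hy _ h1) (hy _ h2)
      (hmV x m1) (hmV _ m2)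
    rw [show y + t₁ - (y + t₂) + x = (t₁ - t₂) + x by abel] at this
    refine this.trans (add_le_add le_rfl ?_)
    rw [div_le_div_iff₀ hY0 hκ]
    have he := Real.exp_pos (-(ε ^ 2 * ℓ / 4))
    have := mul_le_mul_of_nonneg_left hVY he.le
    linarith)
  set lam := iterConv (corr μ μ) k with hlam
  set σ : G → ℝ := fun x => lam x - conv lam (fun y => ind B y / #B) x with hσ
  have hσM : ∀ γ, ‖ft σ γ‖ ≤ κ / 200 := fun γ =>
    norm_ft_smooth_sub_le hT'n hBn hk4 (fun γ hγ b hb => hspec γ hγ b (bohr_mono _ hr₁ hb)) γ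
  have hσV : ∀ x, σ x ≠ 0 → ∀ z ∈ Y, z + x ∈ V := by
    intro x hx
    refine hmV x ?_
    by_cases h1 : lam x = 0
    · have h2 : conv lam (fun y => ind B y / #B) x ≠ 0 := by
        intro h2
        exact hx (by rw [hσ]; simp [h1, h2])
      obtain ⟨v, -, hv⟩ := exists_ne_zero_of_sum_ne_zero h2
      have hv1 := iterConv_mem hψs k (left_ne_zero_of_mul hv)
      have hv2 : x - v ∈ B := by
        by_contra hn
        simp [ind_of_notMem hn] at hv
      have hv3 : x - v ∈ bohr Γ ρ₄ := by
        have hrr : r / Q ≤ r := div_le_self hr0.le hQ1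
        exact bohr_anti hΓ₁ _ (bohr_mono Γ₁ (by linarith) hv2)
      have := add_mem_bohr hv1 hv3
      rw [show v + (x - v) = x by abel] at this
      exact bohr_mono Γ (by linarith) this
    · exact bohr_mono Γ (by linarith) (iterConv_mem hψs k h1)
  have hsq := sq_sum_corr_le hσM hh0 hh1 hσV
  have hdiff : |∑ x, σ x * Φ x| ≤ 0.0075 := by
    have e : ∑ x, σ x * Φ x = (∑ x, σ x * ∑ z ∈ Y, hh (z + x)) / #Y := by
      rw [sum_div]
      exact sum_congr rfl fun x _ => by rw [hΦ, mul_div_assoc]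
    refine abs_le_of_sq_le_sq ?_ (by norm_num)
    rw [e, div_pow, div_le_iff₀ (by positivity)]
    refine hsq.trans ?_
    have h1 : (κ / 200) ^ 2 * #V ≤ κ / 20000 * #Y := by
      linarith [mul_le_mul_of_nonneg_left hVY hκ.le]
    have h2 : κ / 20000 * #Y ≤ 1 / 20000 * #Y := by gcongr
    have h3 := mul_le_mul_of_nonneg_left (h1.trans h2) hY0.le
    linarith [sq_nonneg (#Y : ℝ)]
  have hsplit : ∑ x, σ x * Φ x =
      ∑ x, lam x * Φ x - ∑ x, conv lam (fun y => ind B y / #B) x * Φ x := by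
    rw [← sum_sub_distrib]
    exact sum_congr rfl fun x _ => by rw [hσ]; ring
  refine exists_sum_shift_ge hYn hBn (iterConv_nonneg hψ0 k) (sum_iterConv hψ1 k) ?_
  have e1 := (abs_le.1 hdiff).2
  have e2 := (abs_le.1 happ).1
  change 0.97 < ∑ x, conv lam (fun y => ind B y / #B) x * Φ x
  linarith

end AlmostPeriodic

section Increment

variable {G : Type*} [AddCommGroup G] [Fintype G]

/-- Numerical conditions under which almost periodicity can be applied to sets of relative
density at least `κ`. -/
structure Admissible (Q η κ ε : ℝ) (I k ℓ : ℕ) : Prop where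
  hQ : 100 ≤ Q
  hη0 : 0 ≤ η
  hη : η ≤ κ / 40000
  hκ : 0 < κ
  hκ1 : κ ≤ 1
  hk : 2 * k + 1 ≤ Q
  hk4 : 2 * (1 / 4 : ℝ) ^ k ≤ κ / 200
  hε : 0 < ε
  hε1 : ε ≤ 1
  hℓ : 0 < ℓ
  herr : k * (2 * ε + 16 * Real.exp (-(ε ^ 2 * ℓ / 4)) / κ) ≤ 0.01
  hI : 1 < 1.1 ^ I * ((κ / 2) ^ ℓ / 2)

lemma corr_ind_left (X : Finset G) (f : G → ℝ) (v : G) : corr (ind X) f v = ∑ x ∈ X, f (x + v) :=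
  sum_ind_mul X fun x => f (x + v)

lemma Reg.corr_ind_ge {η Q r : ℝ} {Γ : Finset (AddChar G ℂ)} (h : Reg η Q Γ r) (hη1 : η ≤ 1)
    (hQ : 0 ≤ r / Q) {X : Finset G} (hX : X ⊆ bohr Γ r) {v : G} (hv : v ∈ bohr Γ (r / Q)) :
    #X - η * #(bohr Γ r) ≤ corr (ind X) (ind (bohr Γ r)) v := by
  have h1 : ∑ x ∈ X, (1 - ind (bohr Γ r) (x + v)) ≤ η * #(bohr Γ r) :=
    (sum_le_sum_of_subset_of_nonneg hX fun x _ _ => by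
      linarith [ind_le_one (bohr Γ r) (x + v)]).trans
      (h.sum_shift_le hη1 hQ hv)
  rw [sum_sub_distrib, sum_const, nsmul_eq_mul, mul_one] at h1
  rw [corr_ind_left]
  linarith

lemma corr_neg (f g : G → ℝ) (v : G) : corr f g (-v) = corr g f v := by
  rw [corr, ← Equiv.sum_comp (Equiv.addRight v)]
  refine sum_congr rfl fun y _ => ?_
  simp [mul_comm]

lemma Reg.corr_balanced_add_le {η Q r α : ℝ} {Γ : Finset (AddChar G ℂ)} (h : Reg η Q Γ r)
    (hη1 : η ≤ 1) (hQ : 0 ≤ r / Q) {X : Finset G} (hX : X ⊆ bohr Γ r) (hα : 0 ≤ α)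
    (hXc : #X = α * #(bohr Γ r)) (hη : η ≤ 0.01 * α) {v : G} (hv : v ∈ bohr Γ (r / Q)) :
    corr (fun x => ind X x - α * ind (bohr Γ r) x) (fun x => ind X x - α * ind (bohr Γ r) x) v +
      0.98 * (α * #X) ≤ corr (ind X) (ind X) v := by
  set E := bohr Γ r with hE
  have e : corr (fun x => ind X x - α * ind E x) (fun x => ind X x - α * ind E x) v =
      corr (ind X) (ind X) v - α * corr (ind X) (ind E) v - α * corr (ind E) (ind X) v +
        α ^ 2 * corr (ind E) (ind E) v := by
    simp only [corr, mul_sum, ← sum_sub_distrib, ← sum_add_distrib]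
    refine sum_congr rfl fun y _ => ?_
    ring
  have h1 := h.corr_ind_ge hη1 hQ hX hv
  have h2 := h.corr_ind_ge hη1 hQ hX (neg_mem_bohr hv)
  rw [corr_neg] at h2
  have h3 : corr (ind E) (ind E) v ≤ #E := by
    rw [corr_ind_left]
    calc _ ≤ ∑ _x ∈ E, (1 : ℝ) := sum_le_sum fun _ _ => ind_le_one _ _
      _ = #E := by simp
  rw [e]
  have h4 := mul_le_mul_of_nonneg_left h1 hα
  have h5 := mul_le_mul_of_nonneg_left h2 hα
  have h6 := mul_le_mul_of_nonneg_left h3 (sq_nonneg α)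
  have h7 : α * (η * #E) ≤ 0.01 * (α * #X) := by
    have : η * #E ≤ 0.01 * #X := by
      rw [hXc]
      have : (0 : ℝ) ≤ #E := Nat.cast_nonneg _
      nlinarith
    linarith [mul_le_mul_of_nonneg_left this hα]
  have h8 : α ^ 2 * #E = α * #X := by rw [hXc]; ring
  linarith

theorem density_increment {Q η κ ε α ρ₁ ρ₂ : ℝ} {H h I k ℓ p : ℕ} (P : Admissible Q η κ ε I k ℓ)
    (hreg : HasReg G Q η H) (hH : h + 3 * I + 10 ≤ H) {Γ : Finset (AddChar G ℂ)}
    (hl₁ : IsLevel Q η h Γ ρ₁) (hl₂ : IsLevel Q η h Γ ρ₂) (hρ : 2 * ρ₂ ≤ ρ₁ / Q)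
    {X : Finset G} (hX : X ⊆ bohr Γ ρ₁) (hα : 0 < α) (hXc : #X = α * #(bohr Γ ρ₁))
    (hη : η ≤ 0.01 * α) (hp : Even p) (hp12 : 12 ≤ p)
    (hκ : κ ≤ α ^ (200 * (p + 1)) / 2)
    (hF : (0.4 * (α * #X)) ^ p * (#(bohr Γ ρ₂) : ℝ) ^ 2 ≤
      ∑ z ∈ bohr Γ ρ₂, ∑ u ∈ bohr Γ ρ₂,
        corr (fun x => ind X x - α * ind (bohr Γ ρ₁) x)
          (fun x => ind X x - α * ind (bohr Γ ρ₁) x) (u - z) ^ p) :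
    ∃ Γ' r', IsLevel Q η (h + 3 * I + 10) Γ' r' ∧
      ∃ w, 1.16 * α * #(bohr Γ' r') ≤ ∑ b ∈ bohr Γ' r', ind X (w + b) := by
  classical
  have hQ1 : 1 ≤ Q := by linarith [P.hQ]
  have hρ₁ := hl₁.pos hQ1
  have hρ₂ := hl₂.pos hQ1
  have hE0 : (0 : ℝ) < #(bohr Γ ρ₁) := by exact_mod_cast (bohr_nonempty Γ hρ₁.le).card_pos
  have hX0 : (0 : ℝ) < #X := by rw [hXc]; positivity
  have hXn : X.Nonempty := card_pos.1 (by exact_mod_cast hX0)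
  set F : G → ℝ := fun x => ind X x - α * ind (bohr Γ ρ₁) x with hFdef
  set E := bohr Γ ρ₂ with hE
  set a := α * #X with ha
  have ha0 : 0 < a := by positivity
  have hub := unbalance (E ×ˢ E) (fun i => corr F F (i.2 - i.1) / a)
    (fun i => corr (ind X) (ind X) (i.2 - i.1) / a) hp hp12
    (by
      simp only [div_pow, ← sum_div]
      rw [le_div_iff₀ (by positivity), card_product, sum_product]
      push_cast
      refine le_trans (le_of_eq ?_) hF
      rw [mul_pow]; ring)
    (by
      simp only [div_pow, ← sum_div]
      rw [sum_product]
      exact div_nonneg (bil_corr_nonneg _ _ _) (by positivity))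
    (fun i _ => div_nonneg (corr_ind_nonneg _ _ _) ha0.le)
    (by
      intro i hi
      rw [mem_product] at hi
      rw [div_add' _ _ _ ha0.ne', div_le_div_iff_of_pos_right ha0]
      refine hl₁.reg.corr_balanced_add_le (by linarith [P.hη, P.hκ1]) (by positivity)
          hX hα.le hXc hη
        (bohr_mono Γ ?_ (sub_mem_bohr hi.2 hi.1))
      linarith)
  simp only [div_pow, ← sum_div] at hub
  rw [le_div_iff₀ (by positivity), card_product, sum_product] at hub
  push_cast at hub
  obtain ⟨Y, hYE, hYc, hYS⟩ := sift X E (bohr_nonempty Γ hρ₂.le) hXn hα (q := 200 * (p + 1))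
    (by omega) (by refine le_trans (le_of_eq ?_) hub; rw [mul_pow]; ring)
  obtain ⟨Γ', r', hl', w, hw⟩ := almost_periodic P.hQ hreg P.hη P.hκ P.hκ1 P.hk P.hk4 P.hε P.hε1
    P.hℓ P.herr P.hI hH hl₂ hYE
    (le_trans (mul_le_mul_of_nonneg_right hκ (Nat.cast_nonneg _)) hYc) hYS
  refine ⟨Γ', r', hl', ?_⟩
  set B := bohr Γ' r' with hB
  have hB0 : (0 : ℝ) < #B := by exact_mod_cast (bohr_nonempty Γ' (hl'.pos hQ1).le).card_pos
  have h1 : 1.2 * a * (0.97 * #B) ≤ ∑ y ∈ X, ∑ b ∈ B, ind X (y + w + b) := by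
    calc _ ≤ 1.2 * a * ∑ b ∈ B,
          ind (univ.filter fun v => 1.2 * a ≤ corr (ind X) (ind X) v) (w + b) :=
          mul_le_mul_of_nonneg_left hw (by positivity)
      _ ≤ ∑ b ∈ B, corr (ind X) (ind X) (w + b) := by
          rw [mul_sum]
          refine sum_le_sum fun b _ => ?_
          by_cases hb : 1.2 * a ≤ corr (ind X) (ind X) (w + b)
          · rw [ind_of_mem (by simpa using hb), mul_one]; exact hb
          · rw [ind_of_notMem (by simpa using hb), mul_zero]; exact corr_ind_nonneg _ _ _
      _ = _ := by
          rw [sum_comm]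
          refine sum_congr rfl fun b _ => ?_
          rw [corr_ind_left]
          simp only [add_assoc]
  by_contra! hcon
  have h2 : ∑ y ∈ X, ∑ b ∈ B, ind X (y + w + b) ≤ #X * (1.16 * α * #B) := by
    rw [← nsmul_eq_mul]
    exact sum_le_card_nsmul _ _ _ fun y _ => (hcon (y + w)).le
  have h3 : 0 < a * #B := by positivity
  rw [ha] at h1 h3
  linarith

end Increment

section Count

variable {G : Type*} [AddCommGroup G] [Fintype G]

lemma ind_bohr_neg (Γ : Finset (AddChar G ℂ)) (r : ℝ) (x : G) :
    ind (bohr Γ r) (-x) = ind (bohr Γ r) x := by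
  by_cases hx : x ∈ bohr Γ r
  · rw [ind_of_mem hx, ind_of_mem (neg_mem_bohr hx)]
  · rw [ind_of_notMem hx, ind_of_notMem fun h => hx (by simpa using neg_mem_bohr h)]

lemma conv_comm (f g : G → ℝ) (v : G) : conv f g v = conv g f v := by
  rw [conv, ← Equiv.sum_comp (Equiv.subLeft v)]
  refine sum_congr rfl fun y _ => ?_
  simp [mul_comm]

lemma conv_bohr (Γ : Finset (AddChar G ℂ)) (r : ℝ) (f : G → ℝ) (v : G) :
    conv f (ind (bohr Γ r)) v = corr f (ind (bohr Γ r)) (-v) := by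
  refine sum_congr rfl fun y _ => ?_
  rw [← ind_bohr_neg Γ r (v - y)]
  congr 2; abel

lemma Reg.conv_balanced_add_le {η Q r α₁ α₂ : ℝ} {Γ : Finset (AddChar G ℂ)} (h : Reg η Q Γ r)
    (hη1 : η ≤ 1) (hQ : 0 ≤ r / Q) {X₁ X₂ : Finset G} (hX₁ : X₁ ⊆ bohr Γ r) (hX₂ : X₂ ⊆ bohr Γ r)
    (hα₁ : 0 ≤ α₁) (hα₂ : 0 ≤ α₂) (hXc₁ : #X₁ = α₁ * #(bohr Γ r)) (hXc₂ : #X₂ = α₂ * #(bohr Γ r))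
    (hη₁ : η ≤ 0.01 * α₁) (hη₂ : η ≤ 0.01 * α₂) {v : G} (hv : v ∈ bohr Γ (r / Q)) :
    conv (fun x => ind X₁ x - α₁ * ind (bohr Γ r) x)
        (fun x => ind X₂ x - α₂ * ind (bohr Γ r) x) v + 0.98 * (α₁ * α₂ * #(bohr Γ r)) ≤
      conv (ind X₁) (ind X₂) v := by
  set E := bohr Γ r with hE
  have e : conv (fun x => ind X₁ x - α₁ * ind E x) (fun x => ind X₂ x - α₂ * ind E x) v =
      conv (ind X₁) (ind X₂) v - α₂ * conv (ind X₁) (ind E) v - α₁ * conv (ind X₂) (ind E) v +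
        α₁ * α₂ * conv (ind E) (ind E) v := by
    rw [conv_comm (ind X₂)]
    simp only [conv, mul_sum, ← sum_sub_distrib, ← sum_add_distrib]
    refine sum_congr rfl fun y _ => ?_
    ring
  have h1 := h.corr_ind_ge hη1 hQ hX₁ (neg_mem_bohr hv)
  have h2 := h.corr_ind_ge hη1 hQ hX₂ (neg_mem_bohr hv)
  rw [← conv_bohr] at h1 h2
  have h3 : conv (ind E) (ind E) v ≤ #E := by
    rw [conv, sum_ind_mul]
    calc _ ≤ ∑ _x ∈ E, (1 : ℝ) := sum_le_sum fun _ _ => ind_le_one _ _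
      _ = #E := by simp
  rw [e]
  have h4 := mul_le_mul_of_nonneg_left h1 hα₂
  have h5 := mul_le_mul_of_nonneg_left h2 hα₁
  have h6 := mul_le_mul_of_nonneg_left h3 (mul_nonneg hα₁ hα₂)
  have hE0 : (0 : ℝ) ≤ #E := Nat.cast_nonneg _
  have h7 := mul_le_mul_of_nonneg_right (mul_le_mul_of_nonneg_left hη₁ hα₂) hE0
  have h8 := mul_le_mul_of_nonneg_right (mul_le_mul_of_nonneg_left hη₂ hα₁) hE0
  rw [hXc₁] at h4
  rw [hXc₂] at h5
  linarith

lemma sum_weighted_pow_ge {ι : Type*} (s : Finset ι) (w t : ι → ℝ) {c : ℝ} (hc : 0 < c) {p : ℕ}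
    (hp : Even p) (hw : ∀ i ∈ s, 0 ≤ w i) (hw1 : ∀ i ∈ s, w i ≤ 1)
    (h : ∑ i ∈ s, w i * t i ≤ -(c * ∑ i ∈ s, w i)) :
    c ^ p * ∑ i ∈ s, w i ≤ ∑ i ∈ s, t i ^ p := by
  have key : ∀ i ∈ s, w i * (c ^ p * (1 + p * (|t i| / c - 1))) ≤ t i ^ p := by
    intro i hi
    have h1 : 1 + p * (|t i| / c - 1) ≤ (|t i| / c) ^ p := by
      have := one_add_mul_le_pow (a := |t i| / c - 1)
        (by have : 0 ≤ |t i| / c := by positivity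
            linarith) p
      simpa using this
    have h2 : c ^ p * (1 + p * (|t i| / c - 1)) ≤ t i ^ p := by
      calc _ ≤ c ^ p * (|t i| / c) ^ p := mul_le_mul_of_nonneg_left h1 (by positivity)
        _ = t i ^ p := by rw [← mul_pow, mul_div_cancel₀ _ hc.ne', hp.pow_abs]
    calc _ ≤ w i * t i ^ p := mul_le_mul_of_nonneg_left h2 (hw i hi)
      _ ≤ t i ^ p := mul_le_of_le_one_left (hp.pow_nonneg _) (hw1 i hi)
  refine le_trans ?_ (sum_le_sum key)
  have e : ∑ i ∈ s, w i * (c ^ p * (1 + p * (|t i| / c - 1))) =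
      c ^ p * ∑ i ∈ s, w i + c ^ p * p / c * (∑ i ∈ s, w i * |t i| - c * ∑ i ∈ s, w i) := by
    simp only [mul_sum, ← sum_add_distrib, ← sum_sub_distrib]
    refine sum_congr rfl fun i _ => ?_
    field_simp
  have h3 : -∑ i ∈ s, w i * t i ≤ ∑ i ∈ s, w i * |t i| := by
    rw [← sum_neg_distrib]
    refine sum_le_sum fun i hi => ?_
    have := mul_le_mul_of_nonneg_left (neg_le_abs (t i)) (hw i hi)
    linarith
  rw [e]
  have : 0 ≤ c ^ p * p / c * (∑ i ∈ s, w i * |t i| - c * ∑ i ∈ s, w i) :=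
    mul_nonneg (by positivity) (by linarith)
  linarith

lemma sum_sub_le_card_mul (E : Finset G) {f : G → ℝ} (hf : ∀ x, 0 ≤ f x) :
    ∑ z ∈ E, ∑ u ∈ E, f (u - z) ≤ #E * ∑ v, f v := by
  rw [← nsmul_eq_mul]
  refine sum_le_card_nsmul _ _ _ fun z _ => ?_
  calc _ ≤ ∑ u, f (u - z) := sum_le_sum_of_subset_of_nonneg (subset_univ _) fun _ _ _ => hf _
    _ = _ := Equiv.sum_comp (Equiv.subRight z) f

theorem count_ge_of_no_increment {Q η κ ε α α₁ α₂ ρ₁ ρ₂ : ℝ} {H h I k ℓ p : ℕ}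
    (P : Admissible Q η κ ε I k ℓ)
    (hreg : HasReg G Q η H) (hH : h + 3 * I + 10 ≤ H) {Γ : Finset (AddChar G ℂ)}
    (hl₁ : IsLevel Q η h Γ ρ₁) (hl₂ : IsLevel Q η h Γ ρ₂) (hρ : 2 * ρ₂ ≤ ρ₁ / Q)
    {X₁ X₂ X₃ : Finset G} (hX₁ : X₁ ⊆ bohr Γ ρ₁) (hX₂ : X₂ ⊆ bohr Γ ρ₁) (hα : 0 < α)
    (hXc₁ : #X₁ = α₁ * #(bohr Γ ρ₁)) (hXc₂ : #X₂ = α₂ * #(bohr Γ ρ₁))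
    (hα₁ : 0.97 * α ≤ α₁) (hα₂ : 0.97 * α ≤ α₂)
    (hX₃ : 0.97 * α * (#(bohr Γ ρ₂) : ℝ) ^ 2 ≤
      ∑ z ∈ bohr Γ ρ₂, ∑ u ∈ bohr Γ ρ₂, ind X₃ (u - z))
    (hη : η ≤ 0.0097 * α) (hp : Even p) (hp12 : 12 ≤ p) (hpα : 1 ≤ 2 ^ p * α)
    (hκ : κ ≤ (0.97 * α) ^ (200 * (p + 1)) / 2)
    (hinc : ∀ Γ' r', IsLevel Q η (h + 3 * I + 10) Γ' r' → ∀ w,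
      ∑ b ∈ bohr Γ' r', ind X₁ (w + b) ≤ 1.01 * α * #(bohr Γ' r') ∧
      ∑ b ∈ bohr Γ' r', ind X₂ (w + b) ≤ 1.01 * α * #(bohr Γ' r')) :
    α ^ 3 / 16 * #(bohr Γ ρ₁) * #(bohr Γ ρ₂) ≤
      ∑ v, conv (ind X₁) (ind X₂) v * ind X₃ v := by
  have hQ1 : 1 ≤ Q := by linarith [P.hQ]
  have hρ₁ := hl₁.pos hQ1
  have hρ₂ := hl₂.pos hQ1
  have hα₁0 : 0 < α₁ := by linarith
  have hα₂0 : 0 < α₂ := by linarith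
  set E := bohr Γ ρ₁ with hE
  set E₂ := bohr Γ ρ₂ with hE₂
  have hE0 : (0 : ℝ) < #E := by exact_mod_cast (bohr_nonempty Γ hρ₁.le).card_pos
  have hE₂0 : (0 : ℝ) < #E₂ := by exact_mod_cast (bohr_nonempty Γ hρ₂.le).card_pos
  set F₁ : G → ℝ := fun x => ind X₁ x - α₁ * ind E x with hF₁
  set F₂ : G → ℝ := fun x => ind X₂ x - α₂ * ind E x with hF₂
  set A₁ := ∑ z ∈ E₂, ∑ u ∈ E₂, corr F₁ F₁ (u - z) ^ p with hA₁
  set A₂ := ∑ z ∈ E₂, ∑ u ∈ E₂, corr F₂ F₂ (u - z) ^ p with hA₂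
  set W := ∑ z ∈ E₂, ∑ u ∈ E₂, ind X₃ (u - z) with hW
  have key : ∀ (X : Finset G) (α' : ℝ), X ⊆ E → #X = α' * #E → 0.97 * α ≤ α' →
      (∀ Γ' r', IsLevel Q η (h + 3 * I + 10) Γ' r' → ∀ w,
        ∑ b ∈ bohr Γ' r', ind X (w + b) ≤ 1.01 * α * #(bohr Γ' r')) →
      ∑ z ∈ E₂, ∑ u ∈ E₂, corr (fun x => ind X x - α' * ind E x)
        (fun x => ind X x - α' * ind E x) (u - z) ^ p < (0.4 * (α' * #X)) ^ p * (#E₂ : ℝ) ^ 2 := by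
    intro X α' hX hXc hα' hno
    by_contra! hcon
    obtain ⟨Γ', r', hl', w, hw⟩ := density_increment P hreg hH hl₁ hl₂ hρ hX (by linarith) hXc
      (by linarith) hp hp12 (hκ.trans (by gcongr)) hcon
    have hB0 : (0 : ℝ) < #(bohr Γ' r') := by
      exact_mod_cast (bohr_nonempty Γ' (hl'.pos hQ1).le).card_pos
    have h1 := hno Γ' r' hl' w
    have h2 := mul_le_mul_of_nonneg_right hα' hB0.le
    have h3 := mul_pos hα hB0
    linarith
  have k₁ := key X₁ α₁ hX₁ hXc₁ hα₁ fun Γ' r' hl w => (hinc Γ' r' hl w).1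
  have k₂ := key X₂ α₂ hX₂ hXc₂ hα₂ fun Γ' r' hl w => (hinc Γ' r' hl w).2
  by_contra! hcon
  have hη1 : η ≤ 1 := by linarith [P.hη, P.hκ1]
  set c := 0.9 * (α₁ * α₂ * #E) with hc
  have hc0 : 0 < c := by positivity
  have hαα : 0.94 * α ^ 2 ≤ α₁ * α₂ := by
    have := mul_le_mul hα₁ hα₂ (by positivity) hα₁0.le
    have h' : 0 ≤ α ^ 2 := sq_nonneg α
    linarith
  have hsum : ∑ i ∈ E₂ ×ˢ E₂, ind X₃ (i.2 - i.1) * conv F₁ F₂ (i.2 - i.1) ≤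
      -(c * ∑ i ∈ E₂ ×ˢ E₂, ind X₃ (i.2 - i.1)) := by
    have h1 : ∑ i ∈ E₂ ×ˢ E₂, ind X₃ (i.2 - i.1) * (conv F₁ F₂ (i.2 - i.1) +
        0.98 * (α₁ * α₂ * #E)) ≤ #E₂ * ∑ v, conv (ind X₁) (ind X₂) v * ind X₃ v := by
      refine le_trans ?_ (sum_sub_le_card_mul E₂ fun v =>
        mul_nonneg (conv_nonneg (ind_nonneg _) (ind_nonneg _) v) (ind_nonneg _ _))
      rw [sum_product]
      refine sum_le_sum fun z hz => sum_le_sum fun u hu => ?_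
      rw [mul_comm]
      refine mul_le_mul_of_nonneg_right ?_ (ind_nonneg _ _)
      exact hl₁.reg.conv_balanced_add_le hη1 (by positivity) hX₁ hX₂ hα₁0.le hα₂0.le hXc₁ hXc₂
        (by linarith) (by linarith) (bohr_mono Γ (by linarith) (sub_mem_bohr hu hz))
    have h2 : (#E₂ : ℝ) * ∑ v, conv (ind X₁) (ind X₂) v * ind X₃ v ≤
        #E₂ * (α ^ 3 / 16 * #E * #E₂) := mul_le_mul_of_nonneg_left hcon.le hE₂0.le
    have h3 : ∑ i ∈ E₂ ×ˢ E₂, ind X₃ (i.2 - i.1) = W := by rw [sum_product]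
    simp only [mul_add, sum_add_distrib, ← sum_mul, h3] at h1
    rw [h3]
    have h4 : (0.94 * α ^ 2 * #E) * (0.97 * α * (#E₂ : ℝ) ^ 2) ≤ (α₁ * α₂ * #E) * W :=
      mul_le_mul (mul_le_mul_of_nonneg_right hαα hE0.le) hX₃ (by positivity) (by positivity)
    have h5 : 0 ≤ α ^ 3 * #E * (#E₂ : ℝ) ^ 2 := by positivity
    rw [hc]
    linarith
  have hpow := sum_weighted_pow_ge _ _ _ hc0 hp (fun i _ => ind_nonneg _ _)
    (fun i _ => ind_le_one _ _) hsum
  rw [sum_product, sum_product] at hpow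
  have hlow : (0.4 * (α₁ * α₂ * #E)) ^ p * (#E₂ : ℝ) ^ 2 ≤
      ∑ z ∈ E₂, ∑ u ∈ E₂, conv F₁ F₂ (u - z) ^ p := by
    refine le_trans ?_ hpow
    have h1 : c ^ p = (9 / 8 : ℝ) ^ p * 2 ^ p * (0.4 * (α₁ * α₂ * #E)) ^ p := by
      rw [← mul_pow, ← mul_pow, hc]; congr 1; ring
    have h2 : (4 : ℝ) ≤ (9 / 8) ^ p :=
      le_trans (by norm_num) (pow_le_pow_right₀ (by norm_num) hp12)
    have h3 : 1 ≤ (9 / 8 : ℝ) ^ p * 2 ^ p * (0.97 * α) := by nlinarith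
    calc _ ≤ (0.4 * (α₁ * α₂ * #E)) ^ p * (#E₂ : ℝ) ^ 2 *
          ((9 / 8 : ℝ) ^ p * 2 ^ p * (0.97 * α)) := le_mul_of_one_le_right (by positivity) h3
      _ = c ^ p * (0.97 * α * (#E₂ : ℝ) ^ 2) := by rw [h1]; ring
      _ ≤ _ := mul_le_mul_of_nonneg_left hX₃ (by positivity)
  have hcs := bil_conv_sq_le E₂ F₁ F₂ p
  have h1 := (pow_le_pow_left₀ (by positivity) hlow 2).trans hcs
  have hA₁0 : 0 ≤ A₁ := bil_corr_nonneg _ _ _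
  have hA₂0 : 0 ≤ A₂ := bil_corr_nonneg _ _ _
  have h2 : A₁ * A₂ < ((0.4 * (α₁ * #X₁)) ^ p * (#E₂ : ℝ) ^ 2) *
      ((0.4 * (α₂ * #X₂)) ^ p * (#E₂ : ℝ) ^ 2) := mul_lt_mul'' k₁ k₂ hA₁0 hA₂0
  have h3 : ((0.4 * (α₁ * #X₁)) ^ p * (#E₂ : ℝ) ^ 2) * ((0.4 * (α₂ * #X₂)) ^ p * (#E₂ : ℝ) ^ 2) =
      ((0.4 * (α₁ * α₂ * #E)) ^ p * (#E₂ : ℝ) ^ 2) ^ 2 := by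
    rw [hXc₁, hXc₂, mul_pow (_ ^ p), ← pow_mul, mul_comm p 2, pow_mul]
    rw [show (0.4 * (α₁ * α₂ * (#E : ℝ))) ^ 2 =
      (0.4 * (α₁ * (α₁ * #E))) * (0.4 * (α₂ * (α₂ * #E))) by ring, mul_pow (0.4 * (α₁ * (α₁ * #E)))]
    ring
  rw [h3] at h2
  linarith

end Count

section Locate

variable {G : Type*} [AddCommGroup G] [Fintype G]

lemma Reg.sum_translate_ge {η Q r δ : ℝ} {Γ : Finset (AddChar G ℂ)} (h : Reg η Q Γ r)
    (hη1 : η ≤ 1) (hQ : 0 ≤ r / Q) {A : Finset G} {x₀ : G}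
    (hA : δ * #(bohr Γ r) ≤ ∑ b ∈ bohr Γ r, ind A (x₀ + b)) {s : G} (hs : s ∈ bohr Γ (r / Q)) :
    (δ - η) * #(bohr Γ r) ≤ ∑ y ∈ bohr Γ r, ind A (x₀ + y + s) := by
  set B := bohr Γ r with hB
  have h1 := h.sum_shift_le hη1 hQ (neg_mem_bohr hs)
  have h2 : ∑ w ∈ B, (ind A (x₀ + w) - (1 - ind B (w + -s))) ≤
      ∑ y ∈ B, ind A (x₀ + y + s) := by
    calc _ ≤ ∑ w ∈ B, ind B (w + -s) * ind A (x₀ + w) := by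
          refine sum_le_sum fun w _ => ?_
          have a1 := ind_le_one A (x₀ + w)
          have a2 := ind_le_one B (w + -s)
          nlinarith
      _ ≤ ∑ w, ind B (w + -s) * ind A (x₀ + w) :=
          sum_le_sum_of_subset_of_nonneg (subset_univ _) fun _ _ _ =>
            mul_nonneg (ind_nonneg _ _) (ind_nonneg _ _)
      _ = ∑ y, ind B y * ind A (x₀ + y + s) := by
          rw [← Equiv.sum_comp (Equiv.addRight s)]
          refine sum_congr rfl fun y _ => ?_
          simp [add_assoc]
      _ = _ := sum_ind_mul _ _
  rw [sum_sub_distrib] at h2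
  linarith

lemma exists_three_ge {β : Type*} {B : Finset β} (hB : B.Nonempty) {f₁ f₂ f₃ : β → ℝ} {δ η : ℝ}
    (h₁ : (δ - η) * #B ≤ ∑ y ∈ B, f₁ y) (h₂ : (δ - η) * #B ≤ ∑ y ∈ B, f₂ y)
    (h₃ : (δ - η) * #B ≤ ∑ y ∈ B, f₃ y) (hη : η ≤ 0.003 * δ) (u₁ : ∀ y, f₁ y ≤ 1.01 * δ)
    (u₂ : ∀ y, f₂ y ≤ 1.01 * δ) (u₃ : ∀ y, f₃ y ≤ 1.01 * δ) :
    ∃ y, 0.97 * δ ≤ f₁ y ∧ 0.97 * δ ≤ f₂ y ∧ 0.97 * δ ≤ f₃ y := by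
  obtain ⟨y, -, hy⟩ := exists_le_of_sum_le (f := fun _ => 3 * (δ - η))
    (g := fun y => f₁ y + f₂ y + f₃ y) hB (by
      rw [sum_const, nsmul_eq_mul, sum_add_distrib, sum_add_distrib]; linarith)
  refine ⟨y, ?_, ?_, ?_⟩ <;> linarith [u₁ y, u₂ y, u₃ y]

/-- Averages over a family of small shifts stay large on average over a regular Bohr set. -/
lemma Reg.sum_average_ge {ι : Type*} {η Q r δ : ℝ} {Γ : Finset (AddChar G ℂ)} (h : Reg η Q Γ r)
    (hη1 : η ≤ 1) (hQ : 0 ≤ r / Q) {A : Finset G} {x₀ : G}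
    (hA : δ * #(bohr Γ r) ≤ ∑ b ∈ bohr Γ r, ind A (x₀ + b)) {I : Finset ι} (hI : I.Nonempty)
    {s : ι → G} (hs : ∀ i ∈ I, s i ∈ bohr Γ (r / Q)) :
    (δ - η) * #(bohr Γ r) ≤ ∑ y ∈ bohr Γ r, (∑ i ∈ I, ind A (x₀ + y + s i)) / #I := by
  have hI0 : (0 : ℝ) < #I := by exact_mod_cast hI.card_pos
  rw [← sum_div, le_div_iff₀ hI0, sum_comm, mul_comm, ← nsmul_eq_mul]
  exact card_nsmul_le_sum _ _ _ fun i hi => h.sum_translate_ge hη1 hQ hA (hs i hi)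

end Locate

section Dilate

variable {p : ℕ} [Fact p.Prime]

open Classical in
/-- The frequency set of a dilated Bohr set. -/
noncomputable def dilate (t : ZMod p) (Γ : Finset (AddChar (ZMod p) ℂ)) :
    Finset (AddChar (ZMod p) ℂ) := Γ.image fun χ => χ.mulShift t⁻¹

lemma bohr_dilate {t : ZMod p} (ht : t ≠ 0) (Γ : Finset (AddChar (ZMod p) ℂ)) (r : ℝ) :
    bohr (dilate t Γ) r = (bohr Γ r).map (Equiv.mulLeft₀ t ht).toEmbedding := by
  ext x
  rw [mem_map_equiv, mem_bohr, mem_bohr]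
  simp [dilate, AddChar.mulShift_apply]

lemma card_bohr_dilate {t : ZMod p} (ht : t ≠ 0) (Γ : Finset (AddChar (ZMod p) ℂ)) (r : ℝ) :
    #(bohr (dilate t Γ) r) = #(bohr Γ r) := by
  rw [bohr_dilate ht, card_map]

lemma sum_bohr_dilate {t : ZMod p} (ht : t ≠ 0) (Γ : Finset (AddChar (ZMod p) ℂ)) (r : ℝ)
    (f : ZMod p → ℝ) : ∑ b ∈ bohr (dilate t Γ) r, f b = ∑ b ∈ bohr Γ r, f (t * b) := by
  rw [bohr_dilate ht, sum_map]; rfl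

lemma IsLevel.dilate {Q η r : ℝ} {h : ℕ} {Γ : Finset (AddChar (ZMod p) ℂ)}
    (hl : IsLevel Q η h Γ r) {t : ZMod p} (ht : t ≠ 0) :
    IsLevel Q η h (RothCount.dilate t Γ) r := by
  classical
  refine ⟨card_image_le.trans hl.card_le, hl.width, hl.le_one, ?_⟩
  have := hl.reg
  unfold Reg at *
  rwa [card_bohr_dilate ht, card_bohr_dilate ht]

lemma isLevel_empty {Q η : ℝ} (hη : 0 ≤ η) :
    IsLevel Q η 0 (∅ : Finset (AddChar (ZMod p) ℂ)) 1 := by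
  refine ⟨by simp, by simp, le_rfl, ?_⟩
  have e : ∀ r, bohr (∅ : Finset (AddChar (ZMod p) ℂ)) r = univ := fun r => by
    ext x; simp [mem_bohr]
  unfold Reg
  rw [e, e]
  have : (0 : ℝ) ≤ #(univ : Finset (ZMod p)) := Nat.cast_nonneg _
  nlinarith

end Dilate

lemma IsLevel.card_bohr_ge {G : Type*} [AddCommGroup G] [Fintype G] {Q η r : ℝ} {h H : ℕ}
    {Γ : Finset (AddChar G ℂ)} (hQ : 1 ≤ Q) (hl : IsLevel Q η h Γ r) (hH : h ≤ H) :
    ((Q ^ H)⁻¹ / 8) ^ (2 * H) * Fintype.card G ≤ #(bohr Γ r) := by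
  refine le_trans ?_ (RothCount.card_bohr_ge Γ (hl.pos hQ) hl.le_one)
  have h1 : 0 < Q ^ H := by positivity
  have h2 : (Q ^ H)⁻¹ ≤ r := by
    rw [inv_le_iff_one_le_mul₀ h1, mul_comm]
    exact pow_width_mono hQ hH hl.width
  have h3 : (Q ^ H)⁻¹ ≤ 1 := inv_le_one_of_one_le₀ (one_le_pow₀ hQ)
  gcongr
  calc ((Q ^ H)⁻¹ / 8) ^ (2 * H) ≤ ((Q ^ H)⁻¹ / 8) ^ (2 * #Γ) :=
        pow_le_pow_of_le_one (by positivity) (by linarith)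
          (Nat.mul_le_mul_left _ (hl.card_le.trans hH))
    _ ≤ (r / 8) ^ (2 * #Γ) := by gcongr

section ZMod

variable {p : ℕ} [Fact p.Prime]

/-- The solutions of a linear equation in a set. -/
def solutions (A : Finset (ZMod p)) (b₁ b₂ b₃ : ZMod p) : Finset (ZMod p × ZMod p × ZMod p) :=
  (A ×ˢ A ×ˢ A).filter fun x => b₁ * x.1 + b₂ * x.2.1 + b₃ * x.2.2 = 0

lemma sum_conv_le_card_solutions {A X₁ X₂ X₃ : Finset (ZMod p)} {b₁ b₂ b₃ y : ZMod p}
    (hb : b₁ + b₂ + b₃ = 0) (hb₁ : b₁ ≠ 0) (hb₂ : b₂ ≠ 0) (hb₃ : b₃ ≠ 0)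
    (h₁ : ∀ x ∈ X₁, y + b₁⁻¹ * x ∈ A) (h₂ : ∀ x ∈ X₂, y + b₂⁻¹ * x ∈ A)
    (h₃ : ∀ x ∈ X₃, y - b₃⁻¹ * x ∈ A) :
    ∑ v, conv (ind X₁) (ind X₂) v * ind X₃ v ≤ #(solutions A b₁ b₂ b₃) := by
  classical
  rw [sum_conv_mul, sum_ind_mul]
  simp only [sum_ind_mul]
  rw [← sum_product' (f := fun x v => ind X₃ (v + x))]
  have e : ∑ i ∈ X₂ ×ˢ X₁, ind X₃ (i.2 + i.1) =
      #((X₂ ×ˢ X₁).filter fun i => i.2 + i.1 ∈ X₃) := by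
    rw [card_filter]
    push_cast
    exact sum_congr rfl fun i _ => by simp [ind]
  rw [e]
  norm_cast
  refine card_le_card_of_injOn
    (fun i => (y + b₁⁻¹ * i.2, y + b₂⁻¹ * i.1, y - b₃⁻¹ * (i.2 + i.1))) ?_ ?_
  · rintro ⟨x₂, x₁⟩ hx
    simp only [coe_filter, mem_product, Set.mem_ofPred_eq] at hx
    simp only [solutions, coe_filter, mem_product, Set.mem_ofPred_eq]
    refine ⟨⟨h₁ _ hx.1.2, h₂ _ hx.1.1, h₃ _ hx.2⟩, ?_⟩
    field_simp
    linear_combination y * hb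
  · rintro ⟨x₂, x₁⟩ - ⟨x₂', x₁'⟩ - h
    simp only [Prod.mk.injEq, add_right_inj, mul_right_inj' (inv_ne_zero hb₁),
      mul_right_inj' (inv_ne_zero hb₂)] at h
    exact Prod.ext h.2.1 h.1

set_option maxHeartbeats 1000000 in
theorem card_solutions_ge_of_level {Q η κ ε δ δ₀ r₀ : ℝ} {H h I k ℓ m : ℕ}
    (P : Admissible Q η κ ε I k ℓ) (hreg : HasReg (ZMod p) Q η H) (hH : h + 3 * I + 20 ≤ H)
    {Γ : Finset (AddChar (ZMod p) ℂ)} (hl : IsLevel Q η h Γ r₀) {A : Finset (ZMod p)}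
    {x₀ : ZMod p} (hδ₀ : 0 < δ₀) (hδ : δ₀ ≤ δ)
    (hA : δ * #(bohr Γ r₀) ≤ ∑ b ∈ bohr Γ r₀, ind A (x₀ + b))
    (hinc : ∀ Γ' r', IsLevel Q η (h + 3 * I + 20) Γ' r' → ∀ w,
      ∑ b ∈ bohr Γ' r', ind A (w + b) ≤ 1.01 * δ * #(bohr Γ' r'))
    (hη : η ≤ 0.003 * δ₀) (hm : Even m) (hm12 : 12 ≤ m) (hmα : 1 ≤ 2 ^ m * δ₀)
    (hκ : κ ≤ (0.97 * δ₀) ^ (200 * (m + 1)) / 2) {b₁ b₂ b₃ : ℤ} (hb : b₁ + b₂ + b₃ = 0)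
    (hb₁ : (b₁ : ZMod p) ≠ 0) (hb₂ : (b₂ : ZMod p) ≠ 0) (hb₃ : (b₃ : ZMod p) ≠ 0)
    (hQ₁ : 2 * |(b₂ * b₃ : ℝ)| ≤ Q) (hQ₂ : 2 * |(b₁ * b₃ : ℝ)| ≤ Q)
    (hQ₃ : 2 * |(b₁ * b₂ : ℝ)| ≤ Q) :
    δ₀ ^ 3 / 16 * ((Q ^ H)⁻¹ / 8) ^ (4 * H) * (p : ℝ) ^ 2 ≤
      #(solutions A (b₁ : ZMod p) b₂ b₃) := by
  classical
  have hQ := P.hQ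
  have hQ1 : 1 ≤ Q := by linarith
  have hQ0 : 0 < Q := by linarith
  have hr₀ := hl.pos hQ1
  have hδ0 : 0 < δ := by linarith
  have hη1 : η ≤ 1 := by linarith [P.hη, P.hκ1]
  have hη' : η ≤ 0.003 * δ := by linarith
  obtain ⟨ρ₁, -, hρ₁, hl₁⟩ := hreg.exists_level (by linarith) (h := h + 2) (by omega)
    (hl.card_le.trans (by omega)) (ρ := r₀ / Q ^ 2)
    (by rw [pow_add]; have := hl.width; field_simp; linarith)
    (by rw [div_le_one (by positivity)]; nlinarith [hl.le_one])
  have hρ₁0 := hl₁.pos hQ1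
  obtain ⟨ρ₂, -, hρ₂, hl₂⟩ := hreg.exists_level (by linarith) (h := h + 5) (by omega)
    (hl.card_le.trans (by omega)) (ρ := ρ₁ / Q ^ 2)
    (by
      have := hl₁.width
      rw [show h + 5 = h + 2 + 1 + 2 by ring, pow_add _ (h + 2 + 1)]
      field_simp; linarith)
    (by rw [div_le_one (by positivity)]; nlinarith [hl₁.le_one])
  have hρ₂0 := hl₂.pos hQ1
  replace hl₁ := hl₁.mono hQ1 (H := h + 6) (by omega)
  have hρ₂₁ : 2 * ρ₂ ≤ ρ₁ / Q := by
    calc _ ≤ Q * (ρ₁ / Q ^ 2) := mul_le_mul (by linarith) hρ₂ hρ₂0.le hQ0.le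
      _ = ρ₁ / Q := by field_simp
  have hρ₂₁' : ρ₂ ≤ ρ₁ := by
    have : ρ₁ / Q ≤ ρ₁ := div_le_self hρ₁0.le hQ1
    linarith
  have hup : ∀ Γ' r' h', IsLevel Q η h' Γ' r' → h' ≤ h + 3 * I + 20 → ∀ t : ZMod p, t ≠ 0 → ∀ w,
      ∑ b ∈ bohr Γ' r', ind A (w + t * b) ≤ 1.01 * δ * #(bohr Γ' r') := by
    intro Γ' r' h' hl' hh' t ht w
    have := hinc _ _ ((hl'.dilate ht).mono hQ1 hh') w
    rwa [sum_bohr_dilate ht, card_bohr_dilate ht] at this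
  set B₁ := bohr Γ ρ₁ with hB₁
  set B₂ := bohr Γ ρ₂ with hB₂
  have hB₁n : B₁.Nonempty := bohr_nonempty Γ hρ₁0.le
  have hB₂n : B₂.Nonempty := bohr_nonempty Γ hρ₂0.le
  have hB₁0 : (0 : ℝ) < #B₁ := by exact_mod_cast hB₁n.card_pos
  have hB₂0 : (0 : ℝ) < #B₂ := by exact_mod_cast hB₂n.card_pos
  have hshift : ∀ (t : ℤ) ρ, 0 ≤ ρ → 2 * |(t : ℝ)| ≤ Q → ρ ≤ 2 * (r₀ / Q ^ 2) →
      ∀ β ∈ bohr Γ ρ, (t : ZMod p) * β ∈ bohr Γ (r₀ / Q) := by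
    intro t ρ hρ0 ht hρ β hβ
    have := zsmul_mem_bohr hβ t
    rw [zsmul_eq_mul] at this
    refine bohr_mono Γ ?_ this
    calc |(t : ℝ)| * ρ ≤ (Q / 2) * (2 * (r₀ / Q ^ 2)) :=
          mul_le_mul (by linarith) hρ hρ0 (by positivity)
      _ = r₀ / Q := by field_simp
  have hrQ : 0 ≤ r₀ / Q := by positivity
  have a₁ := hl.reg.sum_average_ge hη1 hrQ hA hB₁n
    (hshift (b₂ * b₃) ρ₁ hρ₁0.le (by push_cast; exact hQ₁) (by linarith))
  have a₂ := hl.reg.sum_average_ge hη1 hrQ hA hB₁n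
    (hshift (b₁ * b₃) ρ₁ hρ₁0.le (by push_cast; exact hQ₂) (by linarith))
  have a₃ := hl.reg.sum_average_ge hη1 hrQ hA (hB₂n.product hB₂n)
    (s := fun i => ((-(b₁ * b₂) : ℤ) : ZMod p) * (i.2 - i.1))
    (fun i hi => hshift (-(b₁ * b₂)) (ρ₂ + ρ₂) (by linarith)
      (by push_cast; rw [abs_neg]; exact hQ₃)
      (by linarith) _ (sub_mem_bohr (mem_product.1 hi).2 (mem_product.1 hi).1))
  have c₁ : ((b₂ * b₃ : ℤ) : ZMod p) ≠ 0 := by push_cast; exact mul_ne_zero hb₂ hb₃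
  have c₂ : ((b₁ * b₃ : ℤ) : ZMod p) ≠ 0 := by push_cast; exact mul_ne_zero hb₁ hb₃
  have c₃ : ((-(b₁ * b₂) : ℤ) : ZMod p) ≠ 0 := by
    push_cast; exact neg_ne_zero.2 (mul_ne_zero hb₁ hb₂)
  obtain ⟨y, y₁, y₂, y₃⟩ := exists_three_ge (bohr_nonempty Γ hr₀.le) a₁ a₂ a₃ hη'
    (fun y => by rw [div_le_iff₀ hB₁0]; exact hup _ _ _ hl₁ (by omega) _ c₁ _)
    (fun y => by rw [div_le_iff₀ hB₁0]; exact hup _ _ _ hl₁ (by omega) _ c₂ _)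
    (fun y => by
      rw [card_product, sum_product, div_le_iff₀ (by push_cast; positivity)]
      push_cast
      rw [mul_left_comm, ← nsmul_eq_mul]
      refine sum_le_card_nsmul _ _ _ fun z _ => ?_
      refine le_trans (le_of_eq ?_) (hup _ _ _ hl₂ (by omega) _ c₃ (x₀ + y + b₁ * b₂ * z))
      refine sum_congr rfl fun u _ => ?_
      congr 1; push_cast; ring)
  set c : ZMod p := b₁ * b₂ * b₃ with hc
  have hc0 : c ≠ 0 := mul_ne_zero (mul_ne_zero hb₁ hb₂) hb₃
  have hk₁ := hl₁.dilate hc0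
  have hk₂ := hl₂.dilate hc0
  set E₁ := bohr (dilate c Γ) ρ₁ with hE₁
  set E₂ := bohr (dilate c Γ) ρ₂ with hE₂
  set X₁ := E₁.filter fun x => x₀ + y + (b₁ : ZMod p)⁻¹ * x ∈ A with hX₁
  set X₂ := E₁.filter fun x => x₀ + y + (b₂ : ZMod p)⁻¹ * x ∈ A with hX₂
  set X₃ := univ.filter fun x => x₀ + y - (b₃ : ZMod p)⁻¹ * x ∈ A with hX₃
  have hcard : ∀ t : ZMod p, (#(E₁.filter fun x => x₀ + y + t * x ∈ A) : ℝ) =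
      ∑ b ∈ B₁, ind A (x₀ + y + t * c * b) := by
    intro t
    rw [card_filter]
    push_cast
    rw [hE₁, sum_bohr_dilate hc0]
    exact sum_congr rfl fun b _ => by simp [ind, mul_assoc]
  have d₁ : #X₁ = (∑ b ∈ B₁, ind A (x₀ + y + ((b₂ * b₃ : ℤ) : ZMod p) * b)) / #B₁ * #E₁ := by
    rw [hX₁, hcard, hE₁, card_bohr_dilate hc0, div_mul_cancel₀ _ hB₁0.ne', hc]
    refine sum_congr rfl fun b _ => ?_
    congr 2; push_cast; field_simp
  have d₂ : #X₂ = (∑ b ∈ B₁, ind A (x₀ + y + ((b₁ * b₃ : ℤ) : ZMod p) * b)) / #B₁ * #E₁ := by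
    rw [hX₂, hcard, hE₁, card_bohr_dilate hc0, div_mul_cancel₀ _ hB₁0.ne', hc]
    refine sum_congr rfl fun b _ => ?_
    congr 2; push_cast; field_simp
  have d₃ : 0.97 * δ * (#E₂ : ℝ) ^ 2 ≤ ∑ z ∈ E₂, ∑ u ∈ E₂, ind X₃ (u - z) := by
    rw [card_product, le_div_iff₀ (by push_cast; positivity), sum_product] at y₃
    rw [hE₂, sum_bohr_dilate hc0, card_bohr_dilate hc0]
    push_cast at y₃
    refine le_trans (le_of_eq (by ring)) (y₃.trans (le_of_eq ?_))
    refine sum_congr rfl fun z _ => ?_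
    rw [sum_bohr_dilate hc0]
    refine sum_congr rfl fun u _ => ?_
    have : x₀ + y + -((b₁ : ZMod p) * b₂) * (u - z) =
        x₀ + y - (b₃ : ZMod p)⁻¹ * (c * u - c * z) := by
      rw [hc]; field_simp; ring
    rw [this]
    simp [ind, hX₃]
  have hno : ∀ (t : ZMod p), t ≠ 0 → ∀ Γ' r', IsLevel Q η (h + 6 + 3 * I + 10) Γ' r' → ∀ w,
      ∑ b ∈ bohr Γ' r', ind (E₁.filter fun x => x₀ + y + t * x ∈ A) (w + b) ≤
        1.01 * δ * #(bohr Γ' r') := by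
    intro t ht Γ' r' hl' w
    refine le_trans (sum_le_sum fun b _ => ?_) (hup _ _ _ hl' (by omega) t ht (x₀ + y + t * w))
    by_cases hb : w + b ∈ E₁.filter fun x => x₀ + y + t * x ∈ A
    · rw [ind_of_mem hb, ind_of_mem]
      have := (mem_filter.1 hb).2
      rwa [mul_add, ← add_assoc] at this
    · rw [ind_of_notMem hb]; exact ind_nonneg _ _
  have hcount := count_ge_of_no_increment P hreg (by omega) hk₁ hk₂ hρ₂₁ (filter_subset _ _)
    (filter_subset _ _) hδ0 d₁ d₂ y₁ y₂ d₃ (by linarith) hm hm12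
    (hmα.trans (by gcongr)) (hκ.trans (by gcongr))
    (fun Γ' r' hl' w => ⟨hno _ (inv_ne_zero hb₁) Γ' r' hl' w, hno _ (inv_ne_zero hb₂) Γ' r' hl' w⟩)
  have hsol := sum_conv_le_card_solutions (A := A) (X₁ := X₁) (X₂ := X₂) (X₃ := X₃)
    (b₁ := b₁) (b₂ := b₂) (b₃ := b₃) (y := x₀ + y)
    (by exact_mod_cast congrArg (Int.cast : ℤ → ZMod p) hb) hb₁ hb₂ hb₃
    (fun x hx => (mem_filter.1 hx).2) (fun x hx => (mem_filter.1 hx).2)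
    (fun x hx => (mem_filter.1 hx).2)
  refine le_trans ?_ (hcount.trans hsol)
  have e₁ := hk₁.card_bohr_ge hQ1 (H := H) (by omega)
  have e₂ := hk₂.card_bohr_ge hQ1 (H := H) (by omega)
  rw [ZMod.card] at e₁ e₂
  calc δ₀ ^ 3 / 16 * ((Q ^ H)⁻¹ / 8) ^ (4 * H) * (p : ℝ) ^ 2 = δ₀ ^ 3 / 16 *
        ((((Q ^ H)⁻¹ / 8) ^ (2 * H) * p) * (((Q ^ H)⁻¹ / 8) ^ (2 * H) * p)) := by ring
    _ ≤ δ ^ 3 / 16 * (#E₁ * #E₂) := by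
        refine mul_le_mul (by gcongr) (mul_le_mul e₁ e₂ (by positivity) (by positivity))
          (by positivity) (by positivity)
    _ = _ := by ring

theorem card_solutions_ge {Q η κ ε δ₀ : ℝ} {H I J k ℓ m : ℕ}
    (P : Admissible Q η κ ε I k ℓ) (hreg : HasReg (ZMod p) Q η H) (hH : (3 * I + 20) * J ≤ H)
    (hJ : 1 < 1.01 ^ J * δ₀) {A : Finset (ZMod p)} (hδ₀ : 0 < δ₀) (hA : δ₀ * p ≤ #A)
    (hη : η ≤ 0.003 * δ₀) (hm : Even m) (hm12 : 12 ≤ m) (hmα : 1 ≤ 2 ^ m * δ₀)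
    (hκ : κ ≤ (0.97 * δ₀) ^ (200 * (m + 1)) / 2) {b₁ b₂ b₃ : ℤ} (hb : b₁ + b₂ + b₃ = 0)
    (hb₁ : (b₁ : ZMod p) ≠ 0) (hb₂ : (b₂ : ZMod p) ≠ 0) (hb₃ : (b₃ : ZMod p) ≠ 0)
    (hQ₁ : 2 * |(b₂ * b₃ : ℝ)| ≤ Q) (hQ₂ : 2 * |(b₁ * b₃ : ℝ)| ≤ Q)
    (hQ₃ : 2 * |(b₁ * b₂ : ℝ)| ≤ Q) :
    δ₀ ^ 3 / 16 * ((Q ^ H)⁻¹ / 8) ^ (4 * H) * (p : ℝ) ^ 2 ≤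
      #(solutions A (b₁ : ZMod p) b₂ b₃) := by
  have hQ1 : 1 ≤ Q := by linarith [P.hQ]
  have hpos : ∀ {h : ℕ} {Γ : Finset (AddChar (ZMod p) ℂ)} {r : ℝ}, IsLevel Q η h Γ r →
      (0 : ℝ) < #(bohr Γ r) := fun hl => by
    exact_mod_cast (bohr_nonempty _ (hl.pos hQ1).le).card_pos
  obtain ⟨j, hj, δ, hδ, ⟨Γ, r, hl, x₀, hx⟩, hmax⟩ := exists_no_increment
    (R := fun j δ => ∃ (Γ : Finset (AddChar (ZMod p) ℂ)) (r : ℝ),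
      IsLevel Q η ((3 * I + 20) * j) Γ r ∧
        ∃ x₀, δ * #(bohr Γ r) ≤ ∑ b ∈ bohr Γ r, ind A (x₀ + b))
    (δ₀ := δ₀) (c := 1.01) (J := J)
    ⟨∅, 1, by simpa using isLevel_empty P.hη0, 0, by
      have : bohr (∅ : Finset (AddChar (ZMod p) ℂ)) 1 = univ := by
        ext; simp [mem_bohr]
      simpa [this, sum_ind, ZMod.card] using hA⟩
    (by
      rintro δ ⟨Γ, r, hl, x₀, hx⟩
      refine le_of_mul_le_mul_right (hx.trans ?_) (hpos hl)
      rw [one_mul]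
      simpa using sum_le_card_nsmul (bohr Γ r) (fun b => ind A (x₀ + b)) 1
        fun b _ => ind_le_one _ _)
    (by norm_num) hδ₀.le hJ
  have hgj : (3 * I + 20) * j + 3 * I + 20 = (3 * I + 20) * (j + 1) := by ring
  refine card_solutions_ge_of_level P hreg ?_ hl hδ₀ hδ hx ?_ hη hm hm12 hmα hκ hb hb₁ hb₂ hb₃
    hQ₁ hQ₂ hQ₃
  · rw [hgj]; exact (Nat.mul_le_mul_left _ hj).trans hH
  · intro Γ' r' hl' w
    rw [hgj] at hl'
    have := hmax ((∑ b ∈ bohr Γ' r', ind A (w + b)) / #(bohr Γ' r'))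
      ⟨Γ', r', hl', w, by rw [div_mul_cancel₀ _ (hpos hl').ne']⟩
    rwa [div_le_iff₀ (hpos hl')] at this

end ZMod

lemma hasReg_of_pow_le {G : Type*} [AddCommGroup G] [Fintype G] {η : ℝ} {K H : ℕ} (hK : 2 ≤ K)
    (hη : η ≤ 1) (h : (1 - η) ^ K ≤ ((((4 * K : ℝ)) ^ H)⁻¹ / 16) ^ (2 * H)) :
    HasReg G (4 * K) η H := by
  intro Γ ρ hΓ hρ hρ1
  have hK' : (2 : ℝ) ≤ K := by exact_mod_cast hK
  have h1 : (0 : ℝ) < (4 * K : ℝ) ^ H := by positivity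
  have h2 : ((4 * K : ℝ) ^ H)⁻¹ ≤ ρ := by
    rwa [inv_le_iff_one_le_mul₀ h1, mul_comm]
  have hρ0 : 0 < ρ := lt_of_lt_of_le (by positivity) h2
  refine exists_reg Γ hK hη hρ0 hρ1 (h.trans ?_)
  have h3 : ((4 * K : ℝ) ^ H)⁻¹ ≤ 1 := inv_le_one_of_one_le₀ (one_le_pow₀ (by linarith))
  calc ((((4 * K : ℝ)) ^ H)⁻¹ / 16) ^ (2 * H) ≤ ((((4 * K : ℝ)) ^ H)⁻¹ / 16) ^ (2 * #Γ) :=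
        pow_le_pow_of_le_one (by positivity) (by linarith) (Nat.mul_le_mul_left _ hΓ)
    _ ≤ (ρ / 16) ^ (2 * #Γ) := by gcongr

lemma sixteen_le_exp_three : (16 : ℝ) ≤ Real.exp 3 := by
  have h := Real.exp_one_gt_d9
  have : Real.exp 3 = Real.exp 1 ^ 3 := by rw [← Real.exp_nat_mul]; norm_num
  rw [this]
  calc (16 : ℝ) ≤ 2.7 ^ 3 := by norm_num
    _ ≤ _ := by gcongr; linarith

lemma exp_le_pow_of_le {x : ℝ} (h : 2.72 ≤ x) (j : ℕ) : Real.exp j ≤ x ^ j := by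
  rw [← mul_one (j : ℝ), Real.exp_nat_mul]
  gcongr
  linarith [Real.exp_one_lt_d9]

lemma le_exp_of_nat_le {x a : ℝ} (j : ℕ) (h : x ≤ 2 ^ j) (ha : (j : ℝ) ≤ a) : x ≤ Real.exp a := by
  refine h.trans (le_trans ?_ (Real.exp_le_exp.2 ha))
  rw [← mul_one (j : ℝ), Real.exp_nat_mul]
  gcongr
  linarith [Real.exp_one_gt_d9]

/-- The scale of the logarithms of the parameters when the density is `exp (-n)`. -/
def logScale (n : ℕ) : ℕ := 7000 * n ^ 2

/-- The number of samples in the almost-periodicity argument. -/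
def sampleCount (n : ℕ) : ℕ := 1920000 * logScale n ^ 3

/-- The number of steps of the inner iteration. -/
def innerSteps (n : ℕ) : ℕ := 20 * (logScale n * sampleCount n + 2)

/-- A bound for the rank reached by the outer iteration. -/
def rankBound (n : ℕ) : ℕ := (3 * innerSteps n + 20) * (400 * n)

lemma sq_le_logScale {n : ℕ} : 7000 * (n : ℝ) ^ 2 = logScale n := by
  simp [logScale]

lemma admissible {n : ℕ} (hn : 1 ≤ n) {Q : ℝ} (hQ : 2 * logScale n + 1 ≤ Q) :
    Admissible Q (Real.exp (-(7000 * n ^ 2))) (Real.exp (-(6000 * n ^ 2)))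
      (1 / (400 * logScale n)) (innerSteps n) (logScale n) (sampleCount n) := by
  have hn1 : (1 : ℝ) ≤ n := by exact_mod_cast hn
  have hn2 : (1 : ℝ) ≤ (n : ℝ) ^ 2 := one_le_pow₀ hn1
  have hk := sq_le_logScale (n := n)
  set k := logScale n with hkdef
  have hk7 : (7000 : ℝ) ≤ k := by linarith
  have hℓ : (sampleCount n : ℝ) = 1920000 * (k : ℝ) ^ 3 := by simp [sampleCount, hkdef]
  have hI : innerSteps n = 20 * (k * sampleCount n + 2) := rfl
  have e1 : Real.exp (-(6000 * n ^ 2 : ℝ)) / 40000 ≥ Real.exp (-(7000 * n ^ 2)) := by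
    rw [ge_iff_le, le_div_iff₀ (by norm_num), show -(6000 * n ^ 2 : ℝ) =
      -(7000 * n ^ 2) + 1000 * n ^ 2 by ring, Real.exp_add]
    gcongr
    exact le_exp_of_nat_le 16 (by norm_num) (by push_cast; linarith)
  refine ⟨by linarith, (Real.exp_pos _).le, e1, Real.exp_pos _, ?_, hQ, ?_, by positivity, ?_, ?_,
    ?_, ?_⟩
  · rw [Real.exp_le_one_iff]; nlinarith
  · have h4 : Real.exp k ≤ 4 ^ k := exp_le_pow_of_le (by norm_num) k
    rw [one_div, inv_pow]
    have : ((4 : ℝ) ^ k)⁻¹ ≤ Real.exp (-k) := by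
      rw [Real.exp_neg]; exact inv_anti₀ (Real.exp_pos _) h4
    rw [← hk] at this
    linarith [Real.exp_pos (-(6000 * n ^ 2 : ℝ))]
  · rw [div_le_one (by positivity)]; linarith
  · have : (0 : ℝ) < sampleCount n := by rw [hℓ]; positivity
    exact_mod_cast this
  · have e2 : (1 / (400 * (k : ℝ))) ^ 2 * sampleCount n / 4 = 3 * k := by
      rw [hℓ]; field_simp; norm_num
    rw [e2]
    have e3 : Real.exp (-(3 * k : ℝ)) / Real.exp (-(6000 * n ^ 2 : ℝ)) ≤ Real.exp (-(2 * k)) := by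
      rw [← Real.exp_sub]
      apply Real.exp_le_exp.2; linarith
    have e4 : (k : ℝ) * (3200 * Real.exp (-(2 * k : ℝ))) ≤ 1 := by
      rw [Real.exp_neg, ← mul_assoc, ← div_eq_mul_inv, div_le_one (Real.exp_pos _), two_mul,
        Real.exp_add]
      refine mul_le_mul (by linarith [Real.add_one_le_exp (k : ℝ)])
        (le_exp_of_nat_le 12 (by norm_num) (by push_cast; linarith)) (by norm_num)
        (Real.exp_pos _).le
    have e5 : (k : ℝ) * (2 * (1 / (400 * k))) = 0.005 := by field_simp; norm_num
    have e6 : (k : ℝ) * (16 * Real.exp (-(3 * k : ℝ)) / Real.exp (-(6000 * n ^ 2 : ℝ))) ≤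
        k * (16 * Real.exp (-(2 * k))) := by
      rw [mul_div_assoc]; gcongr
    rw [mul_add, e5]
    linarith
  · have e2 : Real.exp (-k) ≤ Real.exp (-(6000 * n ^ 2 : ℝ)) / 2 := by
      rw [← hk]; linarith [Real.exp_pos (-(6000 * n ^ 2 : ℝ))]
    have e3 : Real.exp ((k * sampleCount n + 2 : ℕ) : ℝ) ≤ 1.1 ^ innerSteps n := by
      rw [hI, pow_mul]
      exact exp_le_pow_of_le (by norm_num) _
    have e4 : Real.exp (-k) ^ sampleCount n / 2 ≤
        (Real.exp (-(6000 * n ^ 2 : ℝ)) / 2) ^ sampleCount n / 2 := by gcongr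
    have e5 : (1 : ℝ) < Real.exp ((k * sampleCount n + 2 : ℕ) : ℝ) *
        (Real.exp (-k) ^ sampleCount n / 2) := by
      rw [← Real.exp_nat_mul, ← mul_div_assoc, ← Real.exp_add]
      push_cast
      rw [show (k * sampleCount n + 2 + sampleCount n * -k : ℝ) = 2 by ring,
        lt_div_iff₀ (by norm_num)]
      linarith [Real.add_one_le_exp (2 : ℝ)]
    exact e5.trans_le (mul_le_mul e3 e4 (by positivity) (by positivity))

lemma logScale_le_rankBound {n : ℕ} (hn : 1 ≤ n) :
    logScale n + 12 * n + 12 ≤ rankBound n := by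
  have h : logScale n ≤ innerSteps n := by
    have : 1 ≤ sampleCount n := by
      unfold sampleCount logScale; exact Nat.succ_le_of_lt (by positivity)
    unfold innerSteps
    nlinarith
  unfold rankBound
  nlinarith

lemma width_exponent_le {H k B : ℕ} (hk : k ≤ H) (hH : 12 ≤ H) (hB : 1 ≤ B) :
    6 * H * ((H + k + B + 1) * H + 1) ≤ H ^ 4 * (B + 2) := by
  have h1 : (H + k + B + 1) * H + 1 ≤ H * (2 * H + B + 2) := by nlinarith
  have h2 : 2 * H + B + 2 ≤ 2 * H * (B + 2) := by nlinarith
  calc 6 * H * ((H + k + B + 1) * H + 1) ≤ 6 * H * (H * (2 * H * (B + 2))) := by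
        gcongr
        exact h1.trans (by gcongr)
    _ = 12 * H ^ 3 * (B + 2) := by ring
    _ ≤ H * H ^ 3 * (B + 2) := by gcongr
    _ = _ := by ring

lemma two_mul_add_one_le_sixteen_pow (j : ℕ) : 2 * j + 1 ≤ 16 ^ j := by
  induction j with
  | zero => simp
  | succ j ih => rw [pow_succ]; omega

lemma hasReg_sixteen_pow {G : Type*} [AddCommGroup G] [Fintype G] {n B : ℕ} (hn : 1 ≤ n)
    (hB : 1 ≤ B) : HasReg G (4 * (16 ^ (rankBound n + logScale n + B) : ℕ))
      (Real.exp (-(7000 * n ^ 2))) (rankBound n) := by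
  have hkH := logScale_le_rankBound hn
  have hk := sq_le_logScale (n := n)
  rw [hk]
  set H := rankBound n
  set k := logScale n
  set s := H + k + B with hs
  have hH12 : 12 ≤ H := by omega
  apply hasReg_of_pow_le
  · calc 2 ≤ 16 ^ 1 := by norm_num
      _ ≤ 16 ^ s := Nat.pow_le_pow_right (by norm_num) (by omega)
  · rw [Real.exp_le_one_iff]; simp
  have e1 : (1 - Real.exp (-(k : ℝ))) ^ (16 ^ s) ≤
      Real.exp (-((16 : ℝ) ^ s * Real.exp (-(k : ℝ)))) := by
    have h1 := Real.add_one_le_exp (-Real.exp (-(k : ℝ)))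
    calc (1 - Real.exp (-(k : ℝ))) ^ (16 ^ s) ≤ Real.exp (-Real.exp (-(k : ℝ))) ^ (16 ^ s) := by
          gcongr
          · have : Real.exp (-(k : ℝ)) ≤ 1 := by rw [Real.exp_le_one_iff]; simp
            linarith
          · linarith
      _ = _ := by rw [← Real.exp_nat_mul]; congr 1; push_cast; ring
  have e2 : ((6 * H * ((H + k + B + 1) * H + 1) : ℕ) : ℝ) ≤
      (16 : ℝ) ^ s * Real.exp (-(k : ℝ)) := by
    have h1 : Real.exp (k : ℝ) ≤ (16 : ℝ) ^ k := exp_le_pow_of_le (by norm_num) k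
    have h2 : H ^ 4 * (B + 2) ≤ 16 ^ H * 16 ^ B := by
      refine Nat.mul_le_mul ?_ ?_
      · rw [show 16 = 2 ^ 4 by norm_num, ← pow_mul, mul_comm, pow_mul]
        exact Nat.pow_le_pow_left Nat.lt_two_pow_self.le _
      · have := two_mul_add_one_le_sixteen_pow B
        omega
    have h3 : ((6 * H * ((H + k + B + 1) * H + 1) : ℕ) : ℝ) ≤ 16 ^ H * 16 ^ B := by
      exact_mod_cast (width_exponent_le (by omega) hH12 hB).trans h2
    rw [hs, pow_add, pow_add, Real.exp_neg, ← div_eq_mul_inv, le_div_iff₀ (Real.exp_pos _)]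
    calc _ ≤ ((16 : ℝ) ^ H * 16 ^ B) * 16 ^ k := by gcongr
      _ = _ := by ring
  have e3 : Real.exp (-(3 * ((s + 1) * H + 1) : ℕ)) ≤
      ((4 * ((16 ^ s : ℕ) : ℝ)) ^ H)⁻¹ / 16 := by
    rw [Real.exp_neg, div_eq_mul_inv, ← mul_inv]
    apply inv_anti₀ (by positivity)
    calc (4 * ((16 ^ s : ℕ) : ℝ)) ^ H * 16 ≤ (16 * (16 : ℝ) ^ s) ^ H * 16 := by
          push_cast; gcongr; norm_num
      _ = 16 ^ ((s + 1) * H + 1) := by rw [← pow_succ', ← pow_mul, pow_succ]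
      _ ≤ Real.exp 3 ^ ((s + 1) * H + 1) := by gcongr; exact sixteen_le_exp_three
      _ = _ := by rw [← Real.exp_nat_mul]; congr 1; push_cast; ring
  calc (1 - Real.exp (-(k : ℝ))) ^ (16 ^ s) ≤
        Real.exp (-((6 * H * ((H + k + B + 1) * H + 1) : ℕ) : ℝ)) :=
        e1.trans (Real.exp_le_exp.2 (by linarith))
    _ = Real.exp (-(3 * ((s + 1) * H + 1) : ℕ)) ^ (2 * H) := by
        rw [← Real.exp_nat_mul]; congr 1; push_cast; rw [hs]; push_cast; ring
    _ ≤ _ := by gcongr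

lemma exists_rankBound_le : ∃ C : ℕ, ∀ n, 1 ≤ n → rankBound n ≤ C * n ^ 9 := by
  refine ⟨(3 * (20 * (7000 * (1920000 * 7000 ^ 3) + 2)) + 20) * 400, fun n hn => ?_⟩
  have h1 : 1 ≤ n ^ 8 := Nat.one_le_pow _ _ hn
  have h2 : rankBound n = (3 * (20 * (7000 * (1920000 * 7000 ^ 3) * n ^ 8 + 2)) + 20) *
      (400 * n) := by
    unfold rankBound innerSteps sampleCount logScale; ring
  rw [h2]
  calc _ ≤ (3 * (20 * (7000 * (1920000 * 7000 ^ 3) * n ^ 8 + 2 * n ^ 8)) + 20 * n ^ 8) *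
      (400 * n) := by gcongr <;> omega
    _ = _ := by ring

/-- A linear equation in three variables with coefficients summing to zero has many solutions in
any subset of a cyclic group of prime order whose density is at least `exp (-n)`. -/
theorem exists_card_solutions_ge : ∃ C : ℕ, ∀ n B p : ℕ, ∀ [Fact p.Prime], 1 ≤ n → 1 ≤ B →
    ∀ A : Finset (ZMod p), Real.exp (-n) * p ≤ #A → ∀ b₁ b₂ b₃ : ℤ, b₁ + b₂ + b₃ = 0 →
    (b₁ : ZMod p) ≠ 0 → (b₂ : ZMod p) ≠ 0 → (b₃ : ZMod p) ≠ 0 →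
    |(b₂ * b₃ : ℝ)| ≤ B → |(b₁ * b₃ : ℝ)| ≤ B → |(b₁ * b₂ : ℝ)| ≤ B →
    Real.exp (-(C * (B + 2) * n ^ 36)) * (p : ℝ) ^ 2 ≤ #(solutions A (b₁ : ZMod p) b₂ b₃) := by
  obtain ⟨C, hC⟩ := exists_rankBound_le
  refine ⟨C ^ 4 * 3, fun n B p _ hn hB A hA b₁ b₂ b₃ hb hb₁ hb₂ hb₃ h₁ h₂ h₃ => ?_⟩
  have hn1 : (1 : ℝ) ≤ n := by exact_mod_cast hn
  have hn2 : (n : ℝ) ≤ (n : ℝ) ^ 2 := by nlinarith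
  have hkH := logScale_le_rankBound hn
  have hk := sq_le_logScale (n := n)
  have hreg := hasReg_sixteen_pow (G := ZMod p) hn hB
  have hHC := hC n hn
  set s := rankBound n + logScale n + B with hs
  set Q : ℝ := 4 * (16 ^ s : ℕ) with hQ
  have hQs : 2 * (s : ℝ) + 1 ≤ Q := by
    have : 2 * (s : ℝ) + 1 ≤ 16 ^ s := by exact_mod_cast two_mul_add_one_le_sixteen_pow s
    rw [hQ]; push_cast
    have : (0 : ℝ) < 16 ^ s := by positivity
    linarith
  have hsk : (s : ℝ) = rankBound n + logScale n + B := by rw [hs]; push_cast; ring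
  have hH0 : (0 : ℝ) ≤ rankBound n := by positivity
  have hB0 : (0 : ℝ) ≤ B := by positivity
  have hk0 : (0 : ℝ) ≤ logScale n := by positivity
  have P := admissible hn (Q := Q) (by linarith)
  have hcount := card_solutions_ge P hreg (J := 400 * n) (m := 12 * n) le_rfl (δ₀ := Real.exp (-n))
    ?_ (Real.exp_pos _) hA ?_ ⟨6 * n, by ring⟩ (by omega) ?_ ?_ hb hb₁ hb₂ hb₃
    (by linarith) (by linarith) (by linarith)
  · refine le_trans ?_ hcount
    gcongr
    have e3 : Real.exp (-(3 * ((s + 1) * rankBound n + 1) : ℕ)) ≤ (Q ^ rankBound n)⁻¹ / 8 := by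
      rw [Real.exp_neg, div_eq_mul_inv, ← mul_inv]
      apply inv_anti₀ (by positivity)
      calc Q ^ rankBound n * 8 ≤ (16 * (16 : ℝ) ^ s) ^ rankBound n * 16 := by
            rw [hQ]; push_cast; gcongr <;> norm_num
        _ = 16 ^ ((s + 1) * rankBound n + 1) := by rw [← pow_succ', ← pow_mul, pow_succ]
        _ ≤ Real.exp 3 ^ ((s + 1) * rankBound n + 1) := by gcongr; exact sixteen_le_exp_three
        _ = _ := by rw [← Real.exp_nat_mul]; congr 1; push_cast; ring
    have e4 : Real.exp (-(3 * n + 3)) ≤ Real.exp (-(n : ℝ)) ^ 3 / 16 := by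
      rw [neg_add, Real.exp_add, div_eq_mul_inv, ← Real.exp_nat_mul, Real.exp_neg 3]
      refine mul_le_mul (Real.exp_le_exp.2 (by push_cast; linarith))
        (inv_anti₀ (by norm_num) sixteen_le_exp_three) (by positivity) (by positivity)
    have e5 : 3 * ((s + 1) * rankBound n + 1) * (4 * rankBound n) + (3 * n + 3) ≤
        C ^ 4 * 3 * (B + 2) * n ^ 36 := by
      have := width_exponent_le (k := logScale n) (B := B) (H := rankBound n)
        (by omega) (by omega) hB
      rw [← hs] at this
      have h4 : 3 * n + 3 ≤ rankBound n ^ 4 * (B + 2) := by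
        calc 3 * n + 3 ≤ rankBound n ^ 1 * 1 := by rw [pow_one]; omega
          _ ≤ rankBound n ^ 4 * (B + 2) :=
            Nat.mul_le_mul (Nat.pow_le_pow_right (by omega) (by norm_num)) (by omega)
      calc _ ≤ rankBound n ^ 4 * 3 * (B + 2) := by nlinarith
        _ ≤ (C * n ^ 9) ^ 4 * 3 * (B + 2) := by gcongr
        _ = _ := by ring
    calc Real.exp (-((C ^ 4 * 3 : ℕ) * (B + 2) * n ^ 36)) ≤
          Real.exp (-(3 * n + 3) + (4 * rankBound n : ℕ) *
            (-(3 * ((s + 1) * rankBound n + 1) : ℕ))) := by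
          apply Real.exp_le_exp.2
          have e6 : ((3 * ((s + 1) * rankBound n + 1) * (4 * rankBound n) + (3 * n + 3) : ℕ) : ℝ) ≤
            (C ^ 4 * 3 * (B + 2) * n ^ 36 : ℕ) := by exact_mod_cast e5
          push_cast at e6 ⊢
          linarith
      _ = Real.exp (-(3 * n + 3)) *
          Real.exp (-(3 * ((s + 1) * rankBound n + 1) : ℕ)) ^ (4 * rankBound n) := by
          rw [Real.exp_add, Real.exp_nat_mul]
      _ ≤ _ := mul_le_mul e4 (by gcongr) (by positivity) (by positivity)
  · have e1 : Real.exp ((2 * n : ℕ) : ℝ) ≤ (1.01 : ℝ) ^ (400 * n) := by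
      rw [show 400 * n = 200 * (2 * n) by ring, pow_mul]
      exact exp_le_pow_of_le (by norm_num) _
    calc (1 : ℝ) < Real.exp ((2 * n : ℕ) : ℝ) * Real.exp (-n) := by
          rw [← Real.exp_add, Real.one_lt_exp_iff]; push_cast; linarith
      _ ≤ _ := by gcongr
  · rw [show -(7000 * n ^ 2 : ℝ) = -(7000 * n ^ 2 - n) + -n by ring, Real.exp_add]
    gcongr
    rw [Real.exp_neg]
    refine (inv_anti₀ (by norm_num) (le_exp_of_nat_le (x := 1000) 10 (by norm_num) ?_)).trans
      (by norm_num)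
    push_cast; nlinarith
  · rw [Real.exp_neg, ← div_eq_mul_inv, one_le_div (Real.exp_pos _), pow_mul]
    exact exp_le_pow_of_le (by norm_num) _
  · have e1 : Real.exp (-(2 * n : ℝ)) ≤ 0.97 * Real.exp (-(n : ℝ)) := by
      rw [show -(2 * n : ℝ) = -n + -n by ring, Real.exp_add]
      gcongr
      refine (Real.exp_le_exp.2 (neg_le_neg hn1)).trans ?_
      rw [Real.exp_neg]
      exact (inv_anti₀ (by norm_num) Real.exp_one_gt_d9.le).trans (by norm_num)
    calc Real.exp (-(6000 * n ^ 2 : ℝ)) ≤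
          Real.exp ((200 * (12 * n + 1) : ℕ) * (-(2 * n : ℝ)) + -1) := by
          apply Real.exp_le_exp.2; push_cast; nlinarith
      _ = Real.exp (-(2 * n : ℝ)) ^ (200 * (12 * n + 1)) * Real.exp (-1) := by
          rw [Real.exp_add, Real.exp_nat_mul]
      _ ≤ (0.97 * Real.exp (-(n : ℝ))) ^ (200 * (12 * n + 1)) * 2⁻¹ := by
          gcongr
          rw [Real.exp_neg]
          exact inv_anti₀ (by norm_num) (by linarith [Real.exp_one_gt_d9])
      _ = _ := by rw [div_eq_mul_inv]

lemma exists_card_reflect_ge {N : ℕ} {A : Finset ℤ} (hA : A ⊆ Ico 0 (N : ℤ)) :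
    ∃ c, (#A : ℝ) ^ 2 ≤ 2 * N * #(A.filter fun x => c - x ∈ A) := by
  rcases N.eq_zero_or_pos with rfl | hN
  · have : A = ∅ := by simpa using hA
    exact ⟨0, by simp [this]⟩
  have hmaps : ∀ x ∈ A ×ˢ A, x.1 + x.2 ∈ Ico (0 : ℤ) (2 * N) := by
    rintro ⟨x, y⟩ h
    have h1 := mem_Ico.1 (hA (mem_product.1 h).1)
    have h2 := mem_Ico.1 (hA (mem_product.1 h).2)
    simp only [mem_Ico]
    omega
  have hne : (Ico (0 : ℤ) (2 * N)).Nonempty := ⟨0, by simp; omega⟩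
  have hcard : (#(Ico (0 : ℤ) (2 * N)) : ℝ) = 2 * N := by
    have : #(Ico (0 : ℤ) (2 * N)) = 2 * N := by simp; omega
    rw [this]; push_cast; ring
  obtain ⟨c, -, hc⟩ := exists_le_card_fiber_of_nsmul_le_card_of_maps_to hmaps hne
    (b := (#A : ℝ) ^ 2 / (2 * N)) (by
      rw [nsmul_eq_mul, hcard, card_product, mul_div_cancel₀ _ (by positivity)]
      push_cast; nlinarith)
  refine ⟨c, ?_⟩
  rw [div_le_iff₀ (by positivity), mul_comm] at hc
  refine hc.trans ?_
  gcongr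
  refine card_le_card_of_injOn Prod.fst ?_ ?_
  · rintro ⟨x, y⟩ h
    simp only [coe_filter, mem_product, Set.mem_ofPred_eq] at h ⊢
    exact ⟨h.1.1, by rw [← h.2]; simpa using h.1.2⟩
  · rintro ⟨x, y⟩ h ⟨x', y'⟩ h' e
    simp only [coe_filter, mem_product, Set.mem_ofPred_eq] at h h' e
    ext
    · exact e
    · have := h.2.trans h'.2.symm
      simp only at this ⊢
      omega

lemma exists_pattern_of_lt_card_solutions {p N : ℕ} [Fact p.Prime] {A : Finset ℤ}
    (hA : A ⊆ Ico 0 (N : ℤ)) {a₁ a₂ : ℤ} (hcop : IsCoprime a₁ a₂)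
    (hp : (|a₂ - a₁| + |a₂| + |a₁|) * N < p)
    (h : p < #(solutions (A.image ((↑) : ℤ → ZMod p)) ((a₂ - a₁ : ℤ) : ZMod p) ((-a₂ : ℤ) : ZMod p)
      (a₁ : ZMod p))) :
    ∃ i s, s ≠ 0 ∧ i ∈ A ∧ i - a₁ * s ∈ A ∧ i - a₂ * s ∈ A := by
  classical
  obtain ⟨x, hx, hne⟩ : ∃ x ∈ solutions (A.image ((↑) : ℤ → ZMod p)) ((a₂ - a₁ : ℤ) : ZMod p)
      ((-a₂ : ℤ) : ZMod p) (a₁ : ZMod p), ¬(x.2.1 = x.1 ∧ x.2.2 = x.1) := by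
    by_contra! hcon
    refine h.not_ge ((card_le_card_of_injOn Prod.fst (fun _ _ => mem_univ _) ?_).trans
      (by rw [card_univ, ZMod.card]))
    intro x hx y hy e
    have h1 := hcon x hx
    have h2 := hcon y hy
    exact Prod.ext e (Prod.ext (by rw [h1.1, h2.1, e]) (by rw [h1.2, h2.2, e]))
  obtain ⟨x₁, x₂, x₃⟩ := x
  simp only [solutions, mem_filter, mem_product, mem_image] at hx
  obtain ⟨⟨⟨u, hu, rfl⟩, ⟨v, hv, rfl⟩, ⟨w, hw, rfl⟩⟩, he⟩ := hx
  have habs : ∀ {z}, z ∈ A → |z| ≤ N := by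
    intro z hz
    have := mem_Ico.1 (hA hz)
    rw [abs_le]; omega
  have he' : (a₂ - a₁) * u + -a₂ * v + a₁ * w = 0 := by
    have hdvd : (p : ℤ) ∣ (a₂ - a₁) * u + -a₂ * v + a₁ * w := by
      rw [← ZMod.intCast_zmod_eq_zero_iff_dvd]
      push_cast at he ⊢
      exact he
    refine Int.eq_zero_of_abs_lt_dvd hdvd (lt_of_le_of_lt ?_ hp)
    calc |(a₂ - a₁) * u + -a₂ * v + a₁ * w| ≤ |(a₂ - a₁) * u| + |-a₂ * v| + |a₁ * w| :=
          abs_add_three _ _ _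
      _ = |a₂ - a₁| * |u| + |a₂| * |v| + |a₁| * |w| := by simp only [abs_mul, abs_neg]
      _ ≤ |a₂ - a₁| * N + |a₂| * N + |a₁| * N := by
          gcongr <;> exact habs ‹_›
      _ = _ := by ring
  have he2 : a₂ * (u - v) = a₁ * (u - w) := by linear_combination he'
  obtain ⟨s, hs⟩ : a₁ ∣ u - v := hcop.dvd_of_dvd_mul_left ⟨_, he2⟩
  have hs' : a₁ * (a₂ * s) = a₁ * (u - w) := by rw [← he2, hs]; ring
  by_cases ha : a₁ = 0
  · subst ha
    have hu2 : IsUnit a₂ := isCoprime_zero_left.1 hcop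
    have huv : v = u := by rw [zero_mul] at hs; omega
    obtain ⟨t, ht⟩ := hu2.dvd (a := u - w)
    refine ⟨u, t, ?_, hu, by simpa using hu, by rw [← ht]; simpa using hw⟩
    rintro rfl
    exact hne ⟨by simp [huv], by simp at ht; simp; rw [show w = u by omega]⟩
  have hw' := mul_left_cancel₀ ha hs'
  refine ⟨u, s, ?_, hu, by rw [← hs]; simpa using hv, by rw [hw']; simpa using hw⟩
  rintro rfl
  refine hne ⟨?_, ?_⟩
  · simp only; congr 1; linarith
  · simp only; congr 1; linarith

/-- A three-point pattern with positive common difference occurs in any subset of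
`{0, ..., N - 1}` of density at least `exp (-n)` as soon as `N` is at least the exponential of
a fixed power of `n`. -/
theorem exists_pattern {a₁ a₂ : ℤ} (hcop : IsCoprime a₁ a₂) (h₁ : a₁ ≠ 0) (h₂ : a₂ ≠ 0)
    (hne : a₁ ≠ a₂) : ∃ C : ℕ, ∀ n N : ℕ, 1 ≤ n → Real.exp (C * n ^ 36) ≤ N → ∀ A : Finset ℤ,
      A ⊆ Ico 0 (N : ℤ) → Real.exp (-n) * N ≤ #A →
      ∃ i s, 0 < s ∧ i ∈ A ∧ i - a₁ * s ∈ A ∧ i - a₂ * s ∈ A := by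
  classical
  obtain ⟨C, hC⟩ := exists_card_solutions_ge
  set L : ℕ := (|a₂ - a₁| + |a₂| + |a₁|).natAbs with hL
  have hL' : (L : ℤ) = |a₂ - a₁| + |a₂| + |a₁| := by
    rw [hL]; exact Int.natAbs_of_nonneg (by positivity)
  have hL1 : 1 ≤ L := by
    have := abs_pos.2 h₁; have := abs_nonneg (a₂ - a₁); have := abs_nonneg a₂; omega
  have b₁ : |a₂ - a₁| ≤ L := by rw [hL']; linarith [abs_nonneg a₂, abs_nonneg a₁]
  have b₂ : |-a₂| ≤ L := by rw [hL', abs_neg]; linarith [abs_nonneg (a₂ - a₁), abs_nonneg a₁]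
  have b₃ : |a₁| ≤ L := by rw [hL']; linarith [abs_nonneg (a₂ - a₁), abs_nonneg a₂]
  refine ⟨C * (L ^ 2 + 2) * (4 * L + 2) ^ 36, fun n N hn hN A hA hdens => ?_⟩
  have hN0 : 0 < N := by
    have := (Real.exp_pos _).trans_le hN
    exact_mod_cast this
  obtain ⟨c, hc⟩ := exists_card_reflect_ge hA
  set A' := A.filter fun x => c - x ∈ A with hA'
  have hA'A : A' ⊆ A := filter_subset _ _
  have hLN : L * N ≠ 0 := by positivity
  obtain ⟨p, hp, hp1, hp2⟩ := Nat.exists_prime_lt_and_le_two_mul _ hLN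
  have : Fact p.Prime := ⟨hp⟩
  have hLp : L < p := lt_of_le_of_lt (Nat.le_mul_of_pos_right _ hN0) hp1
  have hNp : N < p := lt_of_le_of_lt (Nat.le_mul_of_pos_left _ hL1) hp1
  have hinj : Set.InjOn ((↑) : ℤ → ZMod p) A' := by
    intro x hx y hy e
    have hx := mem_Ico.1 (hA (hA'A hx))
    have hy := mem_Ico.1 (hA (hA'A hy))
    have : (p : ℤ) ∣ x - y := by
      rw [← ZMod.intCast_zmod_eq_zero_iff_dvd]; push_cast; rw [e, sub_self]
    have := Int.eq_zero_of_abs_lt_dvd this (by rw [abs_lt]; omega)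
    omega
  have hcast : ∀ z : ℤ, z ≠ 0 → |z| ≤ L → (z : ZMod p) ≠ 0 := by
    intro z hz hzL h0
    rw [ZMod.intCast_zmod_eq_zero_iff_dvd] at h0
    exact hz (Int.eq_zero_of_abs_lt_dvd h0 (by omega))
  have hbound : ∀ x y : ℤ, |x| ≤ L → |y| ≤ L → |(x * y : ℝ)| ≤ (L ^ 2 : ℕ) := by
    intro x y hx hy
    rw [← Int.cast_mul, ← Int.cast_abs, abs_mul]
    have : |x| * |y| ≤ L * L := mul_le_mul hx hy (abs_nonneg _) (by positivity)
    push_cast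
    rw [sq]
    exact_mod_cast this
  have hn1 : (1 : ℝ) ≤ n := by exact_mod_cast hn
  have hL1' : (1 : ℝ) ≤ L := by exact_mod_cast hL1
  have hN0' : (0 : ℝ) < N := by exact_mod_cast hN0
  have hp2' : (p : ℝ) ≤ 2 * (L * N) := by exact_mod_cast hp2
  have hdens' : Real.exp (-((4 * L + 2) * n : ℕ)) * p ≤
      #(A'.image ((↑) : ℤ → ZMod p)) := by
    rw [card_image_of_injOn hinj]
    have e1 : Real.exp (-(2 * n : ℝ)) * N ≤ 2 * #A' := by
      refine le_of_mul_le_mul_right ?_ hN0'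
      calc Real.exp (-(2 * n : ℝ)) * N * N = (Real.exp (-n) * N) ^ 2 := by
            rw [show -(2 * n : ℝ) = -n + -n by ring, Real.exp_add]; ring
        _ ≤ (#A : ℝ) ^ 2 := by gcongr
        _ ≤ _ := hc.trans (le_of_eq (by ring))
    have e2 : 4 * L * Real.exp (-((4 * L + 2) * n : ℕ)) ≤ Real.exp (-(2 * n : ℝ)) := by
      push_cast
      rw [show -((4 * L + 2) * n : ℝ) = -(4 * L * n) + -(2 * n) by ring, Real.exp_add,
        Real.exp_neg (4 * L * n : ℝ), ← mul_assoc]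
      refine mul_le_of_le_one_left (Real.exp_pos _).le ?_
      rw [← div_eq_mul_inv, div_le_one (Real.exp_pos _)]
      nlinarith [Real.add_one_le_exp (4 * L * n : ℝ)]
    calc Real.exp (-((4 * L + 2) * n : ℕ)) * p ≤
          Real.exp (-((4 * L + 2) * n : ℕ)) * (2 * (L * N)) := by gcongr
      _ = (4 * L * Real.exp (-((4 * L + 2) * n : ℕ))) * N / 2 := by ring
      _ ≤ Real.exp (-(2 * n : ℝ)) * N / 2 := by gcongr
      _ ≤ _ := by linarith
  have hcount := hC ((4 * L + 2) * n) (L ^ 2) p (by nlinarith) (Nat.one_le_pow _ _ hL1)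
    (A'.image ((↑) : ℤ → ZMod p)) hdens' (a₂ - a₁) (-a₂) a₁ (by ring)
    (hcast _ (sub_ne_zero.2 hne.symm) b₁) (hcast _ (neg_ne_zero.2 h₂) b₂) (hcast _ h₁ b₃)
    (hbound _ _ b₂ b₃) (hbound _ _ b₁ b₃) (hbound _ _ b₁ b₂)
  have hlt : p < #(solutions (A'.image ((↑) : ℤ → ZMod p)) ((a₂ - a₁ : ℤ) : ZMod p)
      ((-a₂ : ℤ) : ZMod p) (a₁ : ZMod p)) := by
    have hNp' : (N : ℝ) < p := by exact_mod_cast hNp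
    have : (p : ℝ) < #(solutions (A'.image ((↑) : ℤ → ZMod p)) ((a₂ - a₁ : ℤ) : ZMod p)
      ((-a₂ : ℤ) : ZMod p) (a₁ : ZMod p)) := by
      refine lt_of_lt_of_le ?_ hcount
      rw [Real.exp_neg, inv_mul_eq_div, lt_div_iff₀ (Real.exp_pos _), sq (p : ℝ)]
      have hp0 : (0 : ℝ) < p := by linarith
      refine mul_lt_mul_of_pos_left (lt_of_le_of_lt (le_of_eq ?_) (hN.trans_lt hNp')) hp0
      congr 1
      push_cast
      ring
    exact_mod_cast this
  obtain ⟨i, s, hs, hi, hi₁, hi₂⟩ := exists_pattern_of_lt_card_solutions (hA'A.trans hA) hcop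
    (by rw [← hL']; exact_mod_cast hp1) hlt
  rcases hs.lt_or_gt with hs | hs
  · refine ⟨c - i, -s, by omega, (mem_filter.1 hi).2, ?_, ?_⟩
    · convert (mem_filter.1 hi₁).2 using 1; ring
    · convert (mem_filter.1 hi₂).2 using 1; ring
  · exact ⟨i, s, hs, hA'A hi, hA'A hi₁, hA'A hi₂⟩

lemma sum_pattern_ge {a₁ a₂ : ℤ} (h₁ : a₁ ≠ 0) {N : ℕ} (hN : 0 < N) {δ : ℝ} (hδ : 0 < δ)
    (hpat : ∀ A : Finset ℤ, A ⊆ Ico 0 (N : ℤ) → δ / 8 * N ≤ #A →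
      ∃ i s, 0 < s ∧ i ∈ A ∧ i - a₁ * s ∈ A ∧ i - a₂ * s ∈ A)
    {g : ℤ → ℝ} (hg0 : ∀ i, 0 ≤ g i) (hg1 : ∀ i, g i ≤ 1) :
    (δ / 8) ^ 3 * ((∑ i ∈ Ico 0 (N : ℤ), g i) / N - δ / 4) ≤
      ∑ s ∈ Ico 1 (N : ℤ), ∑ i ∈ Ico 0 (N : ℤ), g i * g (i - a₁ * s) * g (i - a₂ * s) := by
  have hN0 : (0 : ℝ) < N := by exact_mod_cast hN
  have hcard : (#(Ico 0 (N : ℤ)) : ℝ) = N := by simp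
  have hnn : ∀ s i, 0 ≤ g i * g (i - a₁ * s) * g (i - a₂ * s) := fun s i =>
    mul_nonneg (mul_nonneg (hg0 _) (hg0 _)) (hg0 _)
  rcases le_total ((∑ i ∈ Ico 0 (N : ℤ), g i) / N) (δ / 4) with hm | hm
  · exact (mul_nonpos_of_nonneg_of_nonpos (by positivity) (by linarith)).trans
      (sum_nonneg fun s _ => sum_nonneg fun i _ => hnn s i)
  set A := (Ico 0 (N : ℤ)).filter fun i => δ / 8 ≤ g i with hA
  have hAsub : A ⊆ Ico 0 (N : ℤ) := filter_subset _ _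
  have hAcard : δ / 8 * N ≤ #A := by
    have h2 : ∑ i ∈ Ico 0 (N : ℤ), g i ≤ #A + δ / 8 * N := by
      calc ∑ i ∈ Ico 0 (N : ℤ), g i
          ≤ ∑ i ∈ Ico 0 (N : ℤ), ((if δ / 8 ≤ g i then 1 else 0) + δ / 8) := by
            refine sum_le_sum fun i _ => ?_
            split_ifs with h
            · linarith [hg1 i]
            · linarith
        _ = _ := by
            rw [sum_add_distrib, sum_const, nsmul_eq_mul, hcard, hA, card_filter]
            push_cast; ring
    rw [le_div_iff₀ hN0] at hm
    linarith
  obtain ⟨i, s, hs, hi, hi₁, hi₂⟩ := hpat A hAsub hAcard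
  have hsN : s < N := by
    have e1 := mem_Ico.1 (hAsub hi)
    have e2 := mem_Ico.1 (hAsub hi₁)
    have e3 : |a₁ * s| < N := by rw [abs_lt]; omega
    rw [abs_mul, abs_of_pos hs] at e3
    nlinarith [abs_pos.2 h₁]
  have hmean : (∑ i ∈ Ico 0 (N : ℤ), g i) / N ≤ 1 := by
    rw [div_le_one hN0]
    have := sum_le_card_nsmul (Ico 0 (N : ℤ)) g 1 fun i _ => hg1 i
    rwa [nsmul_eq_mul, hcard, mul_one] at this
  calc (δ / 8) ^ 3 * ((∑ i ∈ Ico 0 (N : ℤ), g i) / N - δ / 4) ≤ (δ / 8) ^ 3 * 1 := by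
        gcongr; linarith
    _ = δ / 8 * (δ / 8) * (δ / 8) := by ring
    _ ≤ g i * g (i - a₁ * s) * g (i - a₂ * s) :=
        mul_le_mul (mul_le_mul (mem_filter.1 hi).2 (mem_filter.1 hi₁).2 (by positivity) (hg0 _))
          (mem_filter.1 hi₂).2 (by positivity) (mul_nonneg (hg0 _) (hg0 _))
    _ ≤ ∑ i ∈ Ico 0 (N : ℤ), g i * g (i - a₁ * s) * g (i - a₂ * s) :=
        single_le_sum (f := fun i => g i * g (i - a₁ * s) * g (i - a₂ * s))
          (fun i _ => hnn s i) (hAsub hi)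
    _ ≤ _ := single_le_sum
          (f := fun s => ∑ i ∈ Ico 0 (N : ℤ), g i * g (i - a₁ * s) * g (i - a₂ * s))
          (fun s _ => sum_nonneg fun i _ => hnn s i) (mem_Ico.2 ⟨by omega, hsN⟩)

section Real

variable {f : ℝ → ℝ} (hfs : ∀ x, x ∉ Set.Icc (0 : ℝ) 1 → f x = 0)

include hfs

lemma setIntegral_mul_translates (u v : ℝ) :
    ∫ x in Set.Icc (0 : ℝ) 1, f x * f (x - u) * f (x - v) =
      ∫ x, f x * f (x - u) * f (x - v) :=
  setIntegral_eq_integral_of_forall_compl_eq_zero fun x hx => by simp [hfs x hx]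

lemma setIntegral_translate_ge {δ : ℝ} (hδ : δ ≤ ∫ x in Set.Icc (0 : ℝ) 1, f x) {u : ℝ}
    (hu0 : 0 ≤ u) (hu1 : u ≤ 1) : δ ≤ ∫ x in Set.Icc (-1 : ℝ) 1, f (x + u) := by
  refine hδ.trans (le_of_eq ?_)
  rw [setIntegral_eq_integral_of_forall_compl_eq_zero hfs,
    setIntegral_eq_integral_of_forall_compl_eq_zero fun x hx => hfs _ fun hx' => hx ?_,
    integral_add_right_eq_self]
  simp only [Set.mem_Icc] at hx' ⊢
  constructor <;> linarith

variable (hf : Measurable f) (hf0 : ∀ x, 0 ≤ f x) (hf1 : ∀ x, f x ≤ 1)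

include hf hf0 hf1

lemma integrable_of_support_Icc : Integrable f := by
  have h : Integrable ((Set.Icc (0 : ℝ) 1).indicator fun _ => (1 : ℝ)) :=
    (integrable_indicator_iff measurableSet_Icc).2 (by simp [integrableOn_const_iff])
  refine h.mono' hf.aestronglyMeasurable (Filter.Eventually.of_forall fun x => ?_)
  rw [Real.norm_of_nonneg (hf0 x)]
  by_cases hx : x ∈ Set.Icc (0 : ℝ) 1
  · rw [Set.indicator_of_mem hx]; exact hf1 x
  · rw [Set.indicator_of_notMem hx, hfs x hx]

lemma integrable_mul_translates (u v : ℝ) :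
    Integrable fun x => f x * f (x - u) * f (x - v) := by
  refine (integrable_of_support_Icc hfs hf hf0 hf1).mono'
    (by fun_prop) (Filter.Eventually.of_forall fun x => ?_)
  rw [Real.norm_of_nonneg (mul_nonneg (mul_nonneg (hf0 _) (hf0 _)) (hf0 _)), mul_assoc]
  exact mul_le_of_le_one_right (hf0 _) (mul_le_one₀ (hf1 _) (hf0 _) (hf1 _))

lemma sum_integral_ge {a₁ a₂ : ℤ} (h₁ : a₁ ≠ 0) {N : ℕ} (hN : 0 < N) {δ : ℝ} (hδ : 0 < δ)
    (hpat : ∀ A : Finset ℤ, A ⊆ Ico 0 (N : ℤ) → δ / 8 * N ≤ #A →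
      ∃ i s, 0 < s ∧ i ∈ A ∧ i - a₁ * s ∈ A ∧ i - a₂ * s ∈ A)
    (hfδ : δ ≤ ∫ x in Set.Icc (0 : ℝ) 1, f x) {r : ℝ} (hr : 0 ≤ r) (hrN : r * N ≤ 1) :
    (δ / 8) ^ 3 * (δ / 2) ≤ ∑ s ∈ Ico 1 (N : ℤ), N *
      ∫ x in Set.Icc (0 : ℝ) 1, f x * f (x - a₁ * (r * s)) * f (x - a₂ * (r * s)) := by
  have hN0 : (0 : ℝ) < N := by exact_mod_cast hN
  have hInt : ∀ u v w : ℝ, Integrable fun x => f (x + u) * f (x + u - v) * f (x + u - w) :=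
    fun u v w => (integrable_mul_translates hfs hf hf0 hf1 v w).comp_add_right u
  have hInt1 : ∀ u : ℝ, Integrable fun x => f (x + u) := fun u =>
    (integrable_of_support_Icc hfs hf hf0 hf1).comp_add_right u
  have hconst : IntegrableOn (fun _ : ℝ => δ / 4) (Set.Icc (-1 : ℝ) 1) := by
    simp [integrableOn_const_iff]
  calc (δ / 8) ^ 3 * (δ / 2) = (δ / 8) ^ 3 * ((∑ i ∈ Ico 0 (N : ℤ), δ) / N - δ / 2) := by
        rw [sum_const, nsmul_eq_mul]; simp; left; field_simp; ring
    _ ≤ (δ / 8) ^ 3 * ((∑ i ∈ Ico 0 (N : ℤ), ∫ x in Set.Icc (-1 : ℝ) 1, f (x + r * i)) / N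
          - δ / 2) := by
        gcongr with i hi
        have hi' := mem_Ico.1 hi
        have e1 : (0 : ℝ) ≤ i := by exact_mod_cast hi'.1
        have e2 : (i : ℝ) ≤ N := by exact_mod_cast hi'.2.le
        exact setIntegral_translate_ge hfs hfδ (by positivity)
          (le_trans (by gcongr) hrN)
    _ = ∫ x in Set.Icc (-1 : ℝ) 1,
          (δ / 8) ^ 3 * ((∑ i ∈ Ico 0 (N : ℤ), f (x + r * i)) / N - δ / 4) := by
        rw [integral_const_mul, integral_sub _ hconst, integral_div, integral_finsetSum]
        · congr 2
          simp
          ring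
        · exact fun i _ => (hInt1 _).integrableOn
        · exact (integrable_finsetSum _ fun i _ => (hInt1 _).integrableOn).div_const _
    _ ≤ ∫ x in Set.Icc (-1 : ℝ) 1, ∑ s ∈ Ico 1 (N : ℤ), ∑ i ∈ Ico 0 (N : ℤ),
          f (x + r * i) * f (x + r * i - a₁ * (r * s)) * f (x + r * i - a₂ * (r * s)) := by
        refine integral_mono ?_ ?_ fun x => ?_
        · exact (((integrable_finsetSum _ fun i _ => (hInt1 _).integrableOn).div_const _).sub
            hconst).const_mul _
        · exact integrable_finsetSum _ fun s _ => integrable_finsetSum _ fun i _ =>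
            (hInt _ _ _).integrableOn
        · refine (sum_pattern_ge h₁ hN hδ hpat (g := fun i => f (x + r * i)) (fun _ => hf0 _)
            fun _ => hf1 _).trans (le_of_eq ?_)
          refine sum_congr rfl fun s _ => sum_congr rfl fun i _ => ?_
          have e : ∀ a : ℤ, x + r * ((i - a * s : ℤ) : ℝ) = x + r * i - a * (r * s) := fun a => by
            push_cast; ring
          simp only [e]
    _ = ∑ s ∈ Ico 1 (N : ℤ), ∑ i ∈ Ico 0 (N : ℤ), ∫ x in Set.Icc (-1 : ℝ) 1,
          f (x + r * i) * f (x + r * i - a₁ * (r * s)) * f (x + r * i - a₂ * (r * s)) := by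
        rw [integral_finsetSum]
        · refine sum_congr rfl fun s _ => integral_finsetSum _ fun i _ => ?_
          exact (hInt _ _ _).integrableOn
        · exact fun s _ => integrable_finsetSum _ fun i _ => (hInt _ _ _).integrableOn
    _ ≤ _ := by
        refine sum_le_sum fun s _ => ?_
        refine (sum_le_card_nsmul _ _ (∫ x in Set.Icc (0 : ℝ) 1,
          f x * f (x - a₁ * (r * s)) * f (x - a₂ * (r * s))) fun i _ => ?_).trans
          (le_of_eq (by simp))
        rw [setIntegral_mul_translates hfs, ← integral_add_right_eq_self
          (fun x => f x * f (x - a₁ * (r * s)) * f (x - a₂ * (r * s))) (r * i)]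
        exact setIntegral_le_integral (hInt _ _ _) (Filter.Eventually.of_forall fun x =>
          mul_nonneg (mul_nonneg (hf0 _) (hf0 _)) (hf0 _))

lemma integrableOn_inner (θ₁ θ₂ : ℝ) {s : Set ℝ} (hs : volume s ≠ ⊤) :
    IntegrableOn (fun t => ∫ x in Set.Icc (0 : ℝ) 1, f x * f (x - θ₁ * t) * f (x - θ₂ * t)) s := by
  have hm : StronglyMeasurable
      fun t => ∫ x in Set.Icc (0 : ℝ) 1, f x * f (x - θ₁ * t) * f (x - θ₂ * t) := by
    refine StronglyMeasurable.integral_prod_right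
      (f := fun t x => f x * f (x - θ₁ * t) * f (x - θ₂ * t)) ?_
    exact Measurable.stronglyMeasurable (by unfold Function.uncurry; fun_prop)
  refine Measure.integrableOn_of_bounded (M := ∫ x, f x) hs hm.aestronglyMeasurable
    (Filter.Eventually.of_forall fun t => ?_)
  rw [setIntegral_mul_translates hfs, Real.norm_of_nonneg]
  · refine integral_mono (integrable_mul_translates hfs hf hf0 hf1 _ _)
      (integrable_of_support_Icc hfs hf hf0 hf1) fun x => ?_
    simp only [mul_assoc]
    exact mul_le_of_le_one_right (hf0 _) (mul_le_one₀ (hf1 _) (hf0 _) (hf1 _))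
  · exact integral_nonneg fun x => mul_nonneg (mul_nonneg (hf0 _) (hf0 _)) (hf0 _)

end Real

lemma intervalIntegral_dilate_le {F : ℝ → ℝ} (hF : ∀ t, 0 ≤ F t)
    (hInt : IntegrableOn F (Set.Icc 0 1)) {b c : ℝ} (hb : 0 ≤ b) (hc : 0 < c) (hbc : b * c ≤ 1) :
    ∫ r in 0..b, F (r * c) ≤ c⁻¹ * ∫ t in Set.Icc (0 : ℝ) 1, F t := by
  rw [intervalIntegral.integral_comp_mul_right _ hc.ne', smul_eq_mul, zero_mul,
    intervalIntegral.integral_of_le (by positivity)]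
  have hsub : Set.Ioc 0 (b * c) ⊆ Set.Icc 0 1 := fun t ht => ⟨ht.1.le, ht.2.trans hbc⟩
  exact mul_le_mul_of_nonneg_left (setIntegral_mono_set hInt (Filter.Eventually.of_forall hF)
    (Filter.Eventually.of_forall hsub)) (by positivity)

lemma integral_integral_ge {f : ℝ → ℝ} (hf : Measurable f) (hf0 : ∀ x, 0 ≤ f x)
    (hf1 : ∀ x, f x ≤ 1) (hfs : ∀ x, x ∉ Set.Icc (0 : ℝ) 1 → f x = 0)
    {a₁ a₂ : ℤ} (h₁ : a₁ ≠ 0) {N : ℕ} (hN : 0 < N) {δ : ℝ} (hδ : 0 < δ)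
    (hpat : ∀ A : Finset ℤ, A ⊆ Ico 0 (N : ℤ) → δ / 8 * N ≤ #A →
      ∃ i s, 0 < s ∧ i ∈ A ∧ i - a₁ * s ∈ A ∧ i - a₂ * s ∈ A)
    (hfδ : δ ≤ ∫ x in Set.Icc (0 : ℝ) 1, f x) {γ : ℝ} (hγ : 0 < γ) :
    (δ / 8) ^ 3 * (δ / 2) * (min 1 γ / γ) / N ^ 3 ≤ ∫ t in Set.Icc (0 : ℝ) 1,
      ∫ x in Set.Icc (0 : ℝ) 1, f x * f (x - γ * a₁ * t) * f (x - γ * a₂ * t) := by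
  set F : ℝ → ℝ := fun t =>
    ∫ x in Set.Icc (0 : ℝ) 1, f x * f (x - γ * a₁ * t) * f (x - γ * a₂ * t) with hF
  have hF0 : ∀ t, 0 ≤ F t := fun t =>
    integral_nonneg fun x => mul_nonneg (mul_nonneg (hf0 _) (hf0 _)) (hf0 _)
  have hFint : ∀ {s : Set ℝ}, volume s ≠ ⊤ → IntegrableOn F s := fun hs =>
    integrableOn_inner hfs hf hf0 hf1 _ _ hs
  have hN0 : (0 : ℝ) < N := by exact_mod_cast hN
  have hγ' : 0 < min 1 γ := lt_min one_pos hγ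
  have hb0 : 0 ≤ min 1 γ / N := by positivity
  have hFc : ∀ c : ℝ, c ≠ 0 → IntervalIntegrable (fun r => F (r * c)) volume 0 (min 1 γ / N) := by
    intro c hc
    have h : IntervalIntegrable F volume (0 * c) (min 1 γ / N * c) :=
      (intervalIntegrable_iff.2 (hFint (by simp [Set.uIoc])))
    simpa [hc] using h.comp_mul_right (c := c)
  have hs0 : ∀ s ∈ Ico 1 (N : ℤ), (1 : ℝ) ≤ s ∧ (s : ℝ) ≤ N := fun s hs => by
    have := mem_Ico.1 hs
    exact ⟨by exact_mod_cast this.1, by exact_mod_cast this.2.le⟩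
  have hpoint : ∀ r ∈ Set.Icc 0 (min 1 γ / N), (δ / 8) ^ 3 * (δ / 2) ≤
      ∑ s ∈ Ico 1 (N : ℤ), N * F (r * (s / γ)) := by
    intro r hr
    refine (sum_integral_ge hfs hf hf0 hf1 h₁ hN hδ hpat hfδ hr.1 ?_).trans (le_of_eq ?_)
    · have := mul_le_mul_of_nonneg_right hr.2 hN0.le
      rw [div_mul_cancel₀ _ hN0.ne'] at this
      exact this.trans (min_le_left _ _)
    · refine sum_congr rfl fun s _ => ?_
      have e : ∀ a : ℝ, a * (r * s) = γ * a * (r * (s / γ)) := fun a => by field_simp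
      simp only [hF, e]
  have hFs : ∀ s ∈ Ico 1 (N : ℤ),
      IntervalIntegrable (fun r => N * F (r * (s / γ))) volume 0 (min 1 γ / N) := fun s hs => by
    have := (hs0 s hs).1
    exact (hFc (s / γ) (by positivity)).const_mul (N : ℝ)
  have hsum : IntervalIntegrable (fun r => ∑ s ∈ Ico 1 (N : ℤ), N * F (r * (s / γ))) volume 0
      (min 1 γ / N) := by
    simpa [Finset.sum_fn] using IntervalIntegrable.sum _ hFs
  have hInt := intervalIntegral.integral_mono_on hb0 intervalIntegrable_const hsum hpoint
  rw [intervalIntegral.integral_const, smul_eq_mul, sub_zero] at hInt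
  have hupper : ∫ r in 0..min 1 γ / N, ∑ s ∈ Ico 1 (N : ℤ), N * F (r * (s / γ)) ≤
      N ^ 2 * γ * ∫ t in Set.Icc (0 : ℝ) 1, F t := by
    rw [intervalIntegral.integral_finsetSum hFs]
    have hI0 : 0 ≤ ∫ t in Set.Icc (0 : ℝ) 1, F t := integral_nonneg hF0
    have hterm : ∀ s ∈ Ico 1 (N : ℤ), ∫ r in 0..min 1 γ / N, N * F (r * (s / γ)) ≤
        N * γ * ∫ t in Set.Icc (0 : ℝ) 1, F t := by
      intro s hs
      obtain ⟨hs1, hsN⟩ := hs0 s hs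
      rw [intervalIntegral.integral_const_mul, mul_assoc]
      gcongr
      refine (intervalIntegral_dilate_le hF0 (hFint (by simp)) hb0 (by positivity) ?_).trans ?_
      · calc min 1 γ / N * (s / γ) ≤ γ / N * (N / γ) := by gcongr; exact min_le_right _ _
          _ = 1 := by field_simp
      · gcongr
        rw [inv_div]
        exact div_le_self hγ.le hs1
    refine (sum_le_card_nsmul _ _ _ hterm).trans ?_
    rw [nsmul_eq_mul]
    have hcard : (#(Ico 1 (N : ℤ)) : ℝ) ≤ N := by
      have : #(Ico 1 (N : ℤ)) ≤ N := by simp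
      exact_mod_cast this
    calc _ ≤ (N : ℝ) * (N * γ * ∫ t in Set.Icc (0 : ℝ) 1, F t) := by gcongr
      _ = _ := by ring
  have hfin := hInt.trans hupper
  rw [div_le_iff₀ (by positivity), ← mul_div_assoc, div_le_iff₀ hγ]
  rw [div_mul_eq_mul_div, div_le_iff₀ hN0] at hfin
  linarith

lemma pow_le_exp_add_const (D : ℝ) (hD : 0 < D) (k : ℕ) :
    ∃ K, ∀ u : ℝ, 0 ≤ u → D * (u + 4) ^ k ≤ Real.exp (u / 2) + K := by
  set V := D * 2 ^ k * (k + 1).factorial * Real.exp 2 with hV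
  have hV0 : 0 < V := by positivity
  refine ⟨D * 2 ^ k * V ^ k, fun u hu => ?_⟩
  set v := (u + 4) / 2 with hv
  have hv0 : 0 < v := by positivity
  have e1 : D * (u + 4) ^ k = D * 2 ^ k * v ^ k := by
    rw [hv, div_pow]; field_simp
  have e2 : Real.exp (u / 2) = Real.exp v / Real.exp 2 := by
    rw [← Real.exp_sub, hv]; congr 1; ring
  rw [e1, e2]
  rcases le_total v V with h | h
  · have : D * 2 ^ k * v ^ k ≤ D * 2 ^ k * V ^ k := by gcongr
    have : 0 ≤ Real.exp v / Real.exp 2 := by positivity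
    linarith
  · have h1 : D * 2 ^ k * v ^ k ≤ Real.exp v / Real.exp 2 := by
      rw [le_div_iff₀ (Real.exp_pos _)]
      refine le_trans ?_ (Real.pow_div_factorial_le_exp v hv0.le (k + 1))
      rw [le_div_iff₀ (by positivity), pow_succ]
      calc D * 2 ^ k * v ^ k * Real.exp 2 * (k + 1).factorial = V * v ^ k := by rw [hV]; ring
        _ ≤ v * v ^ k := by gcongr
        _ = _ := mul_comm _ _
    have : 0 ≤ D * 2 ^ k * V ^ k := by positivity
    linarith

/-- Two distinct nonzero rationals are, up to a common positive factor, coprime integers. -/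
lemma exists_coprime_of_rat {z₁ z₂ : ℤ} {N₁ N₂ : ℕ} (hN₁ : 1 ≤ N₁) (hN₂ : 1 ≤ N₂)
    (h : (z₁ : ℝ) / N₁ ≠ z₂ / N₂) (h₁ : (z₁ : ℝ) / N₁ ≠ 0) (h₂ : (z₂ : ℝ) / N₂ ≠ 0) :
    ∃ (γ : ℝ) (a₁ a₂ : ℤ), 0 < γ ∧ IsCoprime a₁ a₂ ∧ a₁ ≠ 0 ∧ a₂ ≠ 0 ∧ a₁ ≠ a₂ ∧
      (z₁ : ℝ) / N₁ = γ * a₁ ∧ (z₂ : ℝ) / N₂ = γ * a₂ := by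
  have hN₁' : (0 : ℝ) < N₁ := by exact_mod_cast hN₁
  have hN₂' : (0 : ℝ) < N₂ := by exact_mod_cast hN₂
  have hz₁ : z₁ ≠ 0 := by rintro rfl; simp at h₁
  have hg : 0 < Int.gcd (z₁ * N₂) (z₂ * N₁) :=
    Int.gcd_pos_of_ne_zero_left _ (mul_ne_zero hz₁ (by exact_mod_cast hN₂'.ne'))
  obtain ⟨a₁, a₂, hcop, e₁, e₂⟩ := Int.exists_gcd_one hg
  set g := Int.gcd (z₁ * N₂) (z₂ * N₁)
  have hg' : (0 : ℝ) < g := by exact_mod_cast hg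
  have e₁' : (z₁ : ℝ) * N₂ = a₁ * g := by exact_mod_cast e₁
  have e₂' : (z₂ : ℝ) * N₁ = a₂ * g := by exact_mod_cast e₂
  have t₁ : (z₁ : ℝ) / N₁ = g / (N₁ * N₂) * a₁ := by
    field_simp; linarith
  have t₂ : (z₂ : ℝ) / N₂ = g / (N₁ * N₂) * a₂ := by
    field_simp; linarith
  refine ⟨g / (N₁ * N₂), a₁, a₂, by positivity, Int.isCoprime_iff_gcd_eq_one.2 hcop, ?_, ?_, ?_,
    t₁, t₂⟩
  · rintro rfl; simp [t₁] at h₁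
  · rintro rfl; simp [t₂] at h₂
  · rintro rfl; exact h (t₁.trans t₂.symm)

/-- A lower bound for the count of three-point patterns in a function on the unit interval. -/
theorem exists_integral_integral_ge {a₁ a₂ : ℤ} (hcop : IsCoprime a₁ a₂) (h₁ : a₁ ≠ 0)
    (h₂ : a₂ ≠ 0) (hne : a₁ ≠ a₂) {γ : ℝ} (hγ : 0 < γ) : ∃ CM : ℝ, 0 < CM ∧
      ∀ δ : ℝ, 0 < δ → δ < 1 → ∀ f : ℝ → ℝ, Measurable f → (∀ x, 0 ≤ f x) → (∀ x, f x ≤ 1) →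
        (∀ x, x ∉ Set.Icc (0 : ℝ) 1 → f x = 0) → δ ≤ ∫ x in Set.Icc (0 : ℝ) 1, f x →
        CM⁻¹ * Real.exp (-δ ^ (-(1 / 2 : ℝ))) ≤ ∫ t in Set.Icc (0 : ℝ) 1,
          ∫ x in Set.Icc (0 : ℝ) 1, f x * f (x - γ * a₁ * t) * f (x - γ * a₂ * t) := by
  obtain ⟨C, hC⟩ := exists_pattern hcop h₁ h₂ hne
  obtain ⟨K, hK⟩ := pow_le_exp_add_const (3 * C + 8) (by positivity) 36
  have hγ' : 0 < min 1 γ := lt_min one_pos hγ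
  refine ⟨(min 1 γ / γ)⁻¹ * Real.exp K, by positivity, fun δ hδ hδ1 f hf hf0 hf1 hfs hfδ => ?_⟩
  set u := Real.log (1 / δ) with hu
  have hu0 : 0 ≤ u := Real.log_nonneg (by rw [le_div_iff₀ hδ]; linarith)
  have hδu : δ = Real.exp (-u) := by
    rw [hu, one_div, Real.log_inv, neg_neg, Real.exp_log hδ]
  set n := ⌈u + 3⌉₊ with hn
  have hn1 : 1 ≤ n := Nat.one_le_iff_ne_zero.2 (Nat.ceil_pos.2 (by linarith)).ne'
  have hnu : u + 3 ≤ n := Nat.le_ceil _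
  have hnu' : (n : ℝ) ≤ u + 4 := by
    have := Nat.ceil_lt_add_one (show 0 ≤ u + 3 by linarith)
    linarith
  have hn1' : (1 : ℝ) ≤ n := by exact_mod_cast hn1
  have hδn : Real.exp (-n) ≤ δ / 8 := by
    have h8 : (8 : ℝ) ≤ Real.exp 3 := by linarith [sixteen_le_exp_three]
    calc Real.exp (-n) ≤ Real.exp (-u + -3) := Real.exp_le_exp.2 (by linarith)
      _ = δ * (Real.exp 3)⁻¹ := by rw [Real.exp_add, ← hδu, Real.exp_neg]
      _ ≤ δ * 8⁻¹ := by gcongr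
      _ = _ := by ring
  set N := ⌈Real.exp (C * n ^ 36)⌉₊ with hN
  have hN0 : 0 < N := Nat.ceil_pos.2 (Real.exp_pos _)
  have hNle : (N : ℝ) ≤ Real.exp (C * n ^ 36 + 1) := by
    have h1 := Nat.ceil_lt_add_one (Real.exp_pos (C * (n : ℝ) ^ 36)).le
    have h2 : 1 ≤ Real.exp (C * (n : ℝ) ^ 36) := Real.one_le_exp (by positivity)
    rw [Real.exp_add]
    nlinarith [Real.exp_one_gt_d9]
  have hN0' : (0 : ℝ) < N := by exact_mod_cast hN0
  have hmain := integral_integral_ge hf hf0 hf1 hfs (a₂ := a₂) h₁ hN0 hδ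
    (fun A hA hcard => hC n N hn1 (Nat.le_ceil _) A hA (le_trans (by gcongr) hcard)) hfδ hγ
  refine le_trans ?_ hmain
  have hpow : δ ^ (-(1 / 2 : ℝ)) = Real.exp (u / 2) := by
    rw [hδu, ← Real.exp_mul]; congr 1; ring
  have hexp : Real.exp (-(4 * n) - 3 * (C * n ^ 36 + 1)) ≤ (δ / 8) ^ 3 * (δ / 2) / N ^ 3 := by
    rw [Real.exp_sub]
    have e1 : Real.exp (-(4 * n : ℝ)) ≤ (δ / 8) ^ 3 * (δ / 2) := by
      calc Real.exp (-(4 * n : ℝ)) = Real.exp (-n) ^ 3 * Real.exp (-n) := by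
            rw [← pow_succ, ← Real.exp_nat_mul]; congr 1; push_cast; ring
        _ ≤ (δ / 8) ^ 3 * (δ / 2) := by gcongr; linarith
    have e2 : (N : ℝ) ^ 3 ≤ Real.exp (3 * (C * n ^ 36 + 1)) := by
      calc (N : ℝ) ^ 3 ≤ Real.exp (C * n ^ 36 + 1) ^ 3 := by gcongr
        _ = _ := by rw [← Real.exp_nat_mul]; norm_num
    exact div_le_div₀ (by positivity) e1 (by positivity) e2
  have hn36 : (n : ℝ) ≤ (n : ℝ) ^ 36 := le_self_pow₀ hn1' (by norm_num)
  have hle : 4 * (n : ℝ) + 3 * (C * n ^ 36 + 1) ≤ Real.exp (u / 2) + K := by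
    refine le_trans ?_ (hK u hu0)
    calc 4 * (n : ℝ) + 3 * (C * n ^ 36 + 1) ≤ (3 * C + 8) * (n : ℝ) ^ 36 := by linarith
      _ ≤ _ := by gcongr
  rw [hpow, mul_inv, inv_inv, ← Real.exp_neg K, mul_assoc, ← Real.exp_add]
  calc min 1 γ / γ * Real.exp (-K + -Real.exp (u / 2)) ≤
        min 1 γ / γ * Real.exp (-(4 * n) - 3 * (C * n ^ 36 + 1)) := by
        gcongr; linarith
    _ ≤ min 1 γ / γ * ((δ / 8) ^ 3 * (δ / 2) / N ^ 3) := by gcongr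
    _ = _ := by ring

end RothCount

/-- **Lemma (quantitative generalized Roth lower bound).** There is an absolute
constant `c ∈ (0,1)` such that for every `M` and distinct nonzero
`θ₁, θ₂ ∈ Q_M` there is `C_M > 0` with: for every `δ ∈ (0,1)` and every
`f : ℝ → [0,1]` supported in `[0,1]` with `∫₀¹ f ≥ δ`,
`∫₀¹∫₀¹ f(x) f(x−θ₁t) f(x−θ₂t) dx dt ≥ C_M⁻¹ exp(−δ^{−(1−c)})`. -/
theorem roth_count_lower_bound :
    ∃ c : ℝ, 0 < c ∧ c < 1 ∧
      ∀ (M : ℕ) (θ₁ θ₂ : ℝ), θ₁ ∈ QM M → θ₂ ∈ QM M → θ₁ ≠ θ₂ →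
        θ₁ ≠ 0 → θ₂ ≠ 0 →
        ∃ CM : ℝ, 0 < CM ∧
          ∀ δ : ℝ, 0 < δ → δ < 1 →
          ∀ f : ℝ → ℝ, Measurable f → (∀ x, 0 ≤ f x) → (∀ x, f x ≤ 1) →
            (∀ x, x ∉ Set.Icc (0:ℝ) 1 → f x = 0) →
            δ ≤ ∫ x in Set.Icc (0:ℝ) 1, f x →
            CM⁻¹ * Real.exp (-δ ^ (-(1 - c))) ≤
              ∫ t in Set.Icc (0:ℝ) 1, ∫ x in Set.Icc (0:ℝ) 1,
                f x * f (x - θ₁ * t) * f (x - θ₂ * t) := by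
  refine ⟨1 / 2, by norm_num, by norm_num, ?_⟩
  rintro M _ _ ⟨-, N₁, z₁, hN₁, -, rfl⟩ ⟨-, N₂, z₂, hN₂, -, rfl⟩ hne h₁ h₂
  obtain ⟨γ, a₁, a₂, hγ, hcop, ha₁, ha₂, ha, e₁, e₂⟩ :=
    RothCount.exists_coprime_of_rat hN₁ hN₂ hne h₁ h₂
  obtain ⟨CM, hCM, h⟩ := RothCount.exists_integral_integral_ge hcop ha₁ ha₂ ha hγ
  refine ⟨CM, hCM, fun δ hδ hδ1 f hf hf0 hf1 hfs hfδ => ?_⟩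
  rw [e₁, e₂, show (1 - 1 / 2 : ℝ) = 1 / 2 by norm_num]
  exact h δ hδ hδ1 f hf hf0 hf1 hfs hfδ
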